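/- There exists a natural number k such that every k-edge-connected finite simple graph G whose number of edges |E(G)| is divisible by 5 admits a decomposition into paths of length 5 (i.e., a set of pairwise edge-disjoint subgraphs of G, each isomorphic to the path P_5 with 5 edges, whose union is G). -/

import Mathlib

open SimpleGraph

/-- A graph `G` is `k`-edge-connected if it remains connected after the deletion of
any fewer than `k` edges. -/
def IsKEdgeConnected {V : Type} (G : SimpleGraph V) (k : ℕ) : Prop :=
  ∀ S : Finset (Sym2 V), S.card < k → (G.deleteEdges ↑S).Connected

/-- `D` is a decomposition of `G` into copies of `T`: a set of pairwise edge-disjoint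
subgraphs of `G`, each isomorphic to `T`, whose union is `G`. -/
def IsDecompInto {V W : Type} (G : SimpleGraph V) (T : SimpleGraph W)
    (D : Set G.Subgraph) : Prop :=
  (∀ H ∈ D, Nonempty (H.coe ≃g T)) ∧
  (∀ H ∈ D, ∀ K ∈ D, H ≠ K → Disjoint H.edgeSet K.edgeSet) ∧
  (⋃ H ∈ D, H.edgeSet) = G.edgeSet

namespace P5
open scoped Classical
set_option linter.unusedSectionVars false
/-- consecutive pairs of a list -/
noncomputable def ed {V : Type} : List V → Finset (Sym2 V)
  | [] => ∅
  | [_] => ∅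
  | a :: b :: l => insert s(a, b) (ed (b :: l))

/-- edge sets that decompose into paths with 5 edges -/
inductive PD {V : Type} : Finset (Sym2 V) → Prop
  | nil : PD ∅
  | cons {l : List V} {E : Finset (Sym2 V)} : l.Nodup → l.length = 6 → Disjoint (ed l) E →
      PD E → PD (ed l ∪ E)

section lists
variable {V : Type}

@[simp] lemma ed_nil : ed ([] : List V) = ∅ := rfl
@[simp] lemma ed_single (a : V) : ed [a] = ∅ := rfl
lemma ed_cons_cons (a b : V) (l : List V) : ed (a :: b :: l) = insert s(a, b) (ed (b :: l)) := rfl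

lemma mem_of_ed : ∀ {l : List V} {e : Sym2 V} {v : V}, e ∈ ed l → v ∈ e → v ∈ l
  | [], e, v, h, _ => by simp at h
  | [a], e, v, h, _ => by simp at h
  | a :: b :: l, e, v, h, hv => by
    rw [ed_cons_cons, Finset.mem_insert] at h
    rcases h with rfl | h
    · rw [Sym2.mem_iff] at hv
      rcases hv with rfl | rfl <;> simp
    · exact List.mem_cons_of_mem _ (mem_of_ed h hv)

lemma ed_append (l : List V) (v : V) (r : List V) :
    ed (l ++ v :: r) = ed (l ++ [v]) ∪ ed (v :: r) := by
  induction l with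
  | nil => simp
  | cons a l ih =>
    cases l with
    | nil => simp [ed_cons_cons]
    | cons b l =>
      simp only [List.cons_append, ed_cons_cons] at ih ⊢
      rw [ih, Finset.insert_union]

lemma ed_card {l : List V} (h : l.Nodup) : (ed l).card = l.length - 1 := by
  induction l with
  | nil => simp
  | cons a l ih =>
    cases l with
    | nil => simp
    | cons b l =>
      rw [ed_cons_cons, Finset.card_insert_of_notMem, ih (List.nodup_cons.1 h).2]
      · simp
      · intro hm
        exact (List.nodup_cons.1 h).1 (mem_of_ed hm (Sym2.mem_mk_left _ _))

lemma ed_reverse (l : List V) : ed l.reverse = ed l := by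
  induction l with
  | nil => simp
  | cons a l ih =>
    cases l with
    | nil => simp
    | cons b l =>
      rw [ed_cons_cons, ← ih]
      simp only [List.reverse_cons, List.append_assoc, List.cons_append, List.nil_append]
      rw [ed_append, ed_cons_cons, ed_single, Finset.union_comm, Sym2.eq_swap]
      simp

/-- e in ed l is not diagonal when nodup -/
lemma ed_not_isDiag {l : List V} (h : l.Nodup) {e : Sym2 V} (he : e ∈ ed l) : ¬ e.IsDiag := by
  induction l with
  | nil => simp at he
  | cons a l ih =>
    cases l with
    | nil => simp at he
    | cons b l =>
      rw [ed_cons_cons, Finset.mem_insert] at he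
      rcases he with rfl | he
      · simp only [Sym2.mk_isDiag_iff]
        rintro rfl
        simp at h
      · exact ih (List.nodup_cons.1 h).2 he

lemma PD.union {A B : Finset (Sym2 V)} (hA : PD A) (hB : PD B) (h : Disjoint A B) : PD (A ∪ B) := by
  induction hA with
  | nil => simpa
  | @cons l E h1 h2 h3 h4 ih =>
    rw [Finset.union_assoc]
    rw [Finset.disjoint_union_left] at h
    refine PD.cons h1 h2 ?_ (ih h.2)
    rw [Finset.disjoint_union_right]
    exact ⟨h3, h.1⟩

lemma PD.card {A : Finset (Sym2 V)} (hA : PD A) : 5 ∣ A.card := by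
  induction hA with
  | nil => simp
  | @cons l E h1 h2 h3 h4 ih =>
    rw [Finset.card_union_of_disjoint h3, ed_card h1, h2]
    omega

lemma ed_disj_append {l : List V} {v : V} {r : List V} (h : (l ++ v :: r).Nodup) :
    Disjoint (ed (l ++ [v])) (ed (v :: r)) := by
  rw [Finset.disjoint_left]
  intro e h1 h2
  have hsub : ∀ x ∈ e, x = v := by
    intro x hx
    have a1 := mem_of_ed h1 hx
    have a2 := mem_of_ed h2 hx
    rw [List.nodup_append] at h
    simp only [List.mem_append, List.mem_singleton] at a1
    rcases a1 with a1 | a1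
    · exact absurd rfl (h.2.2 x a1 x a2)
    · exact a1
  have hn : (v :: r).Nodup := (List.nodup_append.1 h).2.1
  apply ed_not_isDiag hn h2
  induction e with
  | _ x y =>
    have := hsub x (Sym2.mem_mk_left _ _)
    have := hsub y (Sym2.mem_mk_right _ _)
    simp [*]

lemma cut (n : ℕ) : ∀ L : List V, L.Nodup → L.length = n + 1 →
    ∃ (C : List V) (E : Finset (Sym2 V)), C <:+ L ∧ C.length = n % 5 + 1 ∧ PD E ∧
      Disjoint E (ed C) ∧ ed L = E ∪ ed C := by
  induction n using Nat.strong_induction_on with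
  | _ n ih =>
    intro L hL hn
    by_cases h5 : n < 5
    · refine ⟨L, ∅, List.suffix_refl _, ?_, PD.nil, by simp, by simp⟩
      rw [Nat.mod_eq_of_lt h5, hn]
    · have e1 : L = L.take 5 ++ L.drop 5 := (List.take_append_drop 5 L).symm
      obtain ⟨v, r, hr⟩ : ∃ v r, L.drop 5 = v :: r := by
        cases hd : L.drop 5 with
        | nil => have := congrArg List.length hd; simp at this; omega
        | cons v r => exact ⟨v, r, rfl⟩
      rw [hr] at e1
      have hnr : (v :: r).length = (n - 5) + 1 := by
        rw [← hr]; simp; omega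
      have hLN := hL
      rw [e1] at hLN
      obtain ⟨C, E, hC, hCl, hE, hd, he⟩ := ih (n - 5) (by omega) (v :: r)
        ((List.nodup_append.1 hLN).2.1) hnr
      have hdis := ed_disj_append hLN
      rw [he, Finset.disjoint_union_right] at hdis
      refine ⟨C, ed (L.take 5 ++ [v]) ∪ E, ?_, ?_, ?_, ?_, ?_⟩
      · rw [e1]; exact hC.trans (List.suffix_append _ _)
      · rw [hCl]; omega
      · refine PD.cons ?_ ?_ hdis.1 hE
        · have : List.Sublist (L.take 5 ++ [v]) (L.take 5 ++ v :: r) := by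
            apply List.Sublist.append_left
            simp
          exact this.nodup hLN
        · simp; omega
      · rw [Finset.disjoint_union_left]; exact ⟨hdis.2, hd⟩
      · conv_lhs => rw [e1, ed_append, he]
        rw [Finset.union_assoc]

lemma PD_of_path {L : List V} (hL : L.Nodup) (h5 : 5 ∣ L.length - 1) : PD (ed L) := by
  rcases Nat.eq_zero_or_pos L.length with h0 | h0
  · rw [List.length_eq_zero_iff] at h0
    subst h0; exact PD.nil
  obtain ⟨C, E, hC, hCl, hE, hd, he⟩ := cut (L.length - 1) L hL (by omega)
  have : C.length = 1 := by omega
  rw [List.length_eq_one_iff] at this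
  obtain ⟨a, rfl⟩ := this
  rw [he]; simpa using hE

noncomputable def edU : List (List V) → Finset (Sym2 V)
  | [] => ∅
  | q :: qs => ed q ∪ edU qs

lemma mem_edU {qs : List (List V)} {e : Sym2 V} : e ∈ edU qs ↔ ∃ q ∈ qs, e ∈ ed q := by
  induction qs with
  | nil => simp [edU]
  | cons q qs ih => simp [edU, ih]

def Link (p q : List V) : Prop :=
  p.getLast? = q.head? ∧ ∀ x, x ∈ p → x ∈ q → q.head? = some x

lemma chainAux : ∀ (qs : List (List V)) (C : List V), C.Nodup → C.length ≤ 5 → C ≠ [] →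
    (∀ q ∈ qs, q.Nodup ∧ 6 ≤ q.length) → List.IsChain Link (C :: qs) →
    List.Pairwise (fun p q => Disjoint (ed p) (ed q)) (C :: qs) →
    5 ∣ (ed C ∪ edU qs).card → PD (ed C ∪ edU qs) := by
  intro qs
  induction qs with
  | nil =>
    intro C hC h5 _ _ _ _ hd
    simp only [edU, Finset.union_empty] at hd ⊢
    have : (ed C).card = 0 := by
      have := ed_card hC
      omega
    rw [Finset.card_eq_zero] at this
    rw [this]; exact PD.nil
  | cons q qs ih =>
    intro C hC h5 hne hq hch hpw hd
    rw [List.isChain_cons_cons] at hch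
    obtain ⟨⟨hl1, hl2⟩, hch⟩ := hch
    obtain ⟨v, t, rfl⟩ : ∃ v t, q = v :: t := by
      cases q with
      | nil => have := (hq [] (by simp)).2; simp at this
      | cons v t => exact ⟨v, t, rfl⟩
    obtain ⟨hqn, hq6⟩ := hq (v :: t) (by simp)
    simp only [List.head?_cons] at hl1 hl2
    obtain ⟨C0, rfl⟩ : ∃ C0, C = C0 ++ [v] := by
      rw [List.getLast?_eq_some_iff] at hl1
      exact hl1
    set L := C0 ++ v :: t with hL
    have hLn : L.Nodup := by
      rw [hL, List.nodup_append]
      refine ⟨(List.nodup_append.1 hC).1, hqn, ?_⟩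
      rintro a ha b hb rfl
      have := hl2 a (by simp [ha]) hb
      simp only [Option.some.injEq] at this
      subst this
      exact (List.nodup_append.1 hC).2.2 v ha v (by simp) rfl
    obtain ⟨C', E, hC', hCl, hE, hdE, he⟩ := cut (L.length - 1) L hLn (by simp [hL]; omega)
    have hC'q : C' <:+ v :: t := by
      apply List.suffix_of_suffix_length_le hC' (List.suffix_append _ _)
      have := Nat.mod_lt (L.length - 1) (show 5 > 0 by omega)
      omega
    have hC'0 : C' ≠ [] := by
      rintro rfl; simp at hCl
    have hsubC : ed C' ⊆ ed (v :: t) := by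
      obtain ⟨w, s, rfl⟩ := List.exists_cons_of_ne_nil hC'0
      obtain ⟨u, hu⟩ := hC'q
      rw [← hu, ed_append]; exact Finset.subset_union_right
    have hLe : ed L = ed (C0 ++ [v]) ∪ ed (v :: t) := ed_append _ _ _
    have hELs : E ⊆ ed (C0 ++ [v]) ∪ ed (v :: t) := by
      rw [← hLe, he]; exact Finset.subset_union_left
    simp only [List.pairwise_cons] at hpw
    obtain ⟨hp1, hp2, hp3⟩ := hpw
    have hdEU : Disjoint (ed L) (edU qs) := by
      rw [Finset.disjoint_left]
      intro e h1 h2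
      obtain ⟨r, hr, h2⟩ := mem_edU.1 h2
      rw [hLe, Finset.mem_union] at h1
      rcases h1 with h1 | h1
      · exact Finset.disjoint_left.1 (hp1 r (by simp [hr])) h1 h2
      · exact Finset.disjoint_left.1 (hp2 r hr) h1 h2
    have heq : ed (C0 ++ [v]) ∪ edU ((v :: t) :: qs) = E ∪ (ed C' ∪ edU qs) := by
      rw [edU, ← Finset.union_assoc, ← hLe, he, Finset.union_assoc]
    rw [he, Finset.disjoint_union_left] at hdEU
    have hdis : Disjoint E (ed C' ∪ edU qs) := by
      rw [Finset.disjoint_union_right]; exact ⟨hdE, hdEU.1⟩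
    rw [heq] at hd ⊢
    refine PD.union hE (ih C' (hC'q.sublist.nodup hqn) ?_ hC'0 ?_ ?_ ?_ ?_) hdis
    · have := Nat.mod_lt (L.length - 1) (show 5 > 0 by omega)
      omega
    · intro q hqq; exact hq q (by simp [hqq])
    · cases qs with
      | nil => simp
      | cons q' qs =>
        rw [List.isChain_cons_cons] at hch ⊢
        refine ⟨⟨?_, ?_⟩, hch.2⟩
        · rw [← hch.1.1]
          obtain ⟨u, hu⟩ := hC'q
          rw [← hu, List.getLast?_append_of_ne_nil _ hC'0]
        · intro x hx hx'
          exact hch.1.2 x (hC'q.subset hx) hx'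
    · rw [List.pairwise_cons]
      refine ⟨fun r hr => ?_, hp3⟩
      exact Finset.disjoint_of_subset_left hsubC (hp2 r hr)
    · rw [Finset.card_union_of_disjoint hdis] at hd
      have := hE.card
      exact (Nat.dvd_add_right this).1 hd

lemma chain {qs : List (List V)} (hq : ∀ q ∈ qs, q.Nodup ∧ 6 ≤ q.length)
    (hch : List.IsChain Link qs) (hpw : List.Pairwise (fun p q => Disjoint (ed p) (ed q)) qs)
    (hd : 5 ∣ (edU qs).card) : PD (edU qs) := by
  cases qs with
  | nil => exact PD.nil
  | cons q qs =>
    obtain ⟨v, t, rfl⟩ : ∃ v t, q = v :: t := by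
      cases q with
      | nil => have := (hq [] (by simp)).2; simp at this
      | cons v t => exact ⟨v, t, rfl⟩
    have := chainAux ((v :: t) :: qs) [v] (by simp) (by simp) (by simp) hq ?_ ?_ ?_
    · simpa using this
    · rw [List.isChain_cons_cons]
      refine ⟨⟨by simp, ?_⟩, hch⟩
      intro x hx _
      simp at hx; simp [hx]
    · rw [List.pairwise_cons]; exact ⟨by simp, hpw⟩
    · simpa using hd

end lists
end P5

namespace P5
open scoped Classical
set_option linter.unusedSectionVars false
lemma even_card_of_invol {D : Type} (S : Finset D) (f : D → D) (h1 : ∀ d ∈ S, f d ∈ S)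
    (h2 : ∀ d ∈ S, f d ≠ d) (h3 : ∀ d, f (f d) = d) : Even S.card := by
  have : ∑ d ∈ S, (1 : ZMod 2) = 0 := by
    refine Finset.sum_involution (fun d _ => f d) ?_ ?_ ?_ ?_
    · intro a _; decide
    · intro a ha _; exact h2 a ha
    · intro a ha; exact h1 a ha
    · intro a _; exact h3 a
  rw [Finset.sum_const, nsmul_eq_mul, mul_one] at this
  rwa [ZMod.natCast_eq_zero_iff_even] at this

section perm
variable {D : Type}

open Equiv in
/-- conjugation: replaces pairs (α β) (γ δ) by (α γ) (β δ) -/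
lemma conj_exists (σ : Perm D) (hσ : ∀ d, σ (σ d) = d) (α β γ δ : D) (h1 : σ α = β) (h2 : σ γ = δ)
    (hαγ : α ≠ γ) (hβγ : β ≠ γ) (hαβ : α ≠ β) (hγδ : γ ≠ δ) :
    ∃ σ' : Perm D, (∀ d, σ' (σ' d) = d) ∧ σ' α = γ ∧ σ' γ = α ∧ σ' β = δ ∧ σ' δ = β ∧
      ∀ d, d ≠ α → d ≠ β → d ≠ γ → d ≠ δ → σ' d = σ d := by
  have h1' : σ β = α := by rw [← h1, hσ]
  have h2' : σ δ = γ := by rw [← h2, hσ]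
  have hαδ : α ≠ δ := by rintro rfl; exact hβγ (h1.symm.trans h2')
  have hβδ : β ≠ δ := by
    rintro rfl; exact hαγ (h1'.symm.trans h2')
  refine ⟨swap β γ * σ * swap β γ, ?_, ?_, ?_, ?_, ?_, ?_⟩
  · intro d
    simp [Perm.mul_apply, hσ]
  · simp [Perm.mul_apply, swap_apply_of_ne_of_ne hαβ hαγ, h1]
  · simp [Perm.mul_apply, h1', swap_apply_of_ne_of_ne hαβ hαγ]
  · simp [Perm.mul_apply, h2, swap_apply_of_ne_of_ne hβδ.symm hγδ.symm]
  · simp [Perm.mul_apply, swap_apply_of_ne_of_ne hβδ.symm hγδ.symm, h2']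
  · intro d ha hb hc hd
    have e1 : σ d ≠ β := by
      intro h; apply ha; rw [← hσ d, h, h1']
    have e2 : σ d ≠ γ := by
      intro h; apply hd; rw [← hσ d, h, h2]
    simp [Perm.mul_apply, swap_apply_of_ne_of_ne hb hc, swap_apply_of_ne_of_ne e1 e2]

variable [Fintype D] {V : Type} (vert : D → V) (C : D → D → Prop)

/-- density -/
def Dense : Prop := ∀ d, 10 * (Finset.univ.filter (fun d' => vert d' = vert d ∧ ¬ C d d')).card
    ≤ (Finset.univ.filter (fun d' => vert d' = vert d)).card

lemma pick (hC : Dense vert C) (σ : Equiv.Perm D) (hv : ∀ d, vert (σ d) = vert d) (S : Finset D)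
    (hS : S.card ≤ 4) (v : V) (hSv : ∀ x ∈ S, vert x = v) (hne : ∃ d, vert d = v) :
    ∃ μ, vert μ = v ∧ ∀ x ∈ S, C x μ ∧ C x (σ μ) := by
  by_contra hcon
  push Not at hcon
  set N := Finset.univ.filter (fun d' => vert d' = v) with hN
  let B : D → Finset D := fun x => Finset.univ.filter (fun d' => vert d' = v ∧ ¬ C x d')
  have hB : ∀ x ∈ S, 10 * (B x).card ≤ N.card := by
    intro x hx
    have := hC x
    rw [hSv x hx] at this
    exact this
  have hsub : N ⊆ S.biUnion (fun x => B x ∪ (B x).image σ.symm) := by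
    intro μ hμ
    simp only [hN, Finset.mem_filter, Finset.mem_univ, true_and] at hμ
    obtain ⟨x, hx, hc⟩ := hcon μ hμ
    rw [Finset.mem_biUnion]
    refine ⟨x, hx, ?_⟩
    rw [Finset.mem_union]
    by_cases h : C x μ
    · right
      rw [Finset.mem_image]
      exact ⟨σ μ, by simp [B, hv, hμ, hc h], by simp⟩
    · left; simp [B, hμ, h]
  have h1 := Finset.card_le_card hsub
  have h2 : (S.biUnion (fun x => B x ∪ (B x).image σ.symm)).card ≤ ∑ x ∈ S, 2 * (B x).card := by
    refine Finset.card_biUnion_le.trans (Finset.sum_le_sum fun x _ => ?_)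
    refine (Finset.card_union_le _ _).trans ?_
    have := Finset.card_image_le (s := B x) (f := σ.symm)
    omega
  have h3 : 10 * ∑ x ∈ S, 2 * (B x).card ≤ S.card * (2 * N.card) := by
    rw [Finset.mul_sum, ← smul_eq_mul S.card, ← Finset.sum_const]
    refine Finset.sum_le_sum fun x hx => ?_
    have := hB x hx
    omega
  have h4 : S.card * (2 * N.card) ≤ 4 * (2 * N.card) := Nat.mul_le_mul_right _ hS
  have h5 : 0 < N.card := by
    obtain ⟨d, hd⟩ := hne
    exact Finset.card_pos.2 ⟨d, by simp [hN, hd]⟩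
  omega

/-- a perfect compatible pairing -/
structure Perf (σ : Equiv.Perm D) : Prop where
  inv : ∀ d, σ (σ d) = d
  vt : ∀ d, vert (σ d) = vert d
  cp : ∀ d, C d (σ d)

open Equiv in
lemma exists_perf (hC : Dense vert C) (hs : ∀ a b, C a b → C b a) (hirr : ∀ a, ¬ C a a)
    (hev : ∀ v, Even (Finset.univ.filter (fun d => vert d = v)).card) :
    ∃ σ : Perm D, Perf vert C σ := by
  let P : Perm D → Prop := fun τ => (∀ d, τ (τ d) = d) ∧ (∀ d, vert (τ d) = vert d) ∧
    ∀ d, τ d = d ∨ C d (τ d)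
  let fx : Perm D → ℕ := fun τ => (Finset.univ.filter (fun d => τ d = d)).card
  obtain ⟨τ, hτ, hmin⟩ := Set.exists_min_image {τ | P τ} fx (Set.toFinite _)
    ⟨1, by simp [P]⟩
  obtain ⟨hinv, hvt, hcp⟩ := hτ
  have hkey : ∀ τ' : Perm D, P τ' → (∀ d, τ' d = d → τ d = d) →
      ∀ a, τ a = a → τ' a ≠ a → False := by
    intro τ' hP hsub a ha ha'
    have := hmin τ' hP
    have hlt : fx τ' < fx τ := by
      apply Finset.card_lt_card
      rw [Finset.ssubset_iff_of_subset]
      · exact ⟨a, by simpa using ha, by simpa using ha'⟩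
      · intro d hd
        simp only [Finset.mem_filter, Finset.mem_univ, true_and] at hd ⊢
        exact hsub d hd
    omega
  refine ⟨τ, hinv, hvt, fun d => (hcp d).resolve_left ?_⟩
  intro hα
  -- second fixed point
  obtain ⟨β, hβv, hβ, hne⟩ : ∃ β, vert β = vert d ∧ τ β = β ∧ β ≠ d := by
    by_contra hcon
    push Not at hcon
    have h1 : Even ((Finset.univ.filter (fun x => vert x = vert d)).erase d).card := by
      apply even_card_of_invol _ τ
      · intro x hx
        simp only [Finset.mem_erase, Finset.mem_filter, Finset.mem_univ, true_and] at hx ⊢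
        refine ⟨?_, by rw [hvt, hx.2]⟩
        intro h
        apply hx.1
        rw [← hinv x, h, hα]
      · intro x hx h
        simp only [Finset.mem_erase, Finset.mem_filter, Finset.mem_univ, true_and] at hx
        exact hx.1 (hcon x hx.2 h)
      · exact hinv
    have h2 := hev (vert d)
    rw [Finset.card_erase_of_mem (by simp)] at h1
    have h3 : 0 < (Finset.univ.filter (fun x => vert x = vert d)).card :=
      Finset.card_pos.2 ⟨d, by simp⟩
    obtain ⟨a, ha⟩ := h1
    obtain ⟨b, hb⟩ := h2
    omega
  -- joining two compatible fixed points gives a contradiction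
  have hjoin : ∀ a b, τ a = a → τ b = b → vert a = vert b → C a b → False := by
    intro a b ha hb hab hc
    have hne : a ≠ b := by rintro rfl; exact hirr _ hc
    have hca : (τ * swap a b) a = b := by simp [hb]
    have hcb : (τ * swap a b) b = a := by simp [ha]
    have hco : ∀ x, x ≠ a → x ≠ b → (τ * swap a b) x = τ x := by
      intro x h1 h2; simp [swap_apply_of_ne_of_ne h1 h2]
    refine hkey (τ * swap a b) ⟨?_, ?_, ?_⟩ ?_ a ha (by rw [hca]; exact hne.symm)
    · intro x
      by_cases h1 : x = a
      · subst h1; rw [hca, hcb]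
      by_cases h2 : x = b
      · subst h2; rw [hcb, hca]
      rw [hco x h1 h2, hco, hinv]
      · intro h; apply h1; rw [← hinv x, h, ha]
      · intro h; apply h2; rw [← hinv x, h, hb]
    · intro x
      by_cases h1 : x = a
      · subst h1; rw [hca, hab]
      by_cases h2 : x = b
      · subst h2; rw [hcb, hab]
      rw [hco x h1 h2, hvt]
    · intro x
      by_cases h1 : x = a
      · subst h1; rw [hca]; exact Or.inr hc
      by_cases h2 : x = b
      · subst h2; rw [hcb]; exact Or.inr (hs _ _ hc)
      rw [hco x h1 h2]; exact hcp x
    · intro x hx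
      by_cases h1 : x = a
      · subst h1; exact ha
      by_cases h2 : x = b
      · subst h2; exact hb
      rwa [hco x h1 h2] at hx
  obtain ⟨μ, hμv, hμ⟩ := pick vert C hC τ hvt {d, β} (Finset.card_le_two.trans (by norm_num))
    (vert d) (by simp [hβv]) ⟨d, rfl⟩
  have hμd := hμ d (by simp)
  have hμβ := hμ β (by simp)
  by_cases hμf : τ μ = μ
  · exact hjoin d μ hα hμf hμv.symm hμd.1
  -- general step
  have hdμ : d ≠ μ := by rintro rfl; exact hirr _ hμd.1
  have hβμ : β ≠ μ := by rintro rfl; exact hirr _ hμβ.1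
  have hdν : d ≠ τ μ := by
    intro h; apply hirr d; conv => arg 2; rw [h]
    exact hμd.2
  have hβν : β ≠ τ μ := by
    intro h; apply hirr β; conv => arg 2; rw [h]
    exact hμβ.2
  have hca : (τ * swap d β) d = β := by simp [hβ]
  have hcb : (τ * swap d β) β = d := by simp [hα]
  have hco : ∀ x, x ≠ d → x ≠ β → (τ * swap d β) x = τ x := by
    intro x h1 h2; simp [swap_apply_of_ne_of_ne h1 h2]
  obtain ⟨σ', hi, h1, h2, h3, h4, h5⟩ := conj_exists (τ * swap d β) (by
    intro x
    by_cases h1 : x = d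
    · subst h1; rw [hca, hcb]
    by_cases h2 : x = β
    · subst h2; rw [hcb, hca]
    rw [hco x h1 h2, hco, hinv]
    · intro h; apply h1; rw [← hinv x, h, hα]
    · intro h; apply h2; rw [← hinv x, h, hβ]) d β μ (τ μ) hca (hco μ hdμ.symm hβμ.symm)
    hdμ hβμ hne.symm (Ne.symm hμf)
  have h5' : ∀ x, x ≠ d → x ≠ β → x ≠ μ → x ≠ τ μ → σ' x = τ x := by
    intro x ha hb hc hd
    rw [h5 x ha hb hc hd, hco x ha hb]
  refine hkey σ' ⟨hi, ?_, ?_⟩ ?_ d hα (by rw [h1]; exact hdμ.symm)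
  · intro x
    by_cases e1 : x = d
    · subst e1; rw [h1, hμv]
    by_cases e2 : x = β
    · subst e2; rw [h3, hvt, hμv, hβv]
    by_cases e3 : x = μ
    · subst e3; rw [h2, hμv]
    by_cases e4 : x = τ μ
    · subst e4; rw [h4, hvt, hμv, hβv]
    rw [h5' x e1 e2 e3 e4, hvt]
  · intro x
    by_cases e1 : x = d
    · subst e1; rw [h1]; exact Or.inr hμd.1
    by_cases e2 : x = β
    · subst e2; rw [h3]; exact Or.inr hμβ.2
    by_cases e3 : x = μ
    · subst e3; rw [h2]; exact Or.inr (hs _ _ hμd.1)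
    by_cases e4 : x = τ μ
    · subst e4; rw [h4]; exact Or.inr (hs _ _ hμβ.2)
    rw [h5' x e1 e2 e3 e4]; exact hcp x
  · intro x hx
    by_cases e1 : x = d
    · subst e1; exact hα
    by_cases e2 : x = β
    · subst e2; exact hβ
    by_cases e3 : x = μ
    · subst e3; rw [h2] at hx; exact absurd hx hdμ
    by_cases e4 : x = τ μ
    · subst e4; rw [h4] at hx; exact absurd hx hβν
    rwa [h5' x e1 e2 e3 e4] at hx

end perm
end P5

namespace P5
open scoped Classical
set_option linter.unusedSectionVars false
section merge
variable {D : Type} [Fintype D]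

/-- classes generated by the two involutions -/
def cls (σ r : D → D) : Setoid D := Relation.EqvGen.setoid (fun a b => b = σ a ∨ b = r a)

lemma cls_left (σ r : D → D) (a : D) : (cls σ r).r a (σ a) := Relation.EqvGen.rel _ _ (Or.inl rfl)
lemma cls_right (σ r : D → D) (a : D) : (cls σ r).r a (r a) := Relation.EqvGen.rel _ _ (Or.inr rfl)

lemma cls_le {σ r : D → D} {s : Setoid D} (h1 : ∀ a, s.r a (σ a)) (h2 : ∀ a, s.r a (r a))
    {a b : D} (h : (cls σ r).r a b) : s.r a b := by
  induction h with
  | rel x y h =>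
    rcases h with rfl | rfl
    · exact h1 _
    · exact h2 _
  | refl x => exact s.refl' x
  | symm x y _ ih => exact s.symm' ih
  | trans x y z _ _ ih1 ih2 => exact s.trans' ih1 ih2

lemma card_quot_lt {s t : Setoid D} (h : ∀ a b, s.r a b → t.r a b) {a b : D} (h1 : t.r a b)
    (h2 : ¬ s.r a b) : Fintype.card (Quotient t) < Fintype.card (Quotient s) := by
  let f : Quotient s → Quotient t := Quotient.map' id (fun a b hab => h a b hab)
  apply Fintype.card_lt_of_surjective_not_injective f
  · intro x
    induction x using Quotient.inductionOn with
    | _ x => exact ⟨Quotient.mk s x, rfl⟩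
  · intro hf
    have : f (Quotient.mk s a) = f (Quotient.mk s b) := Quotient.sound h1
    exact h2 (Quotient.exact (hf this))

lemma merge_step (σ σ' r : D → D) (hσ : ∀ d, σ (σ d) = d) (hr : ∀ d, r (r d) = d)
    (hσf : ∀ d, σ d ≠ d) (hrf : ∀ d, r d ≠ d) (α β γ δ : D) (h1 : σ α = β) (h2 : σ γ = δ)
    (hne : ¬ (cls σ r).r α γ) (e1 : σ' α = γ) (e3 : σ' β = δ)
    (e5 : ∀ d, d ≠ α → d ≠ β → d ≠ γ → d ≠ δ → σ' d = σ d) :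
    Fintype.card (Quotient (cls σ' r)) < Fintype.card (Quotient (cls σ r)) := by
  have h1' : σ β = α := by rw [← h1, hσ]
  have h2' : σ δ = γ := by rw [← h2, hσ]
  have hsy := fun {a b} => (cls σ' r).symm' (x := a) (y := b)
  have htr := fun {a b c} => (cls σ' r).trans' (x := a) (y := b) (z := c)
  have hαγ : (cls σ' r).r α γ := by have := cls_left σ' r α; rwa [e1] at this
  have hβδ : (cls σ' r).r β δ := by have := cls_left σ' r β; rwa [e3] at this
  -- key parity argument
  have key : (cls σ' r).r α β := by
    by_contra hcon
    let R : D → D → Prop := fun a b =>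
      b = r a ∨ (a ≠ α ∧ a ≠ β ∧ a ≠ γ ∧ a ≠ δ ∧ b = σ a)
    have hR' : ∀ a b, Relation.EqvGen R a b → (cls σ' r).r a b := by
      intro a b h
      induction h with
      | rel x y h =>
        rcases h with rfl | ⟨ha, hb, hc, hd, rfl⟩
        · exact cls_right _ _ _
        · rw [← e5 x ha hb hc hd]; exact cls_left _ _ _
      | refl x => exact (cls σ' r).refl' x
      | symm x y _ ih => exact hsy ih
      | trans x y z _ _ ih1 ih2 => exact htr ih1 ih2
    have hR : ∀ a b, Relation.EqvGen R a b → (cls σ r).r a b := by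
      intro a b h
      induction h with
      | rel x y h =>
        rcases h with rfl | ⟨ha, hb, hc, hd, rfl⟩
        · exact cls_right _ _ _
        · exact cls_left _ _ _
      | refl x => exact (cls σ r).refl' x
      | symm x y _ ih => exact (cls σ r).symm' ih
      | trans x y z _ _ ih1 ih2 => exact (cls σ r).trans' ih1 ih2
    set X : Finset D := Finset.univ.filter (fun d => Relation.EqvGen R α d) with hX
    have hXm : ∀ d, d ∈ X ↔ Relation.EqvGen R α d := by intro d; simp [hX]
    have hαX : α ∈ X := (hXm _).2 (Relation.EqvGen.refl _)
    have hβX : β ∉ X := fun h => hcon (hR' _ _ ((hXm _).1 h))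
    have hγX : γ ∉ X := fun h => hne (hR _ _ ((hXm _).1 h))
    have hδX : δ ∉ X := by
      intro h
      apply hne
      refine (cls σ r).trans' (hR _ _ ((hXm _).1 h)) ?_
      have := cls_left σ r δ
      rwa [h2'] at this
    have ev1 : Even X.card := by
      apply even_card_of_invol X r
      · intro d hd
        rw [hXm] at hd ⊢
        exact hd.trans _ _ _ (Relation.EqvGen.rel _ _ (Or.inl rfl))
      · intro d _; exact hrf d
      · exact hr
    have ev2 : Even (X.erase α).card := by
      apply even_card_of_invol _ σ
      · intro d hd
        rw [Finset.mem_erase] at hd ⊢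
        refine ⟨?_, ?_⟩
        · intro h
          apply hβX
          have : d = β := by rw [← hσ d, h, h1]
          rw [← this]; exact hd.2
        · have hd2 := hd.2
          rw [hXm]
          refine Relation.EqvGen.trans _ _ _ ((hXm _).1 hd2)
            (Relation.EqvGen.rel _ _ (Or.inr ⟨hd.1, ?_, ?_, ?_, rfl⟩))
          · rintro rfl; exact hβX hd2
          · rintro rfl; exact hγX hd2
          · rintro rfl; exact hδX hd2
      · intro d _; exact hσf d
      · exact hσ
    rw [Finset.card_erase_of_mem hαX] at ev2
    have := Finset.card_pos.2 ⟨α, hαX⟩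
    obtain ⟨a, ha⟩ := ev1
    obtain ⟨b, hb⟩ := ev2
    omega
  refine card_quot_lt (fun a b h => cls_le ?_ (cls_right σ' r) h) hαγ hne
  intro a
  by_cases c1 : a = α
  · subst c1; rw [h1]; exact key
  by_cases c2 : a = β
  · subst c2; rw [h1']; exact hsy key
  have hγδ : (cls σ' r).r γ δ := htr (hsy hαγ) (htr key hβδ)
  by_cases c3 : a = γ
  · subst c3; rw [h2]; exact hγδ
  by_cases c4 : a = δ
  · subst c4; rw [h2']; exact hsy hγδ
  rw [← e5 a c1 c2 c3 c4]; exact cls_left _ _ _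

variable {V : Type} (vert : D → V) (C : D → D → Prop)

lemma exists_single (hC : Dense vert C) (hs : ∀ a b, C a b → C b a) (hirr : ∀ a, ¬ C a a)
    (hev : ∀ v, Even (Finset.univ.filter (fun d => vert d = v)).card)
    (r : D → D) (hr : ∀ d, r (r d) = d) (hrf : ∀ d, r d ≠ d)
    (hconn : ∀ X : Set V, X.Nonempty → Xᶜ.Nonempty → ∃ d, vert d ∈ X ∧ vert (r d) ∉ X) :
    ∃ σ : Equiv.Perm D, Perf vert C σ ∧ ∀ a b, (cls σ r).r a b := by
  obtain ⟨σ0, hσ0⟩ := exists_perf vert C hC hs hirr hev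
  obtain ⟨σ, hσ, hmin⟩ := Set.exists_min_image {σ | Perf vert C σ}
    (fun σ => Fintype.card (Quotient (cls σ r))) (Set.toFinite _) ⟨σ0, hσ0⟩
  have hσ : Perf vert C σ := hσ
  refine ⟨σ, hσ, ?_⟩
  have hσf : ∀ d, σ d ≠ d := fun d h => hirr d (by have := hσ.cp d; rwa [h] at this)
  -- one merging
  have hm : ∀ α μ, vert α = vert μ → C α μ → C (σ α) (σ μ) → (cls σ r).r α μ := by
    intro α μ hv h1 h2
    by_contra hne
    have n1 : α ≠ μ := by rintro rfl; exact hne ((cls σ r).refl' _)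
    have n2 : σ α ≠ μ := by rintro rfl; exact hne (cls_left _ _ _)
    obtain ⟨σ', hi, e1, e2, e3, e4, e5⟩ := conj_exists σ hσ.inv α (σ α) μ (σ μ) rfl rfl n1 n2
      (hσf α).symm (hσf μ).symm
    have hp : Perf vert C σ' := by
      refine ⟨hi, ?_, ?_⟩
      · intro x
        by_cases c1 : x = α
        · subst c1; rw [e1, hv]
        by_cases c2 : x = σ α
        · subst c2; rw [e3, hσ.vt, hσ.vt, hv]
        by_cases c3 : x = μ
        · subst c3; rw [e2, hv]
        by_cases c4 : x = σ μ
        · subst c4; rw [e4, hσ.vt, hσ.vt, hv]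
        rw [e5 x c1 c2 c3 c4, hσ.vt]
      · intro x
        by_cases c1 : x = α
        · subst c1; rw [e1]; exact h1
        by_cases c2 : x = σ α
        · subst c2; rw [e3]; exact h2
        by_cases c3 : x = μ
        · subst c3; rw [e2]; exact hs _ _ h1
        by_cases c4 : x = σ μ
        · subst c4; rw [e4]; exact hs _ _ h2
        rw [e5 x c1 c2 c3 c4]; exact hσ.cp x
    have h3 := hmin σ' hp
    have h4 := merge_step σ σ' r hσ.inv hr hσf hrf α (σ α) μ (σ μ) rfl rfl hne e1 e3 e5
    exact absurd h3 (not_le.2 h4)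
  have hsame : ∀ α γ, vert α = vert γ → (cls σ r).r α γ := by
    intro α γ hv
    obtain ⟨μ, hμv, hμ⟩ := pick vert C hC σ hσ.vt {α, σ α, γ, σ γ} Finset.card_le_four
      (vert α) (by simp [hσ.vt, hv]) ⟨α, rfl⟩
    have a1 := hm α μ hμv.symm (hμ α (by simp)).1 (hμ (σ α) (by simp)).2
    have a2 := hm γ μ (by rw [hμv, hv]) (hμ γ (by simp)).1 (hμ (σ γ) (by simp)).2
    exact (cls σ r).trans' a1 ((cls σ r).symm' a2)
  intro a b
  by_contra hab
  let X : Set V := {v | ∃ d, (cls σ r).r a d ∧ vert d = v}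
  have hXd : ∀ d, vert d ∈ X → (cls σ r).r a d := by
    rintro d ⟨d', h1, h2⟩
    exact (cls σ r).trans' h1 (hsame _ _ h2)
  obtain ⟨d, h1, h2⟩ := hconn X ⟨vert a, a, (cls σ r).refl' a, rfl⟩
    ⟨vert b, fun h => hab (hXd b h)⟩
  exact h2 ⟨r d, (cls σ r).trans' (hXd d h1) (cls_right _ _ _), rfl⟩

lemma dihedral (π σ r : Equiv.Perm D) (hπ : ∀ d, π d = σ (r d)) (hσ : ∀ d, σ (σ d) = d)
    (hr : ∀ d, r (r d) = d) (hσf : ∀ d, σ d ≠ d) (hrf : ∀ d, r d ≠ d) (d : D) (n : ℤ) :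
    r d ≠ (π ^ n) d := by
  have hinv : ∀ x, π⁻¹ x = r (σ x) := by
    intro x; rw [Equiv.Perm.inv_eq_iff_eq, hπ, hr, hσ]
  have hconj1 : r * π * r⁻¹ = π⁻¹ := by
    ext x
    have : r⁻¹ x = r x := by rw [Equiv.Perm.inv_eq_iff_eq, hr]
    simp only [Equiv.Perm.mul_apply, this, hπ, hr, hinv]
  have hconj : ∀ (j : ℤ) x, r ((π ^ j) x) = (π ^ (-j)) (r x) := by
    intro j x
    have h : r * π ^ j * r⁻¹ = π ^ (-j) := by
      rw [← conj_zpow, hconj1, inv_zpow, zpow_neg]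
    rw [← h]; simp
  intro h
  rcases Int.even_or_odd' n with ⟨j, rfl | rfl⟩
  · apply hrf ((π ^ j) d)
    rw [hconj, h, ← Equiv.Perm.mul_apply, ← zpow_add]
    congr 2; ring
  · apply hσf (r ((π ^ j) d))
    have h1 : r ((π ^ (j + 1)) d) = (π ^ j) d := by
      rw [hconj, h, ← Equiv.Perm.mul_apply, ← zpow_add]
      congr 2; ring
    have h2 : (π ^ (j + 1)) d = π ((π ^ j) d) := by
      rw [add_comm, zpow_add]; simp
    rw [h2, hπ] at h1
    conv_rhs => rw [← h1]
    rw [hr]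

/-- the orbit of d covers everything up to r -/
lemma orbit_cover (π σ r : Equiv.Perm D) (hπ : ∀ d, π d = σ (r d)) (hσ : ∀ d, σ (σ d) = d)
    (hr : ∀ d, r (r d) = d) (hsing : ∀ a b, (cls σ r).r a b) (d e : D) :
    π.SameCycle d e ∨ π.SameCycle d (r e) := by
  have hinv : ∀ x, π⁻¹ x = r (σ x) := by
    intro x; rw [Equiv.Perm.inv_eq_iff_eq, hπ, hr, hσ]
  have h1 : ∀ x, (π.SameCycle d x ∨ π.SameCycle d (r x)) ↔
      (π.SameCycle d (r x) ∨ π.SameCycle d (r (r x))) := by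
    intro x; rw [hr]; exact or_comm
  have e1 : ∀ x, π.SameCycle d (σ x) ↔ π.SameCycle d (r x) := by
    intro x
    have : σ x = π (r x) := by rw [hπ, hr]
    rw [this, Equiv.Perm.sameCycle_apply_right]
  have e2 : ∀ x, π.SameCycle d (r (σ x)) ↔ π.SameCycle d x := by
    intro x
    rw [← hinv, ← Equiv.Perm.sameCycle_apply_right]; simp
  have : ∀ x y, (cls σ r).r x y → ((π.SameCycle d x ∨ π.SameCycle d (r x)) ↔
      (π.SameCycle d y ∨ π.SameCycle d (r y))) := by
    intro x y h
    induction h with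
    | rel x y h =>
      rcases h with rfl | rfl
      · rw [e1, e2, or_comm]
      · exact h1 x
    | refl x => rfl
    | symm x y _ ih => exact ih.symm
    | trans x y z _ _ ih1 ih2 => exact ih1.trans ih2
  exact (this d e (hsing d e)).1 (Or.inl (Equiv.Perm.SameCycle.refl _ _))

end merge
end P5

namespace P5
open scoped Classical
set_option linter.unusedSectionVars false
section L8
variable {V ι : Type} [Fintype ι]

/-- oriented path of a dart -/
def orient (p : ι → List V) (d : ι × Bool) : List V := if d.2 then p d.1 else (p d.1).reverse

lemma mem_orient {p : ι → List V} {d : ι × Bool} {x : V} : x ∈ orient p d ↔ x ∈ p d.1 := by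
  unfold orient; split_ifs <;> simp

lemma ed_orient (p : ι → List V) (d : ι × Bool) : ed (orient p d) = ed (p d.1) := by
  unfold orient; split_ifs
  · rfl
  · exact ed_reverse _

lemma orient_getLast (p : ι → List V) (d : ι × Bool) :
    (orient p d).getLast? = (orient p (d.1, !d.2)).head? := by
  unfold orient
  rcases d with ⟨i, b⟩
  cases b <;> simp

theorem merging (p : ι → List V) (vert : ι × Bool → V)
    (hp : ∀ i, (p i).Nodup ∧ 6 ≤ (p i).length)
    (hvert : ∀ d, (orient p d).head? = some (vert d))
    (hdis : ∀ i j, i ≠ j → Disjoint (ed (p i)) (ed (p j)))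
    (hev : ∀ v, Even (Finset.univ.filter (fun d => vert d = v)).card)
    (hden : ∀ d, 10 * (Finset.univ.filter (fun d' => vert d' = vert d ∧
        ∃ x, x ≠ vert d ∧ x ∈ p d.1 ∧ x ∈ p d'.1)).card
      ≤ (Finset.univ.filter (fun d' => vert d' = vert d)).card)
    (hconn : ∀ X : Set V, X.Nonempty → Xᶜ.Nonempty → ∃ i,
      (vert (i, true) ∈ X ∧ vert (i, false) ∉ X) ∨ (vert (i, false) ∈ X ∧ vert (i, true) ∉ X))
    (h5 : 5 ∣ (Finset.univ.biUnion (fun i => ed (p i))).card) :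
    PD (Finset.univ.biUnion (fun i => ed (p i))) := by
  rcases isEmpty_or_nonempty ι with hι | ⟨⟨i0⟩⟩
  · simp only [Finset.univ_eq_empty, Finset.biUnion_empty]; exact PD.nil
  let C : ι × Bool → ι × Bool → Prop := fun d d' =>
    vert d' = vert d ∧ ∀ x, x ∈ p d.1 → x ∈ p d'.1 → x = vert d
  let r : Equiv.Perm (ι × Bool) := (Equiv.refl ι).prodCongr Equiv.boolNot
  have hrv : ∀ d, r d = (d.1, !d.2) := fun d => rfl
  have hr : ∀ d, r (r d) = d := by intro d; simp [hrv]
  have hrf : ∀ d, r d ≠ d := by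
    rintro ⟨i, b⟩ h
    simp [hrv] at h
  have hvp : ∀ d, vert d ∈ p d.1 := by
    intro d
    rw [← mem_orient]
    exact List.mem_of_mem_head? (hvert d)
  have hC : Dense vert C := by
    intro d
    refine le_trans (Nat.mul_le_mul_left _ (Finset.card_le_card ?_)) (hden d)
    intro d'
    simp only [Finset.mem_filter, Finset.mem_univ, true_and]
    rintro ⟨h1, h2⟩
    refine ⟨h1, ?_⟩
    by_contra hcon
    apply h2
    refine ⟨h1, fun x hx hx' => ?_⟩
    by_contra hne
    exact hcon ⟨x, hne, hx, hx'⟩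
  have hs : ∀ a b, C a b → C b a := by
    rintro a b ⟨h1, h2⟩
    exact ⟨h1.symm, fun x hx hx' => (h2 x hx' hx).trans h1.symm⟩
  have hirr : ∀ a, ¬ C a a := by
    rintro ⟨i, b⟩ ⟨_, h⟩
    have hl := (hp i).2
    have hn := (hp i).1
    match hpi : p i, hl with
    | x :: y :: l, _ =>
      have h1 := h x (by simp [hpi]) (by simp [hpi])
      have h2 := h y (by simp [hpi]) (by simp [hpi])
      rw [hpi] at hn
      rw [← h2] at h1
      simp [h1] at hn
  obtain ⟨σ, hσ, hsing⟩ := exists_single vert C hC hs hirr hev r hr hrf (by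
    intro X h1 h2
    obtain ⟨i, h | h⟩ := hconn X h1 h2
    · exact ⟨(i, true), h⟩
    · exact ⟨(i, false), h⟩)
  have hσf : ∀ d, σ d ≠ d := fun d h => hirr d (by have := hσ.cp d; rwa [h] at this)
  set π : Equiv.Perm (ι × Bool) := σ * r with hπdef
  have hπ : ∀ d, π d = σ (r d) := fun d => rfl
  set d0 : ι × Bool := (i0, true)
  set m := Function.minimalPeriod π d0 with hm
  have hper : d0 ∈ Function.periodicPts π := by
    apply (Function.Injective.mem_periodicPts π.injective)
  have hmpos : 0 < m := Function.minimalPeriod_pos_of_mem_periodicPts hper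
  have hcov : ∀ i, ∃ k < m, (π^[k] d0).1 = i := by
    intro i
    have : ∃ b, π.SameCycle d0 (i, b) := by
      rcases orbit_cover π σ r hπ hσ.inv hr hsing d0 (i, true) with h | h
      · exact ⟨_, h⟩
      · exact ⟨_, h⟩
    obtain ⟨b, hb⟩ := this
    obtain ⟨n, _, hn⟩ := hb.exists_pow_eq'
    refine ⟨n % m, Nat.mod_lt _ hmpos, ?_⟩
    rw [Function.iterate_mod_minimalPeriod_eq, ← Equiv.Perm.coe_pow, hn]
  have hinj : ∀ a < m, ∀ b < m, (π^[a] d0).1 = (π^[b] d0).1 → a = b := by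
    intro a ha b hb h
    have h1 : π^[a] d0 = π^[b] d0 ∨ r (π^[a] d0) = π^[b] d0 := by
      rw [hrv]
      rcases hx : π^[a] d0 with ⟨i, x⟩
      rcases hy : π^[b] d0 with ⟨j, y⟩
      rw [hx, hy] at h
      simp only at h
      subst h
      cases x <;> cases y <;> simp
    rcases h1 with h1 | h1
    · exact Function.iterate_injOn_Iio_minimalPeriod ha hb h1
    · exfalso
      refine dihedral π σ r hπ hσ.inv hr hσf hrf (π^[a] d0) ((b : ℤ) - a) ?_
      rw [h1, ← Equiv.Perm.coe_pow, ← Equiv.Perm.coe_pow, ← Equiv.Perm.mul_apply, ← zpow_natCast,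
        ← zpow_natCast, ← zpow_add]
      congr 2; ring
  let qs : List (List V) := (List.range m).map (fun k => orient p (π^[k] d0))
  have hqs : edU qs = Finset.univ.biUnion (fun i => ed (p i)) := by
    ext e
    rw [mem_edU, Finset.mem_biUnion]
    constructor
    · rintro ⟨q, hq, he⟩
      simp only [qs, List.mem_map] at hq
      obtain ⟨k, _, rfl⟩ := hq
      rw [ed_orient] at he
      exact ⟨_, Finset.mem_univ _, he⟩
    · rintro ⟨i, _, he⟩
      obtain ⟨k, hk, hki⟩ := hcov i
      refine ⟨orient p (π^[k] d0), ?_, ?_⟩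
      · simp only [qs, List.mem_map]; exact ⟨k, by simpa using hk, rfl⟩
      · rw [ed_orient, hki]; exact he
  rw [← hqs]
  apply chain
  · intro q hq
    simp only [qs, List.mem_map] at hq
    obtain ⟨k, _, rfl⟩ := hq
    unfold orient
    have := hp (π^[k] d0).1
    split_ifs
    · exact this
    · simpa using this
  · rw [List.isChain_iff_getElem]
    intro k hk
    simp only [qs, List.length_map, List.length_range] at hk
    simp only [qs, List.getElem_map, List.getElem_range, Function.iterate_succ_apply']
    set d := π^[k] d0
    have hc : C (r d) (π d) := by rw [hπ]; exact hσ.cp _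
    refine ⟨?_, ?_⟩
    · rw [orient_getLast, ← hrv, hvert, hvert, hc.1]
    · intro x hx hx'
      rw [mem_orient] at hx hx'
      rw [hvert, hc.1, hc.2 x hx hx']
  · simp only [qs]
    rw [List.pairwise_map]
    have h1 : (List.range m).Pairwise (fun a b => a < b) := List.pairwise_lt_range
    refine h1.imp_of_mem ?_
    intro a b ha hb hab
    rw [List.mem_range] at ha hb
    rw [ed_orient, ed_orient]
    apply hdis
    intro h
    have := hinj a ha b hb h
    omega
  · rw [hqs]; exact h5

end L8
end P5

namespace P5
open scoped Classical
set_option linter.unusedSectionVars false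
section BF
variable {I K : Type} [Fintype I] [Fintype K] [DecidableEq I]

lemma bf_kernel (a : K → I → ℝ) (d : ℝ) (hd0 : 0 ≤ d) (hd : ∀ i, ∑ c, |a c i| ≤ d)
    (F : Finset I) (hF : F.Nonempty) :
    ∃ z : I → ℝ, (∃ i, z i ≠ 0) ∧ (∀ i, i ∉ F → z i = 0) ∧
      ∀ c, d < ∑ i ∈ F, |a c i| → ∑ i, a c i * z i = 0 := by
  let A : Finset K := Finset.univ.filter (fun c => d < ∑ i ∈ F, |a c i|)
  have hcard : A.card < F.card := by
    by_contra hcon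
    push Not at hcon
    have hA : A.Nonempty := by
      rw [← Finset.card_pos]; have := Finset.card_pos.2 hF; omega
    have h1 : ∑ c ∈ A, d < ∑ c ∈ A, ∑ i ∈ F, |a c i| := by
      apply Finset.sum_lt_sum_of_nonempty hA
      intro c hc
      simpa [A] using hc
    have h2 : ∑ c ∈ A, ∑ i ∈ F, |a c i| ≤ ∑ i ∈ F, d := by
      rw [Finset.sum_comm]
      apply Finset.sum_le_sum
      intro i _
      refine le_trans ?_ (hd i)
      exact Finset.sum_le_sum_of_subset_of_nonneg (Finset.subset_univ _) (fun _ _ _ => abs_nonneg _)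
    simp only [Finset.sum_const, nsmul_eq_mul] at h1 h2
    have h3 : (F.card : ℝ) * d ≤ A.card * d := by
      apply mul_le_mul_of_nonneg_right _ hd0
      exact_mod_cast hcon
    linarith
  let f : (F → ℝ) →ₗ[ℝ] (A → ℝ) :=
    { toFun := fun z c => ∑ i : F, a c i * z i
      map_add' := by
        intro x y; ext c; simp [mul_add, Finset.sum_add_distrib]
      map_smul' := by
        intro t x; ext c; simp only [Pi.smul_apply, smul_eq_mul, RingHom.id_apply, Finset.mul_sum]
        refine Finset.sum_congr rfl fun i _ => by ring }
  have hk : LinearMap.ker f ≠ ⊥ := by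
    apply LinearMap.ker_ne_bot_of_finrank_lt
    simpa using hcard
  obtain ⟨z, hz, hz0⟩ := (Submodule.ne_bot_iff _).1 hk
  rw [LinearMap.mem_ker] at hz
  obtain ⟨i0, hi0⟩ := Function.ne_iff.1 hz0
  refine ⟨fun i => if h : i ∈ F then z ⟨i, h⟩ else 0, ⟨i0.1, ?_⟩, ?_, ?_⟩
  · simpa using hi0
  · intro i hi; simp [hi]
  · intro c hc
    have h1 := congrFun hz ⟨c, by simpa [A] using hc⟩
    simp only [f, LinearMap.coe_mk, AddHom.coe_mk, Pi.zero_apply] at h1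
    refine Eq.trans ?_ h1
    rw [← Finset.sum_subset (Finset.subset_univ F)]
    · rw [← Finset.sum_coe_sort F]
      refine Finset.sum_congr rfl fun i _ => ?_
      simp
    · intro i _ hi; simp [hi]

lemma bf_move (x z : I → ℝ) (hx : ∀ i, |x i| ≤ 1) (hz : ∀ i, z i ≠ 0 → |x i| < 1)
    (hne : ∃ i, z i ≠ 0) : ∃ t : ℝ, (∀ i, |x i + t * z i| ≤ 1) ∧
      ∃ i, z i ≠ 0 ∧ |x i + t * z i| = 1 := by
  let T : I → ℝ := fun i => (1 - x i * SignType.sign (z i)) / |z i|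
  obtain ⟨i0, hi0, hmin⟩ := Finset.exists_min_image (Finset.univ.filter (fun i => z i ≠ 0)) T
    (by obtain ⟨i, hi⟩ := hne; exact ⟨i, by simpa using hi⟩)
  simp only [Finset.mem_filter, Finset.mem_univ, true_and] at hi0 hmin
  have hpos : 0 ≤ T i0 := by
    have h1 := abs_lt.1 (hz i0 hi0)
    apply div_nonneg _ (abs_nonneg _)
    rcases lt_or_gt_of_ne hi0 with h | h
    · simp [sign_neg h]; linarith
    · simp [sign_pos h]; linarith
  refine ⟨T i0, ?_, i0, hi0, ?_⟩
  · intro i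
    by_cases h0 : z i = 0
    · simp [h0, hx i]
    have h1 := hmin i h0
    have h2 := abs_lt.1 (hz i h0)
    rw [abs_le]
    rcases lt_or_gt_of_ne h0 with h | h
    · have e : T i = (1 + x i) / (- z i) := by simp [T, sign_neg h, abs_of_neg h]
      rw [e, le_div_iff₀ (by linarith)] at h1
      have h3 : T i0 * z i ≤ 0 := mul_nonpos_of_nonneg_of_nonpos hpos h.le
      constructor <;> nlinarith
    · have e : T i = (1 - x i) / (z i) := by simp [T, sign_pos h, abs_of_pos h]
      rw [e, le_div_iff₀ (by linarith)] at h1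
      have h3 : 0 ≤ T i0 * z i := mul_nonneg hpos h.le
      constructor <;> nlinarith
  · rcases lt_or_gt_of_ne hi0 with h | h
    · have e : T i0 = (1 + x i0) / (- z i0) := by simp [T, sign_neg h, abs_of_neg h]
      have e2 : T i0 * z i0 = -(1 + x i0) := by rw [e]; field_simp
      rw [e2]
      have : x i0 + -(1 + x i0) = -1 := by ring
      rw [this]; simp
    · have e : T i0 = (1 - x i0) / (z i0) := by simp [T, sign_pos h, abs_of_pos h]
      have e2 : T i0 * z i0 = 1 - x i0 := by rw [e]; field_simp
      rw [e2]; simp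

lemma bf_main (a : K → I → ℝ) (d : ℝ) (hd0 : 0 ≤ d) (hd : ∀ i, ∑ c, |a c i| ≤ d) (n : ℕ) :
    ∀ x : I → ℝ, (∀ i, |x i| ≤ 1) → (Finset.univ.filter (fun i => |x i| < 1)).card = n →
    ∃ ε : I → ℝ, (∀ i, |ε i| = 1) ∧ (∀ i, |x i| = 1 → ε i = x i) ∧
      ∀ c, |∑ i, a c i * (ε i - x i)| ≤ 2 * d := by
  induction n using Nat.strong_induction_on with
  | _ n ih =>
    intro x hx hn
    set F := Finset.univ.filter (fun i => |x i| < 1) with hF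
    by_cases hFe : F.Nonempty
    swap
    · refine ⟨x, ?_, fun _ _ => rfl, ?_⟩
      · intro i
        refine le_antisymm (hx i) ?_
        by_contra h
        push Not at h
        exact hFe ⟨i, by simp [hF, h]⟩
      · intro c; simp [hd0]
    obtain ⟨z, hz0, hzF, hzk⟩ := bf_kernel a d hd0 hd F hFe
    obtain ⟨t, ht, i0, hi0, hi1⟩ := bf_move x z hx (by
      intro i hi
      by_contra h
      exact hi (hzF i (by simpa [hF] using h))) hz0
    have hsub : ∀ i, |x i| = 1 → z i = 0 := by
      intro i hi
      apply hzF; simp [hF, hi]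
    obtain ⟨ε, h1, h2, h3⟩ := ih (Finset.univ.filter (fun i => |x i + t * z i| < 1)).card (by
      rw [← hn]
      apply Finset.card_lt_card
      rw [Finset.ssubset_iff_of_subset]
      · refine ⟨i0, ?_, by simp [hi1]⟩
        by_contra h; exact hi0 (hzF i0 h)
      · intro i hi
        simp only [hF, Finset.mem_filter, Finset.mem_univ, true_and] at hi ⊢
        by_contra h
        have := le_antisymm (hx i) (not_lt.1 h)
        rw [hsub i this] at hi
        simp at hi; exact h hi) (fun i => x i + t * z i) ht rfl
    have h2' : ∀ i, |x i| = 1 → ε i = x i := by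
      intro i hi
      have := h2 i (by rw [hsub i hi]; simpa using hi)
      rw [this, hsub i hi]; ring
    refine ⟨ε, h1, h2', ?_⟩
    intro c
    by_cases hc : d < ∑ i ∈ F, |a c i|
    · have e : ∑ i, a c i * (ε i - x i) = ∑ i, a c i * (ε i - (x i + t * z i)) := by
        have := hzk c hc
        have e2 : ∑ i, a c i * (ε i - x i) = ∑ i, a c i * (ε i - (x i + t * z i)) +
            t * ∑ i, a c i * z i := by
          rw [Finset.mul_sum, ← Finset.sum_add_distrib]
          refine Finset.sum_congr rfl fun i _ => by ring
        rw [e2, this]; ring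
      rw [e]; exact h3 c
    · push Not at hc
      have e : ∑ i, a c i * (ε i - x i) = ∑ i ∈ F, a c i * (ε i - x i) := by
        symm
        apply Finset.sum_subset (Finset.subset_univ F)
        intro i _ hi
        have : |x i| = 1 := by
          refine le_antisymm (hx i) ?_
          simpa [hF] using hi
        rw [h2' i this]; ring
      rw [e]
      calc |∑ i ∈ F, a c i * (ε i - x i)| ≤ ∑ i ∈ F, |a c i * (ε i - x i)| :=
            Finset.abs_sum_le_sum_abs _ _
        _ ≤ ∑ i ∈ F, |a c i| * 2 := by
            refine Finset.sum_le_sum fun i _ => ?_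
            rw [abs_mul]
            refine mul_le_mul_of_nonneg_left ?_ (abs_nonneg _)
            have := abs_sub (ε i) (x i)
            have := hx i
            have := h1 i
            linarith
        _ = 2 * ∑ i ∈ F, |a c i| := by rw [← Finset.sum_mul]; ring
        _ ≤ 2 * d := by linarith

theorem beck_fiala (a : K → I → ℝ) (d : ℝ) (hd0 : 0 ≤ d) (hd : ∀ i, ∑ c, |a c i| ≤ d) :
    ∃ ε : I → ℝ, (∀ i, ε i = 1 ∨ ε i = -1) ∧ ∀ c, |∑ i, a c i * ε i| ≤ 2 * d := by
  obtain ⟨ε, h1, _, h3⟩ := bf_main a d hd0 hd _ (fun _ => 0) (by simp) rfl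
  refine ⟨ε, ?_, ?_⟩
  · intro i
    rcases abs_choice (ε i) with h | h
    · left; rw [← h]; exact h1 i
    · right; have := h1 i; rw [h] at this; linarith
  · intro c
    have := h3 c
    simpa using this

lemma thin_half (S : K → Finset I) (d : ℕ)
    (hd : ∀ i, (Finset.univ.filter (fun c => i ∈ S c)).card ≤ d) (J : Finset I) :
    ∃ J' ⊆ J, ∀ c, |2 * ((S c ∩ J').card : ℝ) - (S c ∩ J).card| ≤ 2 * d := by
  obtain ⟨ε, h1, h2⟩ := beck_fiala (fun c i => if i ∈ S c ∩ J then (1 : ℝ) else 0) d (by positivity) (by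
    intro i
    have : ∀ c, |(if i ∈ S c ∩ J then (1 : ℝ) else 0)| ≤ if i ∈ S c then 1 else 0 := by
      intro c
      by_cases h : i ∈ S c <;> by_cases h' : i ∈ J <;> simp [h, h']
    refine (Finset.sum_le_sum fun c _ => this c).trans ?_
    rw [Finset.sum_boole]
    exact_mod_cast hd i)
  refine ⟨J.filter (fun i => ε i = 1), Finset.filter_subset _ _, ?_⟩
  intro c
  convert h2 c using 2
  have e1 : (((S c ∩ J.filter (fun i => ε i = 1)).card : ℕ) : ℝ)
      = ∑ i, if i ∈ S c ∩ J then (if ε i = 1 then (1 : ℝ) else 0) else 0 := by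
    rw [← Finset.sum_filter, Finset.sum_boole]
    congr 2
    ext i; simp [and_assoc]
  have e2 : (((S c ∩ J).card : ℕ) : ℝ) = ∑ i, if i ∈ S c ∩ J then (1 : ℝ) else 0 := by
    rw [Finset.sum_boole]; congr 2; ext i; simp
  rw [e1, e2, Finset.mul_sum, ← Finset.sum_sub_distrib]
  refine Finset.sum_congr rfl fun i _ => ?_
  split_ifs with ha hb
  · rw [hb]; ring
  · rw [(h1 i).resolve_left hb]; ring
  · ring

theorem thin (S : K → Finset I) (d : ℕ)
    (hd : ∀ i, (Finset.univ.filter (fun c => i ∈ S c)).card ≤ d) (s : ℕ) :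
    ∃ J : Finset I, ∀ c, |((S c ∩ J).card : ℝ) - (S c).card / 2 ^ s| ≤ 2 * d := by
  induction s with
  | zero => exact ⟨Finset.univ, fun c => by simp⟩
  | succ s ih =>
    obtain ⟨J, hJ⟩ := ih
    obtain ⟨J', _, hJ'⟩ := thin_half S d hd J
    refine ⟨J', fun c => ?_⟩
    have h1 := abs_le.1 (hJ c)
    have h2 := abs_le.1 (hJ' c)
    have e : ((S c).card : ℝ) / 2 ^ (s + 1) = ((S c).card / 2 ^ s) / 2 := by
      rw [pow_succ]; field_simp
    rw [e, abs_le]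
    constructor <;> linarith [h1.1, h1.2, h2.1, h2.2]

/-- one conflict resolution round -/
lemma cr_round (S : K → Finset I) (d : ℕ)
    (hd : ∀ i, (Finset.univ.filter (fun c => i ∈ S c)).card ≤ d) (J : Finset I)
    (P : Finset (I × I)) (hP1 : ∀ p ∈ P, p.1 ≠ p.2)
    (hP : ∀ p ∈ P, ∀ p' ∈ P, p ≠ p' → p.1 ≠ p'.1 ∧ p.1 ≠ p'.2 ∧ p.2 ≠ p'.1 ∧ p.2 ≠ p'.2) :
    ∃ J' ⊆ J, (∀ p ∈ P, ¬ (p.1 ∈ J' ∧ p.2 ∈ J')) ∧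
      ∀ c, ((S c ∩ J).card : ℝ) / 2 - 2 * d ≤ (S c ∩ J').card := by
  let b : K → I → ℝ := fun c i => if i ∈ S c ∩ J then (1 : ℝ) else 0
  have hb0 : ∀ c i, 0 ≤ b c i := by intro c i; simp only [b]; split_ifs <;> norm_num
  have hb : ∀ i, ∑ c, b c i ≤ d := by
    intro i
    have : ∀ c, b c i ≤ if i ∈ S c then 1 else 0 := by
      intro c
      by_cases h : i ∈ S c <;> by_cases h' : i ∈ J <;> simp [b, h, h']
    refine (Finset.sum_le_sum fun c _ => this c).trans ?_
    rw [Finset.sum_boole]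
    exact_mod_cast hd i
  obtain ⟨ε, h1, h2⟩ := beck_fiala (fun c p => if p ∈ P then b c p.1 - b c p.2 else 0)
    (2 * d) (by positivity) (by
    intro p
    have : ∀ c, |(if p ∈ P then b c p.1 - b c p.2 else 0)| ≤ b c p.1 + b c p.2 := by
      intro c
      have := hb0 c p.1
      have := hb0 c p.2
      split_ifs
      · rw [abs_le]; constructor <;> linarith
      · simp; linarith
    refine (Finset.sum_le_sum fun c _ => this c).trans ?_
    rw [Finset.sum_add_distrib]
    linarith [hb p.1, hb p.2])
  let R : Finset I := (P.filter (fun p => ε p = 1)).image Prod.snd ∪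
    (P.filter (fun p => ε p ≠ 1)).image Prod.fst
  refine ⟨J \ R, Finset.sdiff_subset, ?_, ?_⟩
  · rintro p hp ⟨ha, hb⟩
    rw [Finset.mem_sdiff] at ha hb
    by_cases h : ε p = 1
    · apply hb.2
      apply Finset.mem_union_left
      exact Finset.mem_image.2 ⟨p, by simp [hp, h], rfl⟩
    · apply ha.2
      apply Finset.mem_union_right
      exact Finset.mem_image.2 ⟨p, by simp [hp, h], rfl⟩
  · intro c
    set T := S c ∩ J with hT
    have hbT : ∀ i, b c i = if i ∈ T then 1 else 0 := fun i => rfl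
    -- pairs count at most card T
    have k1 : ∑ p ∈ P, (b c p.1 + b c p.2) ≤ (T.card : ℝ) := by
      rw [Finset.sum_add_distrib]
      simp only [hbT]
      rw [Finset.sum_boole, Finset.sum_boole]
      have i1 : ((P.filter (fun p => p.1 ∈ T)).image Prod.fst).card
          = (P.filter (fun p => p.1 ∈ T)).card := by
        apply Finset.card_image_of_injOn
        intro p hp p' hp' h
        by_contra hne
        simp only [Finset.coe_filter, Set.mem_ofPred_eq] at hp hp'
        exact (hP p hp.1 p' hp'.1 hne).1 h
      have i2 : ((P.filter (fun p => p.2 ∈ T)).image Prod.snd).card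
          = (P.filter (fun p => p.2 ∈ T)).card := by
        apply Finset.card_image_of_injOn
        intro p hp p' hp' h
        by_contra hne
        simp only [Finset.coe_filter, Set.mem_ofPred_eq] at hp hp'
        exact (hP p hp.1 p' hp'.1 hne).2.2.2 h
      rw [← i1, ← i2, ← Nat.cast_add, ← Finset.card_union_of_disjoint]
      · apply Nat.cast_le.2
        apply Finset.card_le_card
        intro i hi
        simp only [Finset.mem_union, Finset.mem_image, Finset.mem_filter] at hi
        rcases hi with ⟨p, hp, rfl⟩ | ⟨p, hp, rfl⟩
        · exact hp.2
        · exact hp.2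
      · rw [Finset.disjoint_left]
        intro i hi hi'
        simp only [Finset.mem_image, Finset.mem_filter] at hi hi'
        obtain ⟨p, hp, rfl⟩ := hi
        obtain ⟨p', hp', h⟩ := hi'
        by_cases hne : p = p'
        · subst hne; exact hP1 p hp.1 h.symm
        · exact (hP p hp.1 p' hp'.1 hne).2.1 h.symm
    -- removed count
    have k2 : ((T ∩ R).card : ℝ) ≤ ∑ p ∈ P, if ε p = 1 then b c p.2 else b c p.1 := by
      have hsub : T ∩ R ⊆ ((P.filter (fun p => ε p = 1)).filter (fun p => p.2 ∈ T)).image Prod.snd ∪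
          ((P.filter (fun p => ¬ ε p = 1)).filter (fun p => p.1 ∈ T)).image Prod.fst := by
        intro i hi
        simp only [R, Finset.mem_inter, Finset.mem_union, Finset.mem_image, Finset.mem_filter] at hi ⊢
        obtain ⟨hi, ⟨p, hp, rfl⟩ | ⟨p, hp, rfl⟩⟩ := hi
        · left; exact ⟨p, ⟨hp, hi⟩, rfl⟩
        · right; exact ⟨p, ⟨hp, hi⟩, rfl⟩
      have h3 := (Finset.card_le_card hsub).trans (Finset.card_union_le _ _)
      have h4 := h3.trans (Nat.add_le_add Finset.card_image_le Finset.card_image_le)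
      rw [Finset.sum_ite]
      simp only [hbT]
      rw [Finset.sum_boole, Finset.sum_boole]
      exact_mod_cast h4
    have k3 : ∑ p ∈ P, (if ε p = 1 then b c p.2 else b c p.1) =
        (∑ p ∈ P, (b c p.1 + b c p.2)) / 2 -
        (∑ p, (if p ∈ P then b c p.1 - b c p.2 else 0) * ε p) / 2 := by
      have : ∑ p, (if p ∈ P then b c p.1 - b c p.2 else 0) * ε p =
          ∑ p ∈ P, (b c p.1 - b c p.2) * ε p := by
        simp only [ite_mul, zero_mul]
        rw [← Finset.sum_filter]; congr 1; ext p; simp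
      rw [this, Finset.sum_div, Finset.sum_div, ← Finset.sum_sub_distrib]
      refine Finset.sum_congr rfl fun p _ => ?_
      split_ifs with h
      · rw [h]; ring
      · rw [(h1 p).resolve_left h]; ring
    have k4 := abs_le.1 (h2 c)
    have k5 : (T.card : ℝ) = (T ∩ R).card + (S c ∩ (J \ R)).card := by
      rw [← Nat.cast_add, Nat.cast_inj]
      have : S c ∩ (J \ R) = T \ R := by rw [hT, Finset.inter_sdiff_assoc]
      rw [this, Finset.card_inter_add_card_sdiff]
    linarith [k4.1, k4.2]

lemma greedy_color {X : Type} [Fintype X] (r : X → X → Prop) (hs : ∀ a b, r a b → r b a)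
    (m : ℕ) (hm : ∀ a, (Finset.univ.filter (fun b => r a b)).card ≤ m) :
    ∃ f : X → Fin (m + 1), ∀ a b, a ≠ b → r a b → f a ≠ f b := by
  have : ∀ A : Finset X, ∃ f : X → Fin (m + 1), ∀ a ∈ A, ∀ b ∈ A, a ≠ b → r a b → f a ≠ f b := by
    intro A
    induction A using Finset.induction_on with
    | empty => exact ⟨fun _ => 0, by simp⟩
    | insert x A hx ih =>
      obtain ⟨f, hf⟩ := ih
      obtain ⟨k, hk⟩ : ∃ k : Fin (m + 1), k ∉ (Finset.univ.filter (fun b => r x b)).image f := by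
        by_contra hcon
        push Not at hcon
        have h1 : (Finset.univ : Finset (Fin (m + 1))) ⊆
            (Finset.univ.filter (fun b => r x b)).image f := fun k _ => hcon k
        have := Finset.card_le_card h1
        have h2 := Finset.card_image_le (s := Finset.univ.filter (fun b => r x b)) (f := f)
        have := hm x
        simp only [Finset.card_univ, Fintype.card_fin] at *
        omega
      have hk' : ∀ b, r x b → f b ≠ k := by
        intro b hb h
        exact hk (Finset.mem_image.2 ⟨b, by simpa using hb, h⟩)
      refine ⟨Function.update f x k, ?_⟩
      intro a ha b hb hab hr
      rw [Finset.mem_insert] at ha hb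
      by_cases h1 : a = x
      · subst h1
        rw [Function.update_self, Function.update_of_ne (Ne.symm hab)]
        exact (hk' b hr).symm
      · by_cases h2 : b = x
        · subst h2
          rw [Function.update_self, Function.update_of_ne hab]
          exact hk' a (hs _ _ hr)
        · rw [Function.update_of_ne h1, Function.update_of_ne h2]
          exact hf a (ha.resolve_left h1) b (hb.resolve_left h2) hab hr
  obtain ⟨f, hf⟩ := this Finset.univ
  exact ⟨f, fun a b => hf a (Finset.mem_univ _) b (Finset.mem_univ _)⟩

lemma cr_rounds (S : K → Finset I) (d : ℕ)
    (hd : ∀ i, (Finset.univ.filter (fun c => i ∈ S c)).card ≤ d) (J : Finset I)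
    (P : ℕ → Finset (I × I)) (hP1 : ∀ k, ∀ p ∈ P k, p.1 ≠ p.2)
    (hP : ∀ k, ∀ p ∈ P k, ∀ p' ∈ P k, p ≠ p' → p.1 ≠ p'.1 ∧ p.1 ≠ p'.2 ∧ p.2 ≠ p'.1 ∧ p.2 ≠ p'.2)
    (r : ℕ) :
    ∃ J' ⊆ J, (∀ k < r, ∀ p ∈ P k, ¬ (p.1 ∈ J' ∧ p.2 ∈ J')) ∧
      ∀ c, ((S c ∩ J).card : ℝ) / 2 ^ r - 4 * d ≤ (S c ∩ J').card := by
  induction r with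
  | zero => exact ⟨J, le_rfl, by simp, fun c => by simp⟩
  | succ r ih =>
    obtain ⟨J1, hJ1, h1, h2⟩ := ih
    obtain ⟨J2, hJ2, h3, h4⟩ := cr_round S d hd J1 (P r) (hP1 r) (hP r)
    refine ⟨J2, hJ2.trans hJ1, ?_, ?_⟩
    · intro k hk p hp ⟨ha, hb⟩
      rcases Nat.lt_succ_iff_lt_or_eq.1 hk with hk | rfl
      · exact h1 k hk p hp ⟨hJ2 ha, hJ2 hb⟩
      · exact h3 p hp ⟨ha, hb⟩
    · intro c
      have a1 := h2 c
      have a2 := h4 c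
      have e : ((S c ∩ J).card : ℝ) / 2 ^ (r + 1) = ((S c ∩ J).card / 2 ^ r) / 2 := by
        rw [pow_succ]; field_simp
      rw [e]; linarith

theorem conflict_res (S : K → Finset I) (d : ℕ)
    (hd : ∀ i, (Finset.univ.filter (fun c => i ∈ S c)).card ≤ d) (J : Finset I)
    (conf : I → I → Prop) (hs : ∀ a b, conf a b → conf b a) (Δ : ℕ)
    (hΔ : ∀ i ∈ J, (J.filter (fun j => conf i j)).card ≤ Δ) :
    ∃ J' ⊆ J, (∀ a ∈ J', ∀ b ∈ J', a ≠ b → ¬ conf a b) ∧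
      ∀ c, ((S c ∩ J).card : ℝ) / 2 ^ (4 * Δ + 1) - 4 * d ≤ (S c ∩ J').card := by
  let isP : I × I → Prop := fun p => p.1 ∈ J ∧ p.2 ∈ J ∧ conf p.1 p.2 ∧ p.1 ≠ p.2
  obtain ⟨rel, hrel⟩ : ∃ rel : I × I → I × I → Prop, ∀ p q, rel p q ↔ isP p ∧ isP q ∧
    (p.1 = q.1 ∨ p.1 = q.2 ∨ p.2 = q.1 ∨ p.2 = q.2) := ⟨_, fun _ _ => Iff.rfl⟩
  obtain ⟨f, hf⟩ := greedy_color rel (by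
    intro p q hpq
    rw [hrel] at hpq ⊢
    obtain ⟨h1, h2, h3⟩ := hpq
    refine ⟨h2, h1, ?_⟩
    rcases h3 with h | h | h | h
    · exact Or.inl h.symm
    · exact Or.inr (Or.inr (Or.inl h.symm))
    · exact Or.inr (Or.inl h.symm)
    · exact Or.inr (Or.inr (Or.inr h.symm))) (4 * Δ) (by
    intro p
    by_cases hp : isP p
    swap
    · rw [Finset.filter_false_of_mem]
      · simp
      · intro q _ h; exact hp ((hrel _ _).1 h).1
    have hsub : Finset.univ.filter (fun q => rel p q) ⊆
        (((J.filter (fun j => conf p.1 j)).image (fun j => (p.1, j)) ∪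
        (J.filter (fun j => conf p.1 j)).image (fun j => (j, p.1))) ∪
        ((J.filter (fun j => conf p.2 j)).image (fun j => (p.2, j)) ∪
        (J.filter (fun j => conf p.2 j)).image (fun j => (j, p.2)))) := by
      rintro ⟨x, y⟩ hq
      simp only [Finset.mem_filter, Finset.mem_univ, true_and, hrel] at hq
      obtain ⟨_, ⟨hx, hy, hc, _⟩, h3⟩ := hq
      simp only at hx hy hc h3
      simp only [Finset.mem_union, Finset.mem_image, Finset.mem_filter, Prod.mk.injEq]
      rcases h3 with h | h | h | h
      · left; left; exact ⟨y, ⟨hy, h ▸ hc⟩, h, rfl⟩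
      · left; right; exact ⟨x, ⟨hx, h ▸ hs _ _ hc⟩, rfl, h⟩
      · right; left; exact ⟨y, ⟨hy, h ▸ hc⟩, h, rfl⟩
      · right; right; exact ⟨x, ⟨hx, h ▸ hs _ _ hc⟩, rfl, h⟩
    refine (Finset.card_le_card hsub).trans ?_
    refine (Finset.card_union_le _ _).trans ?_
    have a1 := hΔ p.1 hp.1
    have a2 := hΔ p.2 hp.2.1
    have b1 := (Finset.card_union_le ((J.filter (fun j => conf p.1 j)).image (fun j => (p.1, j)))
        ((J.filter (fun j => conf p.1 j)).image (fun j => (j, p.1)))).trans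
        (Nat.add_le_add Finset.card_image_le Finset.card_image_le)
    have b2 := (Finset.card_union_le ((J.filter (fun j => conf p.2 j)).image (fun j => (p.2, j)))
        ((J.filter (fun j => conf p.2 j)).image (fun j => (j, p.2)))).trans
        (Nat.add_le_add Finset.card_image_le Finset.card_image_le)
    omega)
  obtain ⟨J', hJ', h1, h2⟩ := cr_rounds S d hd J
    (fun k => Finset.univ.filter (fun p => isP p ∧ (f p : ℕ) = k)) (by
      intro k p hp
      simp only [Finset.mem_filter, Finset.mem_univ, true_and] at hp
      exact hp.1.2.2.2) (by
      intro k p hp q hq hne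
      simp only [Finset.mem_filter, Finset.mem_univ, true_and] at hp hq
      have hfe : f p = f q := Fin.ext (hp.2.trans hq.2.symm)
      refine ⟨?_, ?_, ?_, ?_⟩ <;> intro h
      · exact hf p q hne ((hrel _ _).2 ⟨hp.1, hq.1, Or.inl h⟩) hfe
      · exact hf p q hne ((hrel _ _).2 ⟨hp.1, hq.1, Or.inr (Or.inl h)⟩) hfe
      · exact hf p q hne ((hrel _ _).2 ⟨hp.1, hq.1, Or.inr (Or.inr (Or.inl h))⟩) hfe
      · exact hf p q hne ((hrel _ _).2 ⟨hp.1, hq.1, Or.inr (Or.inr (Or.inr h))⟩) hfe) (4 * Δ + 1)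
  refine ⟨J', hJ', ?_, h2⟩
  intro a ha b hb hab hc
  refine h1 (f (a, b)) (f (a, b)).2 (a, b) ?_ ⟨ha, hb⟩
  simp only [Finset.mem_filter, Finset.mem_univ, true_and, and_true]
  exact ⟨hJ' ha, hJ' hb, hc, hab⟩

end BF
end P5

namespace P5
open scoped Classical
set_option linter.unusedSectionVars false
section rado
variable {X Γ : Type} [Fintype X] [Fintype Γ] [DecidableEq X] [DecidableEq Γ]

lemma rado_aux (r : Finset X → ℕ) (hmono : ∀ A B, A ⊆ B → r A ≤ r B)
    (hsub : ∀ A B, r (A ∪ B) + r (A ∩ B) ≤ r A + r B) (R : ℕ) (n : ℕ) :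
    ∀ A : Γ → Finset X, ∑ γ, (A γ).card = n →
    (∀ J : Finset Γ, R ≤ r (J.biUnion A) + Jᶜ.card) →
    ∃ A' : Γ → Finset X, (∀ γ, A' γ ⊆ A γ ∧ (A' γ).card ≤ 1) ∧ R ≤ r (Finset.univ.biUnion A') := by
  induction n using Nat.strong_induction_on with
  | _ n ih =>
    intro A hn hcond
    by_cases hall : ∀ γ, (A γ).card ≤ 1
    · refine ⟨A, fun γ => ⟨le_rfl, hall γ⟩, ?_⟩
      have := hcond Finset.univ
      simpa using this
    push Not at hall
    obtain ⟨γ, hγ⟩ := hall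
    obtain ⟨a, ha, b, hb, hab⟩ := Finset.one_lt_card.1 hγ
    let del : X → Γ → Finset X := fun x => Function.update A γ ((A γ).erase x)
    have hdel : ∀ x ∈ A γ, (∀ J : Finset Γ, R ≤ r (J.biUnion (del x)) + Jᶜ.card) →
        ∃ A' : Γ → Finset X, (∀ γ, A' γ ⊆ A γ ∧ (A' γ).card ≤ 1) ∧
          R ≤ r (Finset.univ.biUnion A') := by
      intro x hx hJ
      have hsubd : ∀ δ, del x δ ⊆ A δ := by
        intro δ
        by_cases h : δ = γ
        · subst h; simp only [del, Function.update_self]; exact Finset.erase_subset _ _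
        · simp only [del, Function.update_of_ne h]; exact le_rfl
      obtain ⟨A', h1, h2⟩ := ih (∑ δ, (del x δ).card) (by
        rw [← hn]
        apply Finset.sum_lt_sum
        · intro δ _; exact Finset.card_le_card (hsubd δ)
        · refine ⟨γ, Finset.mem_univ _, ?_⟩
          simp only [del, Function.update_self]
          exact Finset.card_erase_lt_of_mem hx) (del x) rfl hJ
      exact ⟨A', fun δ => ⟨(h1 δ).1.trans (hsubd δ), (h1 δ).2⟩, h2⟩
    by_cases h1 : ∀ J : Finset Γ, R ≤ r (J.biUnion (del a)) + Jᶜ.card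
    · exact hdel a ha h1
    by_cases h2 : ∀ J : Finset Γ, R ≤ r (J.biUnion (del b)) + Jᶜ.card
    · exact hdel b hb h2
    exfalso
    push Not at h1 h2
    obtain ⟨J1, h1⟩ := h1
    obtain ⟨J2, h2⟩ := h2
    have hin : ∀ x (J : Finset Γ), r (J.biUnion (del x)) + Jᶜ.card < R → γ ∈ J := by
      intro x J h
      by_contra hJ
      have e : J.biUnion (del x) = J.biUnion A := by
        apply Finset.biUnion_congr rfl
        intro δ hδ
        have : δ ≠ γ := by rintro rfl; exact hJ hδ
        simp only [del, Function.update_of_ne this]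
      rw [e] at h
      exact absurd (hcond J) (not_le.2 h)
    have g1 := hin a J1 h1
    have g2 := hin b J2 h2
    have k1 : (J1 ∪ J2).biUnion A ⊆ J1.biUnion (del a) ∪ J2.biUnion (del b) := by
      intro x hx
      obtain ⟨δ, hδ, hx⟩ := Finset.mem_biUnion.1 hx
      by_cases h : δ = γ
      · subst h
        by_cases hxa : x = a
        · subst hxa
          apply Finset.mem_union_right
          refine Finset.mem_biUnion.2 ⟨δ, g2, ?_⟩
          simp only [del, Function.update_self]
          exact Finset.mem_erase.2 ⟨hab, hx⟩
        · apply Finset.mem_union_left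
          refine Finset.mem_biUnion.2 ⟨δ, g1, ?_⟩
          simp only [del, Function.update_self]
          exact Finset.mem_erase.2 ⟨hxa, hx⟩
      · rcases Finset.mem_union.1 hδ with hδ | hδ
        · apply Finset.mem_union_left
          refine Finset.mem_biUnion.2 ⟨δ, hδ, ?_⟩
          simpa only [del, Function.update_of_ne h] using hx
        · apply Finset.mem_union_right
          refine Finset.mem_biUnion.2 ⟨δ, hδ, ?_⟩
          simpa only [del, Function.update_of_ne h] using hx
    have k2 : ((J1 ∩ J2).erase γ).biUnion A ⊆ J1.biUnion (del a) ∩ J2.biUnion (del b) := by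
      intro x hx
      obtain ⟨δ, hδ, hx⟩ := Finset.mem_biUnion.1 hx
      rw [Finset.mem_erase, Finset.mem_inter] at hδ
      rw [Finset.mem_inter]
      refine ⟨Finset.mem_biUnion.2 ⟨δ, hδ.2.1, ?_⟩, Finset.mem_biUnion.2 ⟨δ, hδ.2.2, ?_⟩⟩
      · simpa only [del, Function.update_of_ne hδ.1] using hx
      · simpa only [del, Function.update_of_ne hδ.1] using hx
    have c1 := hcond (J1 ∪ J2)
    have c2 := hcond ((J1 ∩ J2).erase γ)
    have m1 := hmono _ _ k1
    have m2 := hmono _ _ k2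
    have sm := hsub (J1.biUnion (del a)) (J2.biUnion (del b))
    have q1 := Finset.card_compl (J1 ∪ J2)
    have q2 := Finset.card_compl ((J1 ∩ J2).erase γ)
    have q3 := Finset.card_compl J1
    have q4 := Finset.card_compl J2
    have q5 : ((J1 ∩ J2).erase γ).card = (J1 ∩ J2).card - 1 :=
      Finset.card_erase_of_mem (Finset.mem_inter.2 ⟨g1, g2⟩)
    have q6 : 0 < (J1 ∩ J2).card := Finset.card_pos.2 ⟨γ, Finset.mem_inter.2 ⟨g1, g2⟩⟩
    have q7 := Finset.card_union_add_card_inter J1 J2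
    have q8 := Finset.card_le_univ (J1 ∪ J2)
    have q9 := Finset.card_le_univ J1
    have q10 := Finset.card_le_univ J2
    have q11 := Finset.card_le_univ (J1 ∩ J2)
    omega

end rado

section graphic
variable {V E : Type} [Fintype V] [Fintype E] (s t : E → V)

/-- the edge e crosses X -/
def Cr (X : Set V) (e : E) : Prop := (s e ∈ X ∧ t e ∉ X) ∨ (s e ∉ X ∧ t e ∈ X)

noncomputable def chi (e : E) : V → ℝ := Pi.single (s e) 1 - Pi.single (t e) 1

noncomputable def spn (A : Finset E) : Submodule ℝ (V → ℝ) := Submodule.span ℝ (chi s t '' (A : Set E))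

noncomputable def rho (A : Finset E) : ℕ := Module.finrank ℝ (spn s t A)

lemma spn_mono {A B : Finset E} (h : A ⊆ B) : spn s t A ≤ spn s t B :=
  Submodule.span_mono (Set.image_mono (by exact_mod_cast h))

lemma rho_mono {A B : Finset E} (h : A ⊆ B) : rho s t A ≤ rho s t B :=
  Submodule.finrank_mono (spn_mono s t h)

lemma rho_sub (A B : Finset E) : rho s t (A ∪ B) + rho s t (A ∩ B) ≤ rho s t A + rho s t B := by
  unfold rho
  have h1 : spn s t (A ∪ B) = spn s t A ⊔ spn s t B := by
    unfold spn; rw [Finset.coe_union, Set.image_union, Submodule.span_union]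
  have h2 : spn s t (A ∩ B) ≤ spn s t A ⊓ spn s t B :=
    le_inf (spn_mono s t Finset.inter_subset_left) (spn_mono s t Finset.inter_subset_right)
  have h3 := Submodule.finrank_mono h2
  have h4 := Submodule.finrank_sup_add_finrank_inf_eq (spn s t A) (spn s t B)
  rw [h1]; omega

lemma rho_le_of_map {W : Type} [AddCommGroup W] [Module ℝ W] [FiniteDimensional ℝ W]
    (Ψ : (V → ℝ) →ₗ[ℝ] W) (hΨ : Function.Surjective Ψ) (A : Finset E)
    (h : ∀ e ∈ A, Ψ (chi s t e) = 0) : rho s t A + Module.finrank ℝ W ≤ Fintype.card V := by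
  have h1 : spn s t A ≤ LinearMap.ker Ψ := by
    apply Submodule.span_le.2
    rintro _ ⟨e, he, rfl⟩
    exact h e he
  have h2 := Submodule.finrank_mono h1
  have h3 := LinearMap.finrank_range_add_finrank_ker Ψ
  rw [LinearMap.range_eq_top.2 hΨ, finrank_top] at h3
  simp only [Module.finrank_fintype_fun_eq_card] at h3
  unfold rho
  omega

noncomputable def sumOn (X : Set V) : (V → ℝ) →ₗ[ℝ] ℝ :=
  ∑ v ∈ Finset.univ.filter (fun v => v ∈ X), LinearMap.proj v

lemma sumOn_single (X : Set V) (v : V) (c : ℝ) : sumOn X (Pi.single v c) = if v ∈ X then c else 0 := by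
  unfold sumOn
  simp only [LinearMap.coe_sum, Finset.sum_apply, LinearMap.coe_proj, Function.eval]
  by_cases h : v ∈ X
  · rw [Finset.sum_eq_single v]
    · simp [h]
    · intro b _ hb; simp [hb]
    · simp [h]
  · rw [Finset.sum_eq_zero]
    · simp [h]
    · intro w hw
      have : w ≠ v := by rintro rfl; simp at hw; exact h hw
      simp [this]

lemma rho_le (v0 : V) (A : Finset E) : rho s t A + 1 ≤ Fintype.card V := by
  have := rho_le_of_map s t (sumOn (Set.univ : Set V)) (by
    intro c; exact ⟨Pi.single v0 c, by simp [sumOn_single]⟩) A (by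
    intro e _; simp [chi, sumOn_single])
  simpa using this

lemma crossed_of_rho (A : Finset E) (h : Fintype.card V ≤ rho s t A + 1) (X : Set V) (h1 : X.Nonempty)
    (h2 : Xᶜ.Nonempty) : ∃ e ∈ A, Cr s t X e := by
  by_contra hcon
  push Not at hcon
  obtain ⟨x, hx⟩ := h1
  obtain ⟨y, hy⟩ := h2
  have hy' : y ∉ X := hy
  have := rho_le_of_map s t ((sumOn X).prod (sumOn Xᶜ)) (by
    rintro ⟨a, b⟩
    refine ⟨Pi.single x a + Pi.single y b, ?_⟩
    simp [sumOn_single, hx, hy']) A (by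
    intro e he
    have := hcon e he
    unfold Cr at this
    by_cases c1 : s e ∈ X <;> by_cases c2 : t e ∈ X
    · simp [chi, sumOn_single, c1, c2]
    · exact absurd (Or.inl ⟨c1, c2⟩) this
    · exact absurd (Or.inr ⟨c1, c2⟩) this
    · simp [chi, sumOn_single, c1, c2])
  simp at this
  omega

/-- connectivity classes of an edge set -/
def ecls (A : Finset E) : Setoid V :=
  Relation.EqvGen.setoid (fun a b => ∃ e ∈ A, s e = a ∧ t e = b)

lemma rho_ge (A : Finset E) : Fintype.card V ≤ rho s t A + Fintype.card (Quotient (ecls s t A)) := by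
  let Φ : (V → ℝ) →ₗ[ℝ] (Quotient (ecls s t A) → ℝ) :=
    LinearMap.pi (fun c => sumOn {v | Quotient.mk (ecls s t A) v = c})
  have hsp : ∀ v w, (ecls s t A).r v w →
      (Pi.single v 1 - Pi.single w 1 : V → ℝ) ∈ spn s t A := by
    intro v w h
    induction h with
    | rel x y h =>
      obtain ⟨e, he, rfl, rfl⟩ := h
      exact Submodule.subset_span ⟨e, he, rfl⟩
    | refl x => simp
    | symm x y _ ih =>
      have := Submodule.neg_mem _ ih
      simpa using this
    | trans x y z _ _ ih1 ih2 =>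
      have := Submodule.add_mem _ ih1 ih2
      simpa using this
  have hker : LinearMap.ker Φ ≤ spn s t A := by
    intro f hf
    rw [LinearMap.mem_ker] at hf
    have hf' : ∀ c, ∑ v ∈ Finset.univ.filter (fun v => Quotient.mk (ecls s t A) v = c), f v = 0 := by
      intro c
      have := congrFun hf c
      simpa [Φ, sumOn] using this
    let rep : V → V := fun v => (Quotient.mk (ecls s t A) v).out
    have e1 : f = ∑ v, f v • (Pi.single v 1 - Pi.single (rep v) 1 : V → ℝ) := by
      have e2 : f = ∑ v, f v • (Pi.single v 1 : V → ℝ) := by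
        ext w
        simp [Finset.sum_apply, Pi.single_apply]
      have e3 : ∑ v, f v • (Pi.single (rep v) 1 : V → ℝ) = 0 := by
        rw [← Finset.sum_fiberwise Finset.univ (fun v => Quotient.mk (ecls s t A) v)]
        apply Finset.sum_eq_zero
        intro c _
        have : ∀ v ∈ Finset.univ.filter (fun v => Quotient.mk (ecls s t A) v = c),
            f v • (Pi.single (rep v) 1 : V → ℝ) = f v • (Pi.single c.out 1 : V → ℝ) := by
          intro v hv
          simp only [Finset.mem_filter, Finset.mem_univ, true_and] at hv
          simp only [rep, hv]
        rw [Finset.sum_congr rfl this, ← Finset.sum_smul, hf' c, zero_smul]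
      simp only [smul_sub, Finset.sum_sub_distrib, e3, sub_zero]
      exact e2
    rw [e1]
    refine Submodule.sum_mem _ fun v _ => Submodule.smul_mem _ _ (hsp _ _ ?_)
    have : Quotient.mk (ecls s t A) v = Quotient.mk (ecls s t A) (rep v) := by
      simp only [rep, Quotient.out_eq]
    exact Quotient.exact this
  have h1 := Submodule.finrank_mono hker
  have h2 := LinearMap.finrank_range_add_finrank_ker Φ
  have h3 := Submodule.finrank_le (LinearMap.range Φ)
  simp only [Module.finrank_fintype_fun_eq_card] at h2 h3
  unfold rho
  omega

lemma ecls_edge (A : Finset E) (e : E) (he : e ∈ A) :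
    Quotient.mk (ecls s t A) (s e) = Quotient.mk (ecls s t A) (t e) :=
  Quotient.sound (Relation.EqvGen.rel _ _ ⟨e, he, rfl, rfl⟩)

theorem lemmaR {G : Type} (E0 : Finset E) (g : E → G) (q k : ℕ)
    (hq : ∀ γ, (E0.filter (fun e => g e = γ)).card ≤ q) (hq0 : 0 < q)
    (hcut : ∀ X : Set V, X.Nonempty → Xᶜ.Nonempty →
      2 * q * k ≤ (E0.filter (fun e => Cr s t X e)).card) :
    ∃ S : Fin k → Finset E, (∀ i, S i ⊆ E0) ∧
      (∀ i, ∀ X : Set V, X.Nonempty → Xᶜ.Nonempty → ∃ e ∈ S i, Cr s t X e) ∧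
      (∀ i j, ∀ e ∈ S i, ∀ e' ∈ S j, g e = g e' → i = j ∧ e = e') := by
  let r : Finset (E × Fin k) → ℕ := fun X => ∑ i, rho s t (Finset.univ.filter (fun e => (e, i) ∈ X))
  have hrm : ∀ A B, A ⊆ B → r A ≤ r B := by
    intro A B h
    refine Finset.sum_le_sum fun i _ => rho_mono s t ?_
    intro e he
    simp only [Finset.mem_filter, Finset.mem_univ, true_and] at he ⊢
    exact h he
  have hrs : ∀ A B, r (A ∪ B) + r (A ∩ B) ≤ r A + r B := by
    intro A B
    simp only [r, ← Finset.sum_add_distrib]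
    refine Finset.sum_le_sum fun i _ => ?_
    have := rho_sub s t (Finset.univ.filter (fun e => (e, i) ∈ A))
      (Finset.univ.filter (fun e => (e, i) ∈ B))
    rw [← Finset.filter_or, ← Finset.filter_and] at this
    simpa only [Finset.mem_union, Finset.mem_inter] using this
  let A : (E0.image g) → Finset (E × Fin k) := fun γ =>
    Finset.univ.filter (fun p => p.1 ∈ E0 ∧ g p.1 = γ.1)
  obtain ⟨A', hA', hR⟩ := rado_aux r hrm hrs (k * (Fintype.card V - 1)) _ A rfl (by
    intro J
    let EJ : Finset E := E0.filter (fun e => ∃ γ ∈ J, g e = γ.1)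
    have e1 : r (J.biUnion A) = k * rho s t EJ := by
      simp only [r]
      have : ∀ i : Fin k, Finset.univ.filter (fun e => (e, i) ∈ J.biUnion A) = EJ := by
        intro i
        ext e
        simp only [Finset.mem_filter, Finset.mem_univ, true_and, Finset.mem_biUnion, A, EJ]
        constructor
        · rintro ⟨γ, h1, h2, h3⟩; exact ⟨h2, γ, h1, h3⟩
        · rintro ⟨h2, γ, h1, h3⟩; exact ⟨γ, h1, h2, h3⟩
      rw [Finset.sum_congr rfl (fun i _ => by rw [this i])]
      simp
    rw [e1]
    have h1 := rho_ge s t EJ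
    set c := Fintype.card (Quotient (ecls s t EJ)) with hc
    by_cases hc2 : c ≤ 1
    · have : k * (Fintype.card V - 1) ≤ k * rho s t EJ := Nat.mul_le_mul_left _ (by omega)
      omega
    -- at least two classes
    set Q := E0 \ EJ with hQ
    have hcross : ∀ x : Quotient (ecls s t EJ),
        2 * q * k ≤ (Q.filter (fun e => x = Quotient.mk _ (s e) ∨ x = Quotient.mk _ (t e))).card := by
      intro x
      have hX := hcut {v | Quotient.mk (ecls s t EJ) v = x} ⟨x.out, Quotient.out_eq x⟩ (by
        by_contra hne
        rw [Set.not_nonempty_iff_eq_empty, Set.compl_empty_iff] at hne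
        apply hc2
        rw [hc, Fintype.card_le_one_iff]
        have : ∀ y, y = x := by
          intro y
          have : y.out ∈ {v | Quotient.mk (ecls s t EJ) v = x} := by rw [hne]; trivial
          have h : Quotient.mk (ecls s t EJ) y.out = x := this
          rw [← h, Quotient.out_eq]
        intro a b; rw [this a, this b])
      refine hX.trans (Finset.card_le_card ?_)
      intro e he
      rw [Finset.mem_filter] at he ⊢
      obtain ⟨he0, hcr⟩ := he
      refine ⟨?_, ?_⟩
      · rw [hQ, Finset.mem_sdiff]
        refine ⟨he0, fun hEJ => ?_⟩
        have := ecls_edge s t EJ e hEJ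
        rcases hcr with ⟨a1, a2⟩ | ⟨a1, a2⟩
        · exact a2 (this.symm.trans a1)
        · exact a1 (this.trans a2)
      · rcases hcr with ⟨a1, a2⟩ | ⟨a1, a2⟩
        · exact Or.inl (Eq.symm a1)
        · exact Or.inr (Eq.symm a2)
    have h2 : c * (2 * q * k) ≤ 2 * Q.card := by
      calc c * (2 * q * k) = ∑ x : Quotient (ecls s t EJ), 2 * q * k := by simp [hc]
        _ ≤ ∑ x : Quotient (ecls s t EJ), (Q.filter (fun e => x = Quotient.mk _ (s e) ∨
              x = Quotient.mk _ (t e))).card := Finset.sum_le_sum fun x _ => hcross x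
        _ = ∑ e ∈ Q, (Finset.univ.filter (fun x : Quotient (ecls s t EJ) =>
              x = Quotient.mk _ (s e) ∨ x = Quotient.mk _ (t e))).card := by
            simp only [Finset.card_filter]
            rw [Finset.sum_comm]
        _ ≤ ∑ e ∈ Q, 2 := by
            refine Finset.sum_le_sum fun e _ => ?_
            refine (Finset.card_le_card ?_).trans
              (Finset.card_le_two (a := Quotient.mk (ecls s t EJ) (s e))
                (b := Quotient.mk (ecls s t EJ) (t e)))
            intro x hx
            simpa using hx
        _ = 2 * Q.card := by simp [mul_comm]
    have h3 : Q.card ≤ q * Jᶜ.card := by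
      have himg : Q.image g ⊆ Jᶜ.image Subtype.val := by
        intro γ hγ
        obtain ⟨e, he, rfl⟩ := Finset.mem_image.1 hγ
        rw [hQ, Finset.mem_sdiff] at he
        refine Finset.mem_image.2 ⟨⟨g e, Finset.mem_image_of_mem g he.1⟩, ?_, rfl⟩
        rw [Finset.mem_compl]
        intro hJ
        exact he.2 (Finset.mem_filter.2 ⟨he.1, _, hJ, rfl⟩)
      have h4 := Finset.card_le_mul_card_image (f := g) Q q (by
        intro γ _
        refine (Finset.card_le_card ?_).trans (hq γ)
        exact Finset.filter_subset_filter _ Finset.sdiff_subset)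
      have h5 := (Finset.card_le_card himg).trans Finset.card_image_le
      exact h4.trans (Nat.mul_le_mul_left _ h5)
    have h4 : q * (c * k) ≤ q * Jᶜ.card := by nlinarith
    have h5 : c * k ≤ Jᶜ.card := Nat.le_of_mul_le_mul_left h4 hq0
    have h6 : k * (Fintype.card V - 1) ≤ k * (rho s t EJ + c) := Nat.mul_le_mul_left _ (by omega)
    nlinarith)
  let S : Fin k → Finset E := fun i =>
    Finset.univ.filter (fun e => (e, i) ∈ Finset.univ.biUnion A')
  have hS : ∀ i e, e ∈ S i → ∃ h : e ∈ E0, (e, i) ∈ A' ⟨g e, Finset.mem_image_of_mem g h⟩ := by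
    intro i e he
    simp only [S, Finset.mem_filter, Finset.mem_univ, true_and, Finset.mem_biUnion] at he
    obtain ⟨γ, hγ⟩ := he
    have h1 := (hA' γ).1 hγ
    simp only [A, Finset.mem_filter, Finset.mem_univ, true_and] at h1
    refine ⟨h1.1, ?_⟩
    have : (⟨g e, Finset.mem_image_of_mem g h1.1⟩ : E0.image g) = γ := Subtype.ext h1.2
    rw [this]; exact hγ
  refine ⟨S, fun i e he => (hS i e he).1, ?_, ?_⟩
  · intro i X hX1 hX2
    apply crossed_of_rho s t (S i) _ X hX1 hX2
    obtain ⟨v0, _⟩ := hX1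
    have hR' : k * (Fintype.card V - 1) ≤ ∑ i, rho s t (S i) := hR
    have hle : ∀ j, rho s t (S j) ≤ Fintype.card V - 1 := fun j => by
      have := rho_le s t v0 (S j); omega
    by_contra hlt
    push Not at hlt
    have : ∑ j, rho s t (S j) < ∑ j : Fin k, (Fintype.card V - 1) :=
      Finset.sum_lt_sum (fun j _ => hle j) ⟨i, Finset.mem_univ _, by omega⟩
    simp at this
    omega
  · intro i j e he e' he' hg
    obtain ⟨h0, h1⟩ := hS i e he
    obtain ⟨h0', h1'⟩ := hS j e' he'
    have : (⟨g e, Finset.mem_image_of_mem g h0⟩ : E0.image g) =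
      ⟨g e', Finset.mem_image_of_mem g h0'⟩ := Subtype.ext hg
    rw [this] at h1
    have h2 := Finset.card_le_one.1 (hA' _).2 _ h1 _ h1'
    rw [Prod.mk.injEq] at h2
    exact ⟨h2.2, h2.1⟩

end graphic
end P5

namespace P5
open scoped Classical
set_option linter.unusedSectionVars false
section grp
variable {α : Type}

lemma exists_groups (D : ℕ) (hD : 0 < D) (n : ℕ) : ∀ N : Finset α, N.card = n → D ≤ n →
    ∃ f : α → ℕ, ∀ x ∈ N, D ≤ (N.filter (fun y => f y = f x)).card ∧
      (N.filter (fun y => f y = f x)).card ≤ 2 * D := by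
  induction n using Nat.strong_induction_on with
  | _ n ih =>
    intro N hN hDn
    by_cases h2 : n ≤ 2 * D
    · refine ⟨fun _ => 0, fun x _ => ?_⟩
      simp [hN, hDn, h2]
    obtain ⟨A, hA, hAc⟩ := Finset.exists_subset_card_eq (s := N) (n := D) (by omega)
    have hc : (N \ A).card = n - D := by rw [Finset.card_sdiff_of_subset hA, hN, hAc]
    obtain ⟨f, hf⟩ := ih (n - D) (by omega) (N \ A) hc (by omega)
    refine ⟨fun x => if x ∈ A then 0 else f x + 1, fun x hx => ?_⟩
    by_cases hxA : x ∈ A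
    · have : N.filter (fun y => (if y ∈ A then 0 else f y + 1) = if x ∈ A then 0 else f x + 1) = A := by
        ext y
        simp only [hxA, if_true, Finset.mem_filter]
        constructor
        · rintro ⟨_, h⟩
          by_contra hy
          simp [hy] at h
        · intro hy; exact ⟨hA hy, by simp [hy]⟩
      rw [this, hAc]; omega
    · have : N.filter (fun y => (if y ∈ A then 0 else f y + 1) = if x ∈ A then 0 else f x + 1) =
          (N \ A).filter (fun y => f y = f x) := by
        ext y
        simp only [hxA, if_false, Finset.mem_filter, Finset.mem_sdiff]
        constructor
        · rintro ⟨h1, h⟩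
          by_cases hy : y ∈ A
          · simp [hy] at h
          · simp only [hy, if_false] at h
            exact ⟨⟨h1, hy⟩, by omega⟩
        · rintro ⟨⟨h1, hy⟩, h⟩
          simp [h1, hy, h]
      rw [this]
      exact hf x (by simp [hx, hxA])

end grp

section walks
variable {V : Type} [Fintype V] (Γ : SimpleGraph V) (grp : V → V → ℕ)

noncomputable def nb (v : V) : Finset V := Finset.univ.filter (fun x => Γ.Adj v x)

lemma mem_nb {v x : V} : x ∈ nb Γ v ↔ Γ.Adj v x := by simp [nb]

noncomputable def nxt (u w : V) : Finset V := (nb Γ w).filter (fun x => grp w x = grp w u)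

noncomputable def ext : ℕ → V → V → Finset (List V)
  | 0, _, _ => {[]}
  | n + 1, u, w => (nxt Γ grp u w).biUnion (fun x => (ext n w x).image (fun l => x :: l))

lemma ext_zero (u w : V) : ext Γ grp 0 u w = {[]} := rfl
lemma ext_succ (n : ℕ) (u w : V) : ext Γ grp (n + 1) u w =
  (nxt Γ grp u w).biUnion (fun x => (ext Γ grp n w x).image (fun l => x :: l)) := rfl

def Wk (l : List V) : Prop := (∀ a b, [a, b] <:+: l → Γ.Adj a b) ∧
  (∀ a b c, [a, b, c] <:+: l → grp b a = grp b c)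

lemma Wk.rev {l : List V} (h : Wk Γ grp l) : Wk Γ grp l.reverse := by
  refine ⟨fun a b hab => ?_, fun a b c habc => ?_⟩
  · have : [b, a] <:+: l := by
      rw [← List.reverse_infix]; simpa using hab
    exact (h.1 b a this).symm
  · have : [c, b, a] <:+: l := by
      rw [← List.reverse_infix]; simpa using habc
    exact (h.2 c b a this).symm

lemma Wk.infix {l l' : List V} (h : Wk Γ grp l) (hl : l' <:+: l) : Wk Γ grp l' :=
  ⟨fun a b hab => h.1 a b (hab.trans hl), fun a b c habc => h.2 a b c (habc.trans hl)⟩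

lemma Wk_two (u w : V) : Wk Γ grp [u, w] ↔ Γ.Adj u w := by
  constructor
  · intro h; exact h.1 u w (List.infix_refl _)
  · intro h
    refine ⟨fun a b hab => ?_, fun a b c habc => ?_⟩
    · have := hab.eq_of_length (by simp)
      simp at this; rw [this.1, this.2]; exact h
    · have := habc.length_le; simp at this

lemma Wk_cons (u w x : V) (l : List V) : Wk Γ grp (u :: w :: x :: l) ↔
    Γ.Adj u w ∧ grp w u = grp w x ∧ Wk Γ grp (w :: x :: l) := by
  constructor
  · intro h
    refine ⟨h.1 u w ⟨[], x :: l, by simp⟩, h.2 u w x ⟨[], l, by simp⟩, h.infix Γ grp ?_⟩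
    exact (List.suffix_cons _ _).isInfix
  · rintro ⟨h1, h2, h3⟩
    refine ⟨fun a b hab => ?_, fun a b c habc => ?_⟩
    · rw [List.infix_cons_iff] at hab
      rcases hab with hab | hab
      · simp only [List.cons_prefix_cons, List.nil_prefix, and_true] at hab
        rw [hab.1, hab.2]; exact h1
      · exact h3.1 a b hab
    · rw [List.infix_cons_iff] at habc
      rcases habc with hab | hab
      · simp only [List.cons_prefix_cons, List.nil_prefix, and_true] at hab
        rw [hab.1, hab.2.1, hab.2.2]; exact h2
      · exact h3.2 a b c hab

lemma mem_ext (n : ℕ) : ∀ (u w : V) (l : List V), Γ.Adj u w →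
    (l ∈ ext Γ grp n u w ↔ l.length = n ∧ Wk Γ grp (u :: w :: l)) := by
  induction n with
  | zero =>
    intro u w l h
    rw [ext_zero, Finset.mem_singleton, List.length_eq_zero_iff]
    constructor
    · rintro rfl; exact ⟨rfl, (Wk_two Γ grp u w).2 h⟩
    · exact fun h => h.1
  | succ n ih =>
    intro u w l h
    rw [ext_succ, Finset.mem_biUnion]
    constructor
    · rintro ⟨x, hx, hl⟩
      rw [Finset.mem_image] at hl
      obtain ⟨l', hl', rfl⟩ := hl
      rw [nxt, Finset.mem_filter, mem_nb] at hx
      rw [ih w x l' hx.1] at hl'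
      refine ⟨by simp [hl'.1], ?_⟩
      rw [Wk_cons]; exact ⟨h, hx.2.symm, hl'.2⟩
    · rintro ⟨h1, h2⟩
      cases l with
      | nil => simp at h1
      | cons x l =>
        rw [Wk_cons] at h2
        have hadj : Γ.Adj w x := h2.2.2.1 w x ⟨[], l, by simp⟩
        refine ⟨x, ?_, ?_⟩
        · rw [nxt, Finset.mem_filter, mem_nb]; exact ⟨hadj, h2.2.1.symm⟩
        · rw [Finset.mem_image]
          refine ⟨l, (ih w x l hadj).2 ⟨by simpa using h1, h2.2.2⟩, rfl⟩

variable (D : ℕ)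

lemma ext_card_le (hu : ∀ u w, (nxt Γ grp u w).card ≤ 2 * D) (n : ℕ) :
    ∀ u w, (ext Γ grp n u w).card ≤ (2 * D) ^ n := by
  induction n with
  | zero => intro u w; simp [ext_zero]
  | succ n ih =>
    intro u w
    rw [ext_succ]
    refine Finset.card_biUnion_le.trans ?_
    calc ∑ x ∈ nxt Γ grp u w, ((ext Γ grp n w x).image (fun l => x :: l)).card
        ≤ ∑ x ∈ nxt Γ grp u w, (2 * D) ^ n :=
          Finset.sum_le_sum fun x _ => Finset.card_image_le.trans (ih w x)
      _ = (nxt Γ grp u w).card * (2 * D) ^ n := by simp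
      _ ≤ 2 * D * (2 * D) ^ n := Nat.mul_le_mul_right _ (hu u w)
      _ = (2 * D) ^ (n + 1) := by rw [pow_succ]; ring

lemma ext_through_le (hu : ∀ u w, (nxt Γ grp u w).card ≤ 2 * D) (y : V) (n : ℕ) :
    ∀ u w, 2 * D * ((ext Γ grp n u w).filter (fun l => y ∈ l)).card ≤ n * (2 * D) ^ n := by
  induction n with
  | zero =>
    intro u w
    rw [ext_zero]
    simp [Finset.filter_singleton]
  | succ n ih =>
    intro u w
    have hsub : (ext Γ grp (n + 1) u w).filter (fun l => y ∈ l) ⊆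
        (ext Γ grp n w y).image (fun l => y :: l) ∪ (nxt Γ grp u w).biUnion
          (fun x => ((ext Γ grp n w x).filter (fun l => y ∈ l)).image (fun l => x :: l)) := by
      intro l hl
      rw [Finset.mem_filter, ext_succ, Finset.mem_biUnion] at hl
      obtain ⟨⟨x, hx, hl⟩, hy⟩ := hl
      obtain ⟨l', hl', rfl⟩ := Finset.mem_image.1 hl
      rw [Finset.mem_union]
      by_cases hxy : y = x
      · subst hxy
        left; exact hl
      · right
        rw [List.mem_cons] at hy
        refine Finset.mem_biUnion.2 ⟨x, hx, Finset.mem_image.2 ⟨l', ?_, rfl⟩⟩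
        exact Finset.mem_filter.2 ⟨hl', hy.resolve_left hxy⟩
    have h1 := (Finset.card_le_card hsub).trans (Finset.card_union_le _ _)
    have h2 : ((ext Γ grp n w y).image (fun l => y :: l)).card ≤ (2 * D) ^ n :=
      Finset.card_image_le.trans (ext_card_le Γ grp D hu n w y)
    have h3 : 2 * D * ((nxt Γ grp u w).biUnion
          (fun x => ((ext Γ grp n w x).filter (fun l => y ∈ l)).image (fun l => x :: l))).card ≤
          2 * D * (n * (2 * D) ^ n) := by
      calc _ ≤ 2 * D * ∑ x ∈ nxt Γ grp u w, ((ext Γ grp n w x).filter (fun l => y ∈ l)).card :=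
            Nat.mul_le_mul_left _ (Finset.card_biUnion_le.trans
              (Finset.sum_le_sum fun x _ => Finset.card_image_le))
        _ = ∑ x ∈ nxt Γ grp u w, 2 * D * ((ext Γ grp n w x).filter (fun l => y ∈ l)).card := by
            rw [Finset.mul_sum]
        _ ≤ ∑ x ∈ nxt Γ grp u w, n * (2 * D) ^ n := Finset.sum_le_sum fun x _ => ih w x
        _ = (nxt Γ grp u w).card * (n * (2 * D) ^ n) := by simp
        _ ≤ _ := Nat.mul_le_mul_right _ (hu u w)
    calc _ ≤ 2 * D * (_ + _) := Nat.mul_le_mul_left _ h1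
      _ ≤ 2 * D * (2 * D) ^ n + 2 * D * (n * (2 * D) ^ n) := by
          rw [mul_add]; exact Nat.add_le_add (Nat.mul_le_mul_left _ h2) h3
      _ = (n + 1) * (2 * D) ^ (n + 1) := by rw [pow_succ]; ring

lemma ext_lower (hl : ∀ u w, Γ.Adj w u → D ≤ (nxt Γ grp u w).card) (n : ℕ) :
    ∀ u w (f : List V), Γ.Adj w u → (D - (f.length + n)) ^ n ≤
      ((ext Γ grp n u w).filter (fun l => l.Nodup ∧ ∀ x ∈ l, x ∉ f)).card := by
  induction n with
  | zero =>
    intro u w f _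
    simp [ext_zero, Finset.filter_singleton]
  | succ n ih =>
    intro u w f hadj
    have hsub : ((nxt Γ grp u w) \ f.toFinset).biUnion (fun x => ((ext Γ grp n w x).filter
        (fun l => l.Nodup ∧ ∀ z ∈ l, z ∉ x :: f)).image (fun l => x :: l)) ⊆
        (ext Γ grp (n + 1) u w).filter (fun l => l.Nodup ∧ ∀ x ∈ l, x ∉ f) := by
      intro l h
      obtain ⟨x, hx, h⟩ := Finset.mem_biUnion.1 h
      obtain ⟨l', hl', rfl⟩ := Finset.mem_image.1 h
      rw [Finset.mem_sdiff, List.mem_toFinset] at hx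
      rw [Finset.mem_filter] at hl' ⊢
      obtain ⟨h1, h2, h3⟩ := hl'
      refine ⟨?_, ?_, ?_⟩
      · rw [ext_succ]
        exact Finset.mem_biUnion.2 ⟨x, hx.1, Finset.mem_image.2 ⟨l', h1, rfl⟩⟩
      · rw [List.nodup_cons]
        refine ⟨fun hm => h3 x hm (by simp), h2⟩
      · intro z hz
        rw [List.mem_cons] at hz
        rcases hz with rfl | hz
        · exact hx.2
        · intro hzf; exact h3 z hz (by simp [hzf])
    refine le_trans ?_ (Finset.card_le_card hsub)
    rw [Finset.card_biUnion]
    · calc (D - (f.length + (n + 1))) ^ (n + 1)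
          = (D - (f.length + (n + 1))) * (D - (f.length + (n + 1))) ^ n := by rw [pow_succ]; ring
        _ ≤ ((nxt Γ grp u w) \ f.toFinset).card * (D - (f.length + (n + 1))) ^ n := by
            apply Nat.mul_le_mul_right
            have h1 := hl u w hadj
            have h2 := List.toFinset_card_le f
            have h3 := Finset.le_card_sdiff f.toFinset (nxt Γ grp u w)
            omega
        _ = ∑ x ∈ (nxt Γ grp u w) \ f.toFinset, (D - (f.length + (n + 1))) ^ n := by simp
        _ ≤ _ := by
            apply Finset.sum_le_sum
            intro x hx
            rw [Finset.mem_sdiff, nxt, Finset.mem_filter, mem_nb] at hx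
            rw [Finset.card_image_of_injective _ (List.cons_injective)]
            have := ih w x (x :: f) hx.1.1.symm
            simp only [List.length_cons] at this
            have e : f.length + 1 + n = f.length + (n + 1) := by ring
            rw [e] at this
            exact this
    · intro x _ y _ hxy
      rw [Function.onFun, Finset.disjoint_left]
      intro l h1 h2
      obtain ⟨a, _, rfl⟩ := Finset.mem_image.1 h1
      obtain ⟨b, _, hb⟩ := Finset.mem_image.1 h2
      simp at hb
      exact hxy hb.1.symm

end walks
end P5

namespace P5
open scoped Classical
set_option linter.unusedSectionVars false
section wrap
variable {α K : Type} [Fintype K]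

lemma thin_fin (C : Finset α) (P : K → α → Prop) (d : ℕ)
    (hd : ∀ i ∈ C, (Finset.univ.filter (fun c => P c i)).card ≤ d) (s : ℕ) :
    ∃ J ⊆ C, ∀ c, |((J.filter (P c)).card : ℝ) - ((C.filter (P c)).card : ℝ) / 2 ^ s| ≤ 2 * d := by
  obtain ⟨J, hJ⟩ := thin (I := {x // x ∈ C}) (K := K)
    (fun c => Finset.univ.filter (fun i => P c i.1)) d
    (by intro i; simpa using hd i.1 i.2) s
  refine ⟨J.map (Function.Embedding.subtype _), ?_, fun c => ?_⟩
  · intro x hx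
    simp only [Finset.mem_map, Function.Embedding.coe_subtype] at hx
    obtain ⟨a, _, rfl⟩ := hx
    exact a.2
  · have h1 : ((J.map (Function.Embedding.subtype _)).filter (P c)).card =
        ((Finset.univ.filter (fun i : {x // x ∈ C} => P c i.1)) ∩ J).card := by
      rw [Finset.filter_map, Finset.card_map]
      congr 1
      ext i
      refine Finset.mem_filter.trans ?_
      simp [and_comm]
    have h2 : (C.filter (P c)).card = (Finset.univ.filter (fun i : {x // x ∈ C} => P c i.1)).card := by
      rw [← Finset.card_map (Function.Embedding.subtype _)]
      congr 1
      ext i; simp [and_comm]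
    rw [h1, h2]
    convert hJ c using 4

lemma conflict_fin (C : Finset α) (P : K → α → Prop) (d : ℕ)
    (hd : ∀ i ∈ C, (Finset.univ.filter (fun c => P c i)).card ≤ d)
    (conf : α → α → Prop) (hs : ∀ a b, conf a b → conf b a) (Δ : ℕ)
    (hΔ : ∀ i ∈ C, (C.filter (fun j => conf i j)).card ≤ Δ) :
    ∃ J ⊆ C, (∀ a ∈ J, ∀ b ∈ J, a ≠ b → ¬ conf a b) ∧
      ∀ c, ((C.filter (P c)).card : ℝ) / 2 ^ (4 * Δ + 1) - 4 * d ≤ (J.filter (P c)).card := by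
  obtain ⟨J, -, hJ2, hJ⟩ := conflict_res (I := {x // x ∈ C}) (K := K)
    (fun c => Finset.univ.filter (fun i => P c i.1)) d
    (by intro i; simpa using hd i.1 i.2) Finset.univ (fun a b => conf a.1 b.1)
    (fun a b h => hs _ _ h) Δ (by
      intro i _
      refine le_trans (le_of_eq ?_) (hΔ i.1 i.2)
      rw [← Finset.card_map (Function.Embedding.subtype _)]
      congr 1
      ext i; simp [and_comm])
  refine ⟨J.map (Function.Embedding.subtype _), ?_, ?_, fun c => ?_⟩
  · intro x hx
    simp only [Finset.mem_map, Function.Embedding.coe_subtype] at hx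
    obtain ⟨a, _, rfl⟩ := hx
    exact a.2
  · intro a ha b hb hab
    simp only [Finset.mem_map, Function.Embedding.coe_subtype] at ha hb
    obtain ⟨a, ha, rfl⟩ := ha
    obtain ⟨b, hb, rfl⟩ := hb
    exact hJ2 a ha b hb (fun h => hab (by rw [h]))
  · have h1 : ((J.map (Function.Embedding.subtype _)).filter (P c)).card =
        ((Finset.univ.filter (fun i : {x // x ∈ C} => P c i.1)) ∩ J).card := by
      rw [Finset.filter_map, Finset.card_map]
      congr 1
      ext i
      refine Finset.mem_filter.trans ?_
      simp [and_comm]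
    have h2 : (C.filter (P c)).card =
        ((Finset.univ.filter (fun i : {x // x ∈ C} => P c i.1)) ∩ Finset.univ).card := by
      rw [← Finset.card_map (Function.Embedding.subtype _)]
      congr 1
      ext i; simp [and_comm]
    rw [h1, h2]
    convert hJ c using 4

end wrap

def isHead {V : Type} (v : V) (p : List V) : Prop := p.head? = some v

def isEnd {V : Type} (v : V) (p : List V) : Prop := p.head? = some v ∨ p.getLast? = some v

section cands
variable {V : Type} [Fintype V] (Γ : SimpleGraph V) (grp : V → V → ℕ) (n : ℕ)

noncomputable def cand : Finset (List V) :=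
  ((Finset.univ : Finset V).biUnion (fun u => (nb Γ u).biUnion (fun w =>
    (ext Γ grp n u w).image (fun l => u :: w :: l)))).filter (fun l => l.Nodup)

lemma mem_cand (p : List V) : p ∈ cand Γ grp n ↔ p.Nodup ∧ p.length = n + 2 ∧ Wk Γ grp p := by
  simp only [cand, Finset.mem_filter, Finset.mem_biUnion, Finset.mem_univ, true_and, Finset.mem_image,
    mem_nb]
  constructor
  · rintro ⟨⟨u, w, huw, l, hl, rfl⟩, hn⟩
    rw [mem_ext Γ grp n u w l huw] at hl
    exact ⟨hn, by simp [hl.1], hl.2⟩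
  · rintro ⟨hn, hl, hw⟩
    match p, hl with
    | u :: w :: l, hl =>
      have huw : Γ.Adj u w := hw.1 u w ⟨[], l, by simp⟩
      exact ⟨⟨u, w, huw, l, (mem_ext Γ grp n u w l huw).2 ⟨by simpa using hl, hw⟩, rfl⟩, hn⟩

lemma cand_rev {p : List V} (h : p ∈ cand Γ grp n) : p.reverse ∈ cand Γ grp n := by
  rw [mem_cand] at h ⊢
  exact ⟨List.nodup_reverse.2 h.1, by simp [h.2.1], h.2.2.rev Γ grp⟩

variable (D : ℕ)

lemma cand_starts (hl : ∀ u w, Γ.Adj w u → D ≤ (nxt Γ grp u w).card) (v : V) :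
    (nb Γ v).card * (D - (n + 2)) ^ n ≤ ((cand Γ grp n).filter (fun p => isHead v p)).card := by
  have hsub : (nb Γ v).biUnion (fun w => ((ext Γ grp n v w).filter
      (fun l => l.Nodup ∧ ∀ x ∈ l, x ∉ [v, w])).image (fun l => v :: w :: l)) ⊆
      (cand Γ grp n).filter (fun p => isHead v p) := by
    intro p hp
    simp only [Finset.mem_biUnion, Finset.mem_image, Finset.mem_filter, mem_nb] at hp
    obtain ⟨w, hw, l, ⟨hl1, hl2, hl3⟩, rfl⟩ := hp
    rw [Finset.mem_filter, mem_cand]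
    rw [mem_ext Γ grp n v w l hw] at hl1
    refine ⟨⟨?_, by simp [hl1.1], hl1.2⟩, by simp [isHead]⟩
    simp only [List.nodup_cons, List.mem_cons, not_or]
    refine ⟨⟨hw.ne, fun h => hl3 v h (by simp)⟩, fun h => hl3 w h (by simp), hl2⟩
  refine le_trans ?_ (Finset.card_le_card hsub)
  rw [Finset.card_biUnion]
  · rw [← smul_eq_mul]
    apply Finset.card_nsmul_le_sum
    intro w hw
    rw [Finset.card_image_of_injective _ (by intro a b h; simpa using h)]
    have := ext_lower Γ grp D hl n v w [v, w] ((mem_nb Γ).1 hw).symm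
    refine le_trans (Nat.pow_le_pow_left ?_ n) this
    simp; omega
  · intro a _ b _ hab
    simp only [Function.onFun]
    rw [Finset.disjoint_left]
    intro p hp hp'
    simp only [Finset.mem_image] at hp hp'
    obtain ⟨l, _, rfl⟩ := hp
    obtain ⟨l', _, h⟩ := hp'
    simp at h
    exact hab h.1.symm

lemma ed_split {p : List V} {e : Sym2 V} (h : e ∈ ed p) :
    ∃ l x y r, p = l ++ x :: y :: r ∧ e = s(x, y) := by
  induction p with
  | nil => simp at h
  | cons a p ih =>
    cases p with
    | nil => simp at h
    | cons b p =>
      rw [ed_cons_cons, Finset.mem_insert] at h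
      rcases h with h | h
      · exact ⟨[], a, b, p, by simp, h⟩
      · obtain ⟨l, x, y, r, h1, h2⟩ := ih h
        exact ⟨a :: l, x, y, r, by simp [h1], h2⟩

lemma Wk_ed {p : List V} (h : Wk Γ grp p) : ↑(ed p) ⊆ Γ.edgeSet := by
  intro e he
  obtain ⟨l, x, y, r, rfl, rfl⟩ := ed_split he
  rw [SimpleGraph.mem_edgeSet]
  exact h.1 x y ⟨l, r, by simp⟩

lemma cand_edge (hu : ∀ u w, (nxt Γ grp u w).card ≤ 2 * D) (e : Sym2 V) :
    ((cand Γ grp n).filter (fun p => e ∈ ed p)).card ≤ 2 * (n + 1) * (2 * D) ^ n := by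
  induction e with
  | _ a b =>
  have hsub : (cand Γ grp n).filter (fun p => s(a, b) ∈ ed p) ⊆
      ((Finset.range (n + 1)) ×ˢ ({(a, b), (b, a)} : Finset (V × V))).biUnion (fun jxy =>
        ((ext Γ grp jxy.1 jxy.2.2 jxy.2.1) ×ˢ (ext Γ grp (n - jxy.1) jxy.2.1 jxy.2.2)).image
          (fun lr => lr.1.reverse ++ jxy.2.1 :: jxy.2.2 :: lr.2)) := by
    intro p hp
    rw [Finset.mem_filter, mem_cand] at hp
    obtain ⟨⟨h1, h2, h3⟩, h4⟩ := hp
    obtain ⟨l, x, y, r, rfl, hxy⟩ := ed_split h4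
    have hadj : Γ.Adj x y := h3.1 x y ⟨l, r, by simp⟩
    rw [Finset.mem_biUnion]
    simp only [List.length_append, List.length_cons] at h2
    refine ⟨(l.length, (x, y)), ?_, ?_⟩
    · simp only [Finset.mem_product, Finset.mem_range, Finset.mem_insert, Finset.mem_singleton,
        Prod.mk.injEq]
      refine ⟨by omega, ?_⟩
      rw [Sym2.eq_iff] at hxy
      tauto
    · rw [Finset.mem_image]
      refine ⟨(l.reverse, r), ?_, by simp⟩
      rw [Finset.mem_product]
      constructor
      · simp only
        rw [mem_ext Γ grp _ y x _ hadj.symm]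
        refine ⟨by simp, ?_⟩
        have : Wk Γ grp (l ++ [x, y]) := h3.infix Γ grp ⟨[], r, by simp⟩
        simpa using this.rev Γ grp
      · simp only
        rw [mem_ext Γ grp _ x y _ hadj]
        refine ⟨by omega, h3.infix Γ grp ⟨l, [], by simp⟩⟩
  refine (Finset.card_le_card hsub).trans (Finset.card_biUnion_le.trans ?_)
  have : ∀ jxy ∈ ((Finset.range (n + 1)) ×ˢ ({(a, b), (b, a)} : Finset (V × V))),
      (((ext Γ grp jxy.1 jxy.2.2 jxy.2.1) ×ˢ (ext Γ grp (n - jxy.1) jxy.2.1 jxy.2.2)).image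
          (fun lr => lr.1.reverse ++ jxy.2.1 :: jxy.2.2 :: lr.2)).card ≤ (2 * D) ^ n := by
    intro jxy hj
    simp only [Finset.mem_product, Finset.mem_range] at hj
    refine Finset.card_image_le.trans ?_
    rw [Finset.card_product]
    calc _ ≤ (2 * D) ^ jxy.1 * (2 * D) ^ (n - jxy.1) :=
          Nat.mul_le_mul (ext_card_le Γ grp D hu _ _ _) (ext_card_le Γ grp D hu _ _ _)
      _ = _ := by rw [← pow_add]; congr 1; omega
  refine (Finset.sum_le_card_nsmul _ _ _ this).trans ?_
  rw [smul_eq_mul, Finset.card_product, Finset.card_range]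
  have : ({(a, b), (b, a)} : Finset (V × V)).card ≤ 2 := Finset.card_le_two
  calc _ ≤ (n + 1) * 2 * (2 * D) ^ n := by gcongr
    _ = _ := by ring

lemma cand_pair_head (hD : 0 < D) (hu : ∀ u w, (nxt Γ grp u w).card ≤ 2 * D) (v x : V) (hxv : x ≠ v) (g : ℕ)
    (hg1 : 1 ≤ g) (hg : (nb Γ v).card ≤ 2 * D * g) :
    ((cand Γ grp n).filter (fun p => isHead v p ∧ x ∈ p)).card ≤ (n + 1) * g * (2 * D) ^ n := by
  have hsub : (cand Γ grp n).filter (fun p => isHead v p ∧ x ∈ p) ⊆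
      (ext Γ grp n v x).image (fun l => v :: x :: l) ∪
      (nb Γ v).biUnion (fun w => ((ext Γ grp n v w).filter (fun l => x ∈ l)).image (fun l => v :: w :: l)) := by
    intro p hp
    rw [Finset.mem_filter, mem_cand] at hp
    obtain ⟨⟨h1, h2, h3⟩, h4, h5⟩ := hp
    match p, h2, h4 with
    | u :: w :: l, h2, h4 =>
      simp [isHead] at h4
      subst h4
      have huw : Γ.Adj u w := h3.1 u w ⟨[], l, by simp⟩
      have hm := (mem_ext Γ grp n u w l huw).2 ⟨by simpa using h2, h3⟩
      simp only [List.mem_cons, hxv, false_or] at h5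
      rw [Finset.mem_union]
      rcases h5 with rfl | h5
      · left; exact Finset.mem_image_of_mem _ hm
      · right
        rw [Finset.mem_biUnion]
        refine ⟨w, (mem_nb Γ).2 huw, Finset.mem_image_of_mem (fun l => u :: w :: l) ?_⟩
        simp [hm, h5]
  have h1 : ((cand Γ grp n).filter (fun p => isHead v p ∧ x ∈ p)).card ≤
      (2 * D) ^ n + ∑ w ∈ nb Γ v, ((ext Γ grp n v w).filter (fun l => x ∈ l)).card := by
    refine (Finset.card_le_card hsub).trans ((Finset.card_union_le _ _).trans ?_)
    refine Nat.add_le_add (Finset.card_image_le.trans (ext_card_le Γ grp D hu _ _ _)) ?_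
    refine Finset.card_biUnion_le.trans (Finset.sum_le_sum fun w _ => Finset.card_image_le)
  have h2 : 2 * D * ∑ w ∈ nb Γ v, ((ext Γ grp n v w).filter (fun l => x ∈ l)).card ≤
      2 * D * g * (n * (2 * D) ^ n) := by
    rw [Finset.mul_sum]
    refine (Finset.sum_le_card_nsmul _ _ (n * (2 * D) ^ n) fun w _ => ext_through_le Γ grp D hu x n v w).trans ?_
    rw [smul_eq_mul]
    exact Nat.mul_le_mul_right _ hg
  have h3 : ∑ w ∈ nb Γ v, ((ext Γ grp n v w).filter (fun l => x ∈ l)).card ≤ g * (n * (2 * D) ^ n) := by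
    rw [mul_assoc (2 * D) g] at h2
    exact Nat.le_of_mul_le_mul_left h2 (by omega)
  calc _ ≤ 1 * (2 * D) ^ n + g * (n * (2 * D) ^ n) := by omega
    _ ≤ g * (2 * D) ^ n + g * (n * (2 * D) ^ n) := by gcongr
    _ = _ := by ring

lemma cand_pair (hD : 0 < D) (hu : ∀ u w, (nxt Γ grp u w).card ≤ 2 * D) (v x : V) (hxv : x ≠ v) (g : ℕ)
    (hg1 : 1 ≤ g) (hg : (nb Γ v).card ≤ 2 * D * g) :
    ((cand Γ grp n).filter (fun p => isEnd v p ∧ x ∈ p)).card ≤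
      2 * (n + 1) * g * (2 * D) ^ n := by
  have h := cand_pair_head Γ grp n D hD hu v x hxv g hg1 hg
  have hsub : (cand Γ grp n).filter (fun p => isEnd v p ∧ x ∈ p) ⊆
      (cand Γ grp n).filter (fun p => isHead v p ∧ x ∈ p) ∪
      ((cand Γ grp n).filter (fun p => isHead v p ∧ x ∈ p)).image List.reverse := by
    intro p hp
    rw [Finset.mem_filter] at hp
    obtain ⟨h1, h2 | h2, h3⟩ := hp
    · exact Finset.mem_union_left _ (Finset.mem_filter.2 ⟨h1, h2, h3⟩)
    · refine Finset.mem_union_right _ ?_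
      rw [Finset.mem_image]
      refine ⟨p.reverse, ?_, by simp⟩
      rw [Finset.mem_filter]
      exact ⟨cand_rev Γ grp n h1, by simpa [isHead] using h2, by simpa using h3⟩
  calc _ ≤ _ := (Finset.card_le_card hsub).trans (Finset.card_union_le _ _)
    _ ≤ (n + 1) * g * (2 * D) ^ n + (n + 1) * g * (2 * D) ^ n :=
      Nat.add_le_add h (Finset.card_image_le.trans h)
    _ = _ := by ring

end cands
end P5

namespace P5
open scoped Classical
set_option linter.unusedSectionVars false
lemma exists_grp {V : Type} [Fintype V] (Γ : SimpleGraph V) (D : ℕ) (hD : 0 < D)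
    (h : ∀ v, D ≤ (nb Γ v).card) :
    ∃ grp : V → V → ℕ, (∀ u w, (nxt Γ grp u w).card ≤ 2 * D) ∧
      (∀ u w, Γ.Adj w u → D ≤ (nxt Γ grp u w).card) := by
  choose f hf using fun v => exists_groups D hD _ (nb Γ v) rfl (h v)
  refine ⟨f, fun u w => ?_, fun u w huw => (hf w u ((mem_nb Γ).2 huw)).1⟩
  by_cases hne : (nxt Γ f u w).Nonempty
  · obtain ⟨y, hy⟩ := hne
    rw [nxt, Finset.mem_filter] at hy
    rw [nxt, ← hy.2]
    exact (hf w y hy.1).2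
  · rw [Finset.not_nonempty_iff_eq_empty.1 hne]; simp

theorem lemmaH (n : ℕ) : ∃ c1 : ℕ, ∀ m : ℕ, ∃ D : ℕ, 0 < D ∧ ∀ (V : Type) [Fintype V] (Γ : SimpleGraph V),
    (∀ v, D ≤ (nb Γ v).card) → ∃ g : V → ℕ, (∀ v, 1 ≤ g v ∧ (nb Γ v).card ≤ 2 * D * g v) ∧
    ∃ F : Finset (List V), (∀ p ∈ F, p.Nodup ∧ p.length = n + 2 ∧ ↑(ed p) ⊆ Γ.edgeSet) ∧
      (∀ p ∈ F, ∀ q ∈ F, p ≠ q → Disjoint (ed p) (ed q)) ∧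
      (∀ v, m * g v ≤ (F.filter (fun p => isHead v p)).card) ∧
      (∀ v x, x ≠ v → (F.filter (fun p => isEnd v p ∧ x ∈ p)).card ≤ c1 * g v) := by
  obtain ⟨d, hd⟩ : ∃ d, d = 3 * n + 6 := ⟨_, rfl⟩
  obtain ⟨c1, hc1⟩ : ∃ c1, c1 = 2 * (n + 1) + 2 * d := ⟨_, rfl⟩
  refine ⟨c1, fun m => ?_⟩
  obtain ⟨Δ, hΔ⟩ : ∃ Δ, Δ = (n + 1) * c1 := ⟨_, rfl⟩
  obtain ⟨a, ha⟩ : ∃ a, a = 4 ^ n * (2 * d + 2 ^ (4 * Δ + 1) * (m + 4)) + 2 * (n + 2) := ⟨_, rfl⟩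
  refine ⟨2 ^ a, by positivity, ?_⟩
  obtain ⟨D, hD⟩ : ∃ D, D = 2 ^ a := ⟨_, rfl⟩
  rw [← hD]
  have hDa : a < D := hD ▸ Nat.lt_two_pow_self
  have hD0 : 0 < D := by omega
  intro V _ Γ hdeg
  obtain ⟨grp, hu, hl⟩ := exists_grp Γ D hD0 hdeg
  have hg1 : ∀ v, 1 ≤ (nb Γ v).card / D := fun v => (Nat.one_le_div_iff hD0).2 (hdeg v)
  obtain ⟨g, hg⟩ : ∃ g : V → ℕ, ∀ v, g v = (nb Γ v).card / D := ⟨_, fun _ => rfl⟩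
  simp only [← hg] at hg1
  have hgl : ∀ v, g v * D ≤ (nb Γ v).card := fun v => by rw [hg]; exact Nat.div_mul_le_self _ _
  have hgu : ∀ v, (nb Γ v).card ≤ 2 * D * g v := fun v => by
    have := Nat.lt_div_mul_add (a := (nb Γ v).card) hD0
    rw [← hg] at this
    have h1 := hg1 v
    nlinarith
  refine ⟨g, fun v => ⟨hg1 v, hgu v⟩, ?_⟩
  obtain ⟨C, hC⟩ : ∃ C, C = cand Γ grp n := ⟨_, rfl⟩
  have hCm : ∀ p, p ∈ C ↔ p.Nodup ∧ p.length = n + 2 ∧ Wk Γ grp p := fun p => by rw [hC, mem_cand]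
  obtain ⟨P, hP⟩ : ∃ P : Sym2 V ⊕ ((V × V) ⊕ V) → List V → Prop,
    P = Sum.elim (fun e p => e ∈ ed p) (Sum.elim (fun vx p => isEnd vx.1 p ∧ vx.2 ∈ p)
      (fun v p => isHead v p)) := ⟨_, rfl⟩
  have hP1 : ∀ e, P (Sum.inl e) = fun p => e ∈ ed p := fun e => by rw [hP]; rfl
  have hP2 : ∀ v x, P (Sum.inr (Sum.inl (v, x))) = fun p => isEnd v p ∧ x ∈ p := fun v x => by rw [hP]; rfl
  have hP3 : ∀ v, P (Sum.inr (Sum.inr v)) = fun p => isHead v p := fun v => by rw [hP]; rfl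
  obtain ⟨J, hJC, hJ⟩ := thin_fin C P d (by
    intro p hp
    obtain ⟨h1, h2, _⟩ := (hCm p).1 hp
    have hne : p ≠ [] := by rintro rfl; simp at h2
    have hsub : Finset.univ.filter (fun c => P c p) ⊆ (ed p).disjSum
        ((({p.head hne, p.getLast hne} : Finset V) ×ˢ p.toFinset).disjSum {p.head hne}) := by
      intro c hc
      rw [Finset.mem_filter] at hc
      rcases c with e | ⟨v, x⟩ | v
      · rw [hP1] at hc; simpa using hc.2
      · rw [hP2] at hc
        have := hc.2
        simp only [isEnd, List.head?_eq_some_head hne, List.getLast?_eq_some_getLast hne, Option.some.injEq] at this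
        simp [this.2]
        tauto
      · rw [hP3] at hc
        have := hc.2
        simp only [isHead, List.head?_eq_some_head hne, Option.some.injEq] at this
        simp [this]
    refine (Finset.card_le_card hsub).trans ?_
    rw [Finset.card_disjSum, Finset.card_disjSum, Finset.card_product, ed_card h1, List.toFinset_card_of_nodup h1,
      h2, Finset.card_singleton]
    have : ({p.head hne, p.getLast hne} : Finset V).card ≤ 2 := Finset.card_le_two
    rw [hd]
    have := Nat.mul_le_mul_right (n + 2) this
    omega) ((a + 1) * n)
  have hpow : (2 : ℝ) ^ ((a + 1) * n) = (2 * D : ℝ) ^ n := by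
    rw [pow_mul, pow_succ, hD]; push_cast; ring
  rw [hpow] at hJ
  have hDp : (0 : ℝ) < (2 * D : ℝ) ^ n := by positivity
  -- edges
  have hJ1 : ∀ e, (J.filter (fun p => e ∈ ed p)).card ≤ c1 := by
    intro e
    have h := (abs_le.1 (hJ (Sum.inl e))).2
    simp only [hP1] at h
    have h2 : ((C.filter (fun p => e ∈ ed p)).card : ℝ) ≤ 2 * (n + 1) * (2 * D) ^ n := by
      rw [hC]; exact_mod_cast cand_edge Γ grp n D hu e
    have h3 := (div_le_iff₀ hDp).2 h2
    have : ((J.filter (fun p => e ∈ ed p)).card : ℝ) ≤ c1 := by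
      rw [hc1]; push_cast; linarith
    exact_mod_cast this
  have hJ2 : ∀ v x, x ≠ v → (J.filter (fun p => isEnd v p ∧ x ∈ p)).card ≤ c1 * g v := by
    intro v x hxv
    have h := (abs_le.1 (hJ (Sum.inr (Sum.inl (v, x))))).2
    simp only [hP2] at h
    have h2 : ((C.filter (fun p => isEnd v p ∧ x ∈ p)).card : ℝ) ≤ 2 * (n + 1) * g v * (2 * D) ^ n := by
      rw [hC]
      have := cand_pair Γ grp n D hD0 hu v x hxv (g v) (hg1 v) (hgu v)
      have h3 : ((cand Γ grp n).filter (fun p => isEnd v p ∧ x ∈ p)).card ≤ 2 * (n + 1) * g v * (2 * D) ^ n := by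
        exact this
      exact_mod_cast h3
    have h3 := (div_le_iff₀ hDp).2 h2
    have h4 : (1 : ℝ) ≤ g v := by exact_mod_cast hg1 v
    have h5 : (0 : ℝ) ≤ d := by positivity
    have : ((J.filter (fun p => isEnd v p ∧ x ∈ p)).card : ℝ) ≤ c1 * g v := by
      rw [hc1]; push_cast; nlinarith
    exact_mod_cast this
  have hJ3 : ∀ v, (g v : ℝ) * (D / 4 ^ n) - 2 * d ≤ (J.filter (fun p => isHead v p)).card := by
    intro v
    have h := (abs_le.1 (hJ (Sum.inr (Sum.inr v)))).1
    simp only [hP3] at h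
    have h2 : (((nb Γ v).card * (D - (n + 2)) ^ n : ℕ) : ℝ) ≤ ((C.filter (fun p => isHead v p)).card : ℝ) := by
      rw [hC]
      have := cand_starts Γ grp n D hl v
      have h3 : (nb Γ v).card * (D - (n + 2)) ^ n ≤ ((cand Γ grp n).filter (fun p => isHead v p)).card := by
        exact this
      exact_mod_cast h3
    have h3 : (g v : ℝ) * (D / 4 ^ n) * (2 * D) ^ n ≤ (((nb Γ v).card * (D - (n + 2)) ^ n : ℕ) : ℝ) := by
      have e1 : (g v : ℝ) * (D / 4 ^ n) * (2 * D) ^ n = (g v * D) * (D / 2) ^ n := by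
        have : (4 : ℝ) ^ n = 2 ^ n * 2 ^ n := by rw [← mul_pow]; norm_num
        rw [div_pow, mul_pow, this]; field_simp
      rw [e1]; push_cast
      have e2 : (D : ℝ) / 2 ≤ ((D - (n + 2) : ℕ) : ℝ) := by
        have : D ≤ 2 * (D - (n + 2)) := by omega
        have : (D : ℝ) ≤ 2 * ((D - (n + 2) : ℕ) : ℝ) := by exact_mod_cast this
        linarith
      have e3 : ((g v : ℝ) * D) ≤ (nb Γ v).card := by exact_mod_cast hgl v
      gcongr
    have h4 := (le_div_iff₀ hDp).2 (h3.trans h2)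
    linarith
  obtain ⟨conf, hconf⟩ : ∃ conf : List V → List V → Prop, ∀ p q, conf p q ↔ ¬ Disjoint (ed p) (ed q) := ⟨_, fun _ _ => Iff.rfl⟩
  obtain ⟨F, hFJ, hF1, hF2⟩ := conflict_fin J (fun (v : V) p => isHead v p) 1 (by
    intro p _
    rw [Finset.card_le_one]
    intro a ha b hb
    simp only [Finset.mem_filter, Finset.mem_univ, true_and] at ha hb
    rw [isHead] at ha hb; rw [ha] at hb; simpa using hb) conf
    (fun p q h => by rw [hconf] at h ⊢; exact fun h' => h h'.symm) Δ (by
    intro p hp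
    have hsub : J.filter (fun q => conf p q) ⊆
        (ed p).biUnion (fun e => J.filter (fun q => e ∈ ed q)) := by
      intro q hq
      rw [Finset.mem_filter, hconf, Finset.not_disjoint_iff] at hq
      obtain ⟨hq, e, h1, h2⟩ := hq
      simp only [Finset.mem_biUnion, Finset.mem_filter]
      exact ⟨e, h1, hq, h2⟩
    refine (Finset.card_le_card hsub).trans (Finset.card_biUnion_le.trans ?_)
    refine (Finset.sum_le_card_nsmul _ _ c1 fun e _ => hJ1 e).trans ?_
    obtain ⟨h1, h2, _⟩ := (hCm p).1 (hJC hp)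
    rw [ed_card h1, h2, hΔ, smul_eq_mul]
    simp)
  refine ⟨F, ?_, ?_, ?_, ?_⟩
  · intro p hp
    obtain ⟨h1, h2, h3⟩ := (hCm p).1 (hJC (hFJ hp))
    exact ⟨h1, h2, Wk_ed Γ grp h3⟩
  · intro p hp q hq hpq
    simpa [hconf] using hF1 p hp q hq hpq
  · intro v
    have h1 := hF2 v
    have h2 := hJ3 v
    have h3 : (1 : ℝ) ≤ g v := by exact_mod_cast hg1 v
    have h4 : (2 * d + 2 ^ (4 * Δ + 1) * (m + 4) : ℝ) ≤ D / 4 ^ n := by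
      rw [le_div_iff₀ (by positivity)]
      have : 4 ^ n * (2 * d + 2 ^ (4 * Δ + 1) * (m + 4)) ≤ D := by omega
      have : (4 : ℝ) ^ n * (2 * d + 2 ^ (4 * Δ + 1) * (m + 4)) ≤ D := by exact_mod_cast this
      linarith
    have hp : (0 : ℝ) < 2 ^ (4 * Δ + 1) := by positivity
    have h5 : (2 ^ (4 * Δ + 1) * (m * g v + 4) : ℝ) ≤ (J.filter (fun p => isHead v p)).card := by
      have h6 : (0 : ℝ) ≤ d := by positivity
      have h7 : (g v : ℝ) * (2 * d + 2 ^ (4 * Δ + 1) * (m + 4)) ≤ g v * (D / 4 ^ n) := by gcongr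
      have h8 : 0 ≤ ((g v : ℝ) - 1) * d := mul_nonneg (by linarith) h6
      have h9 : 0 ≤ ((g v : ℝ) - 1) * (2 : ℝ) ^ (4 * Δ + 1) := mul_nonneg (by linarith) hp.le
      nlinarith
    rw [mul_comm] at h5
    have h6 := (le_div_iff₀ hp).2 h5
    have : (m * g v : ℝ) ≤ (F.filter (fun p => isHead v p)).card := by
      push_cast at h1; linarith
    exact_mod_cast this
  · intro v x hxv
    refine le_trans (Finset.card_le_card ?_) (hJ2 v x hxv)
    exact Finset.filter_subset_filter _ hFJ
end P5

namespace P5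
open scoped Classical
set_option linter.unusedSectionVars false
section cuts
variable {V : Type}

/-- the edge `e` crosses the cut given by `X` -/
def cx (X : Set V) (e : Sym2 V) : Prop := ∃ a b, e = s(a, b) ∧ a ∈ X ∧ b ∉ X

lemma cx_mk (X : Set V) (a b : V) : cx X s(a, b) ↔ ((a ∈ X ∧ b ∉ X) ∨ (a ∉ X ∧ b ∈ X)) := by
  constructor
  · rintro ⟨c, d, h, h1, h2⟩
    rw [Sym2.eq_iff] at h
    rcases h with ⟨rfl, rfl⟩ | ⟨rfl, rfl⟩ <;> tauto
  · rintro (⟨h1, h2⟩ | ⟨h1, h2⟩)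
    · exact ⟨a, b, rfl, h1, h2⟩
    · exact ⟨b, a, Sym2.eq_swap, h2, h1⟩

noncomputable def sd (e : Sym2 V) : V := (Quot.out e).1
noncomputable def td (e : Sym2 V) : V := (Quot.out e).2

lemma sd_td (e : Sym2 V) : s(sd e, td e) = e := by
  simp only [sd, td]; exact Quot.out_eq e

lemma Cr_iff (X : Set V) (e : Sym2 V) : Cr sd td X e ↔ cx X e := by
  conv_rhs => rw [← sd_td e]
  rw [cx_mk, Cr]

lemma cx_symmDiff (X Y : Set V) (e : Sym2 V) : cx (symmDiff X Y) e ↔ ((cx X e ∧ ¬ cx Y e) ∨ (¬ cx X e ∧ cx Y e)) := by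
  induction e with
  | _ a b =>
    rw [cx_mk, cx_mk, cx_mk, Set.mem_symmDiff, Set.mem_symmDiff]
    tauto

variable [Fintype V]

lemma maxcut (E : Finset (Sym2 V)) (K : ℕ)
    (h : ∀ X : Set V, X.Nonempty → Xᶜ.Nonempty → K ≤ (E.filter (fun e => cx X e)).card) :
    ∃ κ : Set V, ∀ X : Set V, X.Nonempty → Xᶜ.Nonempty →
      K ≤ 2 * ((E.filter (fun e => cx κ e)).filter (fun e => cx X e)).card := by
  obtain ⟨κ, hκ⟩ := Finite.exists_max (fun κ : Set V => (E.filter (fun e => cx κ e)).card)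
  refine ⟨κ, fun X h1 h2 => ?_⟩
  have h3 := hκ (symmDiff κ X)
  have h4 := h X h1 h2
  have e1 : (E.filter (fun e => cx (symmDiff κ X) e)).card =
      (E.filter (fun e => cx κ e ∧ ¬ cx X e)).card + (E.filter (fun e => ¬ cx κ e ∧ cx X e)).card := by
    rw [← Finset.card_union_of_disjoint, ← Finset.filter_or]
    · congr 1; ext e; simp only [Finset.mem_filter, cx_symmDiff]
    · rw [Finset.disjoint_filter]; tauto
  have e2 : (E.filter (fun e => cx κ e)).card =
      (E.filter (fun e => cx κ e ∧ ¬ cx X e)).card + (E.filter (fun e => cx κ e ∧ cx X e)).card := by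
    rw [← Finset.card_union_of_disjoint, ← Finset.filter_or]
    · congr 1; ext e; simp only [Finset.mem_filter]; tauto
    · rw [Finset.disjoint_filter]; tauto
  have e3 : (E.filter (fun e => cx X e)).card =
      (E.filter (fun e => ¬ cx κ e ∧ cx X e)).card + (E.filter (fun e => cx κ e ∧ cx X e)).card := by
    rw [← Finset.card_union_of_disjoint, ← Finset.filter_or]
    · congr 1; ext e; simp only [Finset.mem_filter]; tauto
    · rw [Finset.disjoint_filter]; tauto
  rw [Finset.filter_filter]
  omega

/-- edges of a graph as a finset -/
noncomputable def gE (G : SimpleGraph V) : Finset (Sym2 V) := Finset.univ.filter (fun e => e ∈ G.edgeSet)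

lemma mem_gE (G : SimpleGraph V) (e : Sym2 V) : e ∈ gE G ↔ e ∈ G.edgeSet := by simp [gE]

lemma cuts_of_conn (G : SimpleGraph V) (K : ℕ)
    (h : ∀ S : Finset (Sym2 V), S.card < K → (G.deleteEdges ↑S).Connected) (X : Set V)
    (h1 : X.Nonempty) (h2 : Xᶜ.Nonempty) : K ≤ ((gE G).filter (fun e => cx X e)).card := by
  by_contra hlt
  push Not at hlt
  have hc := h _ hlt
  obtain ⟨a, ha⟩ := h1
  obtain ⟨b, hb⟩ := h2
  obtain ⟨w⟩ := hc.preconnected a b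
  have : ∀ {a b : V} (w : (G.deleteEdges ↑((gE G).filter (fun e => cx X e))).Walk a b), a ∈ X → b ∈ X := by
    intro a b w
    induction w with
    | nil => exact id
    | cons hadj _ ih =>
      rename_i u v _ _
      intro hu
      apply ih
      by_contra hv
      rw [SimpleGraph.deleteEdges_adj] at hadj
      refine hadj.2 ?_
      simp only [Finset.coe_filter, Set.mem_ofPred_eq, mem_gE, SimpleGraph.mem_edgeSet]
      exact ⟨hadj.1, (cx_mk X u v).2 (Or.inl ⟨hu, hv⟩)⟩
  exact hb (this w ha)

end cuts

section light

lemma chunk {α : Type} (N : Finset α) (q : ℕ) (hq : 0 < q) :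
    ∃ f : α → ℕ, (∀ j, (N.filter (fun x => f x = j)).card ≤ q) ∧ ∀ x ∈ N, f x ≤ N.card / q := by
  let f : α → ℕ := fun x => if h : x ∈ N then (N.equivFin ⟨x, h⟩).1 else 0
  have hf : ∀ x ∈ N, f x < N.card := fun x hx => by simp only [f, hx, dif_pos]; exact Fin.is_lt _
  have hinj : Set.InjOn f N := by
    intro x hx y hy hxy
    have hx' : x ∈ N := hx
    have hy' : y ∈ N := hy
    simp only [f, hx', hy', dif_pos] at hxy
    have := N.equivFin.injective (Fin.ext hxy)
    simpa using this
  refine ⟨fun x => f x / q, fun j => ?_, fun x hx => Nat.div_le_div_right (hf x hx).le⟩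
  have hcard : (Finset.Ico (q * j) (q * j + q)).card = q := by simp
  refine le_trans (Finset.card_le_card_of_injOn (t := Finset.Ico (q * j) (q * j + q)) f ?_ ?_) hcard.le
  · intro x hx
    rw [Finset.mem_coe, Finset.mem_filter] at hx
    rw [Finset.coe_Ico, Set.mem_Ico, ← hx.2]
    constructor
    · exact Nat.mul_div_le _ _
    · have := Nat.lt_mul_div_succ (f x) hq
      rw [mul_add, mul_one] at this
      exact this
  · exact hinj.mono (by intro x hx; simp only [Finset.coe_filter, Set.mem_ofPred_eq] at hx; exact hx.1)

variable {V E : Type} [Fintype V] [Fintype E]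

lemma light_round [DecidableEq E] (s t w : E → V) (E0 : Finset E) (q k : ℕ) (hq : 0 < q)
    (hcut : ∀ X : Set V, X.Nonempty → Xᶜ.Nonempty → 2 * q * k ≤ (E0.filter (fun e => Cr s t X e)).card) :
    ∃ S : Fin k → Finset E, (∀ i, S i ⊆ E0) ∧
      (∀ i X, X.Nonempty → Xᶜ.Nonempty → ∃ e ∈ S i, Cr s t X e) ∧
      (∀ i j, i ≠ j → Disjoint (S i) (S j)) ∧
      ∀ v, ((Finset.univ.biUnion S).filter (fun e => w e = v)).card ≤
        (E0.filter (fun e => w e = v)).card / q + 1 := by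
  choose f hf1 hf2 using fun v => chunk (E0.filter (fun e => w e = v)) q hq
  obtain ⟨S, h1, h2, h3⟩ := lemmaR s t E0 (fun e => (w e, f (w e) e)) q k (by
    rintro ⟨v, j⟩
    refine le_trans (Finset.card_le_card ?_) (hf1 v j)
    intro e he
    simp only [Finset.mem_filter, Prod.mk.injEq] at he ⊢
    obtain ⟨h1, rfl, h2⟩ := he
    exact ⟨⟨h1, rfl⟩, h2⟩) hq hcut
  refine ⟨S, h1, h2, ?_, fun v => ?_⟩
  · intro i j hij
    rw [Finset.disjoint_left]
    intro e he he'
    exact hij (h3 i j e he e he' rfl).1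
  · rw [← Finset.card_range ((E0.filter (fun e => w e = v)).card / q + 1)]
    apply Finset.card_le_card_of_injOn (f v)
    · intro e he
      simp only [Finset.coe_filter, Finset.mem_biUnion, Finset.mem_univ, true_and, Set.mem_ofPred_eq] at he
      obtain ⟨⟨i, hi⟩, rfl⟩ := he
      rw [Finset.mem_coe, Finset.mem_range, Nat.lt_succ_iff]
      exact hf2 (w e) e (by simp [h1 i hi])
    · intro e he e' he' hee
      simp only [Finset.coe_filter, Finset.mem_biUnion, Finset.mem_univ, true_and, Set.mem_ofPred_eq] at he he'
      obtain ⟨⟨i, hi⟩, hv⟩ := he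
      obtain ⟨⟨i', hi'⟩, hv'⟩ := he'
      exact (h3 i i' e hi e' hi' (by simp only [hv, hv', hee])).2

lemma light (E0 : Finset (Sym2 V)) (q k : ℕ) (hq : 0 < q)
    (hcut : ∀ X : Set V, X.Nonempty → Xᶜ.Nonempty → 2 * q * (2 * q * k) ≤ (E0.filter (fun e => cx X e)).card) :
    ∃ T : Fin k → Finset (Sym2 V), (∀ i, T i ⊆ E0) ∧
      (∀ i X, X.Nonempty → Xᶜ.Nonempty → ∃ e ∈ T i, cx X e) ∧
      (∀ i j, i ≠ j → Disjoint (T i) (T j)) ∧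
      ∀ v, ((Finset.univ.biUnion T).filter (fun e => v ∈ e)).card ≤
        2 * ((E0.filter (fun e => v ∈ e)).card / q + 1) := by
  simp only [← Cr_iff] at hcut ⊢
  obtain ⟨S, s1, s2, s3, s4⟩ := light_round sd td sd E0 q (2 * q * k) hq hcut
  obtain ⟨T, t1, t2, t3, t4⟩ := light_round sd td td (Finset.univ.biUnion S) q k hq (by
    intro X h1 h2
    choose e he hc using fun i => s2 i X h1 h2
    have hcard : (Finset.univ : Finset (Fin (2 * q * k))).card = 2 * q * k := by simp
    refine hcard.ge.trans (Finset.card_le_card_of_injOn e ?_ ?_)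
    · intro i _
      simp only [Finset.coe_filter, Finset.mem_biUnion, Finset.mem_univ, true_and, Set.mem_ofPred_eq]
      exact ⟨⟨i, he i⟩, hc i⟩
    · intro i _ j _ hij
      by_contra hne
      exact (Finset.disjoint_left.1 (s3 i j hne)) (he i) (hij ▸ he j))
  have hSE : Finset.univ.biUnion S ⊆ E0 := by
    intro e he
    simp only [Finset.mem_biUnion, Finset.mem_univ, true_and] at he
    obtain ⟨i, hi⟩ := he
    exact s1 i hi
  have hTS : Finset.univ.biUnion T ⊆ Finset.univ.biUnion S := by
    intro e he
    simp only [Finset.mem_biUnion, Finset.mem_univ, true_and] at he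
    obtain ⟨i, hi⟩ := he
    exact t1 i hi
  refine ⟨T, fun i => (t1 i).trans hSE, t2, t3, fun v => ?_⟩
  have hv : ∀ e : Sym2 V, v ∈ e ↔ sd e = v ∨ td e = v := by
    intro e
    conv_lhs => rw [← sd_td e]
    rw [Sym2.mem_iff]; constructor <;> rintro (h | h) <;> simp [h]
  have e1 : ((Finset.univ.biUnion T).filter (fun e => v ∈ e)) ⊆
      ((Finset.univ.biUnion S).filter (fun e => sd e = v)) ∪ ((Finset.univ.biUnion T).filter (fun e => td e = v)) := by
    intro e he
    rw [Finset.mem_filter, hv] at he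
    rw [Finset.mem_union, Finset.mem_filter, Finset.mem_filter]
    rcases he with ⟨h1, h2 | h2⟩
    · exact Or.inl ⟨hTS h1, h2⟩
    · exact Or.inr ⟨h1, h2⟩
  have e2 := (Finset.card_le_card e1).trans (Finset.card_union_le _ _)
  have e3 : (E0.filter (fun e => sd e = v)).card / q ≤ (E0.filter (fun e => v ∈ e)).card / q := by
    apply Nat.div_le_div_right
    apply Finset.card_le_card
    intro e he
    rw [Finset.mem_filter] at he ⊢
    rw [hv]; exact ⟨he.1, Or.inl he.2⟩
  have e4 : ((Finset.univ.biUnion S).filter (fun e => td e = v)).card / q ≤ (E0.filter (fun e => v ∈ e)).card / q := by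
    apply Nat.div_le_div_right
    apply Finset.card_le_card
    intro e he
    rw [Finset.mem_filter] at he ⊢
    rw [hv]; exact ⟨hSE he.1, Or.inr he.2⟩
  have := s4 v
  have := t4 v
  omega

end light
end P5

namespace P5
open scoped Classical
set_option linter.unusedSectionVars false
/-- degree of `v` in an edge set -/
noncomputable def dg {V : Type} (F : Finset (Sym2 V)) (v : V) : ℕ := (F.filter (fun e => v ∈ e)).card

lemma nb_fromEdge {V : Type} [Fintype V] (F : Finset (Sym2 V)) (hF : ∀ e ∈ F, ¬ e.IsDiag) (v : V) :
    (nb (SimpleGraph.fromEdgeSet (F : Set (Sym2 V))) v).card = dg F v := by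
  apply Finset.card_bij (fun x _ => s(v, x))
  · intro x hx
    rw [mem_nb, SimpleGraph.fromEdgeSet_adj] at hx
    rw [Finset.mem_filter]
    exact ⟨hx.1, Sym2.mem_mk_left _ _⟩
  · intro x _ y _ h
    exact Sym2.congr_right.1 h
  · intro e he
    rw [Finset.mem_filter] at he
    obtain ⟨y, rfl⟩ := he.2
    refine ⟨y, ?_, rfl⟩
    rw [mem_nb, SimpleGraph.fromEdgeSet_adj]
    exact ⟨he.1, fun h => hF _ he.1 (Sym2.mk_isDiag_iff.2 h)⟩

structure Setup (V : Type) [Fintype V] (E : Finset (Sym2 V)) (c1 : ℕ) where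
  κ : Set V
  T : Fin 64 → Finset (Sym2 V)
  Es : Finset (Sym2 V)
  EH : Finset (Sym2 V)
  gs : V → ℕ
  gH : V → ℕ
  S : Finset (List V)
  H : Finset (List V)
  nl : ∀ e ∈ E, ¬ e.IsDiag
  hTE : ∀ j, T j ⊆ E
  hsE : Es ⊆ E
  hHE : EH ⊆ E
  dTT : ∀ i j, i ≠ j → Disjoint (T i) (T j)
  dTs : ∀ j, Disjoint (T j) Es
  dTH : ∀ j, Disjoint (T j) EH
  dsH : Disjoint Es EH
  bT : ∀ j, ∀ e ∈ T j, cx κ e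
  bs : ∀ e ∈ Es, cx κ e
  conn : ∀ j X, X.Nonempty → Xᶜ.Nonempty → ∃ e ∈ T j, cx X e
  gs1 : ∀ v, 1 ≤ gs v
  gT : ∀ v, dg (Finset.univ.biUnion T) v ≤ gs v
  gTs : ∀ v, dg (Finset.univ.biUnion T ∪ Es) v ≤ 2 * gH v
  S1 : ∀ p ∈ S, p.Nodup ∧ p.length = 15 ∧ ed p ⊆ Es
  S2 : ∀ p ∈ S, ∀ q ∈ S, p ≠ q → Disjoint (ed p) (ed q)
  S3 : ∀ v, (2 * c1 + 6) * gs v ≤ (S.filter (fun p => isHead v p)).card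
  S4 : ∀ v x, x ≠ v → (S.filter (fun p => isEnd v p ∧ x ∈ p)).card ≤ c1 * gs v
  H1 : ∀ p ∈ H, p.Nodup ∧ p.length = 15 ∧ ed p ⊆ EH
  H2 : ∀ p ∈ H, ∀ q ∈ H, p ≠ q → Disjoint (ed p) (ed q)
  H3 : ∀ v, (10 * (15 * c1 + 2)) * gH v ≤ (H.filter (fun p => isHead v p)).card
  H4 : ∀ v x, x ≠ v → (H.filter (fun p => isEnd v p ∧ x ∈ p)).card ≤ c1 * gH v

theorem exists_setup : ∃ c1 K : ℕ, ∀ (V : Type) [Fintype V] [Nontrivial V] (G : SimpleGraph V),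
    (∀ S : Finset (Sym2 V), S.card < K → (G.deleteEdges ↑S).Connected) → Nonempty (Setup V (gE G) c1) := by
  obtain ⟨c1, hc1⟩ := lemmaH 13
  obtain ⟨Ds, hDs0, hDs⟩ := hc1 (2 * c1 + 6)
  obtain ⟨DH, hDH0, hDH⟩ := hc1 (10 * (15 * c1 + 2))
  obtain ⟨A, hA⟩ : ∃ A, A = 2 ^ (DH + 4) := ⟨_, rfl⟩
  have hA16 : 16 * DH ≤ A := by
    rw [hA, pow_add]
    have : DH < 2 ^ DH := Nat.lt_two_pow_self
    omega
  obtain ⟨q, hq⟩ : ∃ q, q = 24 * (A * Ds) := ⟨_, rfl⟩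
  have hADs : A ≤ A * Ds := Nat.le_mul_of_pos_right _ hDs0
  have hq0 : 0 < q := by omega
  obtain ⟨N, hN⟩ : ∃ N, N = 2 * q * (2 * q * 64) := ⟨_, rfl⟩
  have hNq : 2 * q ≤ N := by
    rw [hN]; apply Nat.le_mul_of_pos_right; omega
  refine ⟨c1, 2 * N, ?_⟩
  intro V _ _ G hG
  have hnl : ∀ e ∈ gE G, ¬ e.IsDiag := fun e he => G.not_isDiag_of_mem_edgeSet ((mem_gE G e).1 he)
  obtain ⟨κ, hκ⟩ := maxcut (gE G) (2 * N) (cuts_of_conn G (2 * N) hG)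
  obtain ⟨Gb, hGb⟩ : ∃ Gb, Gb = (gE G).filter (fun e => cx κ e) := ⟨_, rfl⟩
  rw [← hGb] at hκ
  have hGbE : Gb ⊆ gE G := hGb ▸ Finset.filter_subset _ _
  have hGbκ : ∀ e ∈ Gb, cx κ e := fun e he => by rw [hGb, Finset.mem_filter] at he; exact he.2
  have hcut : ∀ X : Set V, X.Nonempty → Xᶜ.Nonempty → N ≤ (Gb.filter (fun e => cx X e)).card := by
    intro X h1 h2
    have := hκ X h1 h2
    omega
  have hd : ∀ v, N ≤ dg Gb v := by
    intro v
    obtain ⟨w, hw⟩ := exists_ne v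
    refine (hcut {v} ⟨v, rfl⟩ ⟨w, hw⟩).trans (Finset.card_le_card ?_)
    intro e he
    rw [Finset.mem_filter] at he ⊢
    refine ⟨he.1, ?_⟩
    obtain ⟨a, b, rfl, ha, _⟩ := he.2
    rw [Set.mem_singleton_iff] at ha
    rw [ha]; exact Sym2.mem_mk_left _ _
  obtain ⟨T, hT1, hT2, hT3, hT4⟩ := light Gb q 64 hq0 (by rw [← hN]; exact hcut)
  obtain ⟨TT, hTT⟩ : ∃ TT, TT = Finset.univ.biUnion T := ⟨_, rfl⟩
  have hTTm : ∀ e, e ∈ TT ↔ ∃ i, e ∈ T i := fun e => by rw [hTT]; simp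
  have hTTb : TT ⊆ Gb := fun e he => by
    obtain ⟨i, hi⟩ := (hTTm e).1 he
    exact hT1 i hi
  have hdT : ∀ v, q * dg TT v ≤ 3 * dg Gb v := by
    intro v
    have h1 := hT4 v
    rw [← hTT] at h1
    change dg TT v ≤ 2 * (dg Gb v / q + 1) at h1
    have h2 := Nat.mul_div_le (dg Gb v) q
    have h3 := hd v
    have h4 := Nat.mul_le_mul_left q h1
    have h5 : q * (2 * (dg Gb v / q + 1)) = 2 * (q * (dg Gb v / q)) + 2 * q := by ring
    omega
  obtain ⟨EΓ, hEΓ⟩ : ∃ EΓ, EΓ = Gb \ TT := ⟨_, rfl⟩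
  have hdΓ : ∀ v, dg EΓ v + dg TT v = dg Gb v := by
    intro v
    rw [dg, dg, dg, ← Finset.card_union_of_disjoint, ← Finset.filter_union, hEΓ, Finset.sdiff_union_of_subset hTTb]
    apply Finset.disjoint_filter_filter
    rw [hEΓ]; exact Finset.sdiff_disjoint
  obtain ⟨P, hP⟩ : ∃ P : V → Sym2 V → Prop, ∀ v e, P v e ↔ v ∈ e := ⟨fun v e => v ∈ e, fun _ _ => Iff.rfl⟩
  have hPd : ∀ F : Finset (Sym2 V), ∀ v, (F.filter (P v)).card = dg F v := by
    intro F v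
    rw [dg]
    congr 1
    ext e
    rw [Finset.mem_filter, Finset.mem_filter, hP]
  obtain ⟨Es, hEsΓ, hEs⟩ := thin_fin EΓ P 2 (by
    intro e _
    have : (Finset.univ.filter (fun v => P v e)) = e.toFinset := by
      ext v; simp [hP]
    rw [this]
    rw [Sym2.card_toFinset]; split_ifs <;> norm_num) (DH + 4)
  have hEsr : ∀ v, A * dg Es v ≤ dg EΓ v + 4 * A ∧ dg EΓ v ≤ A * dg Es v + 4 * A := by
    intro v
    have h := abs_le.1 (hEs v)
    rw [hPd, hPd] at h
    have hAr : (2 : ℝ) ^ (DH + 4) = A := by rw [hA]; push_cast; rfl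
    rw [hAr] at h
    have hA0 : (0 : ℝ) < A := by rw [← hAr]; positivity
    push_cast at h
    have e : (dg EΓ v : ℝ) = A * (dg EΓ v / A) := by field_simp
    constructor
    · have : (A : ℝ) * dg Es v ≤ dg EΓ v + 4 * A := by rw [e]; nlinarith [h.2]
      exact_mod_cast this
    · have : (dg EΓ v : ℝ) ≤ A * dg Es v + 4 * A := by rw [e]; nlinarith [h.1]
      exact_mod_cast this
  obtain ⟨EH, hEH⟩ : ∃ EH, EH = EΓ \ Es := ⟨_, rfl⟩
  have hdH : ∀ v, dg EH v + dg Es v = dg EΓ v := by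
    intro v
    rw [dg, dg, dg, ← Finset.card_union_of_disjoint, ← Finset.filter_union, hEH, Finset.sdiff_union_of_subset hEsΓ]
    apply Finset.disjoint_filter_filter
    rw [hEH]; exact Finset.sdiff_disjoint
  have hEΓb : EΓ ⊆ Gb := by rw [hEΓ]; exact Finset.sdiff_subset
  have hEHΓ : EH ⊆ EΓ := by rw [hEH]; exact Finset.sdiff_subset
  -- numeric facts
  have hA0 : 16 ≤ A := by omega
  have num : ∀ v, dg Gb v ≤ 4 * (A * dg Es v) ∧ A * dg Es v ≤ 2 * dg Gb v ∧ dg Gb v ≤ 4 * dg EH v := by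
    intro v
    have h1 := hdT v
    have h2 := hdΓ v
    have h3 := hEsr v
    have h4 := hdH v
    have h5 := hd v
    have h6 : 24 * dg TT v ≤ 3 * dg Gb v := by
      have : 24 * dg TT v ≤ q * dg TT v := Nat.mul_le_mul_right _ (by omega)
      omega
    have h7 : 16 * dg Es v ≤ A * dg Es v := Nat.mul_le_mul_right _ hA0
    have h8 : 48 * A ≤ N := by omega
    refine ⟨by omega, by omega, by omega⟩
  have hnls : ∀ e ∈ Es, ¬ e.IsDiag := fun e he => hnl e (hGbE (hEΓb (hEsΓ he)))
  have hnlH : ∀ e ∈ EH, ¬ e.IsDiag := fun e he => hnl e (hGbE (hEΓb (hEHΓ he)))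
  obtain ⟨gs, hgs, S, S1, S2, S3, S4⟩ := hDs V (SimpleGraph.fromEdgeSet (Es : Set (Sym2 V))) (by
    intro v
    rw [nb_fromEdge Es hnls]
    have h1 := (num v).1
    have h2 := hd v
    have h3 : A * Ds ≤ A * dg Es v := by omega
    exact Nat.le_of_mul_le_mul_left h3 (by omega))
  obtain ⟨gH, hgH, H, H1, H2, H3, H4⟩ := hDH V (SimpleGraph.fromEdgeSet (EH : Set (Sym2 V))) (by
    intro v
    rw [nb_fromEdge EH hnlH]
    have h1 := (num v).2.2
    have h2 := hd v
    omega)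
  have hsub : ∀ F : Finset (Sym2 V), ∀ p : List V,
      ↑(ed p) ⊆ (SimpleGraph.fromEdgeSet (F : Set (Sym2 V))).edgeSet → ed p ⊆ F := by
    intro F p hp e he
    have := hp he
    rw [SimpleGraph.edgeSet_fromEdgeSet] at this
    exact this.1
  have hgT : ∀ v, dg TT v ≤ gs v := by
    intro v
    have h1 := (hgs v).2
    rw [nb_fromEdge Es hnls] at h1
    have h2 := hdT v
    have h3 := (num v).1
    have h4 := Nat.mul_le_mul_left A h1
    have h5 : 12 * (A * (2 * Ds * gs v)) = q * gs v := by rw [hq]; ring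
    have h9 : q * dg TT v ≤ q * gs v := by omega
    exact Nat.le_of_mul_le_mul_left h9 hq0
  have hgH' : ∀ v, dg TT v ≤ gH v ∧ dg Es v ≤ gH v := by
    intro v
    have h1 := (hgH v).2
    rw [nb_fromEdge EH hnlH] at h1
    have h2 := hdT v
    obtain ⟨_, h3, h4⟩ := num v
    have h5 : 16 * DH * gH v ≤ A * gH v := Nat.mul_le_mul_right _ hA16
    have h6 : 16 * (A * gH v) ≤ q * gH v := by
      rw [← mul_assoc]; exact Nat.mul_le_mul_right _ (by omega)
    have h7 : 2 * DH * gH v = 2 * (DH * gH v) := by ring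
    have h8 : 16 * DH * gH v = 16 * (DH * gH v) := by ring
    constructor
    · have h9 : q * dg TT v ≤ q * gH v := by omega
      exact Nat.le_of_mul_le_mul_left h9 hq0
    · have h9 : A * dg Es v ≤ A * gH v := by omega
      exact Nat.le_of_mul_le_mul_left h9 (by omega)
  have hdisj : ∀ j, Disjoint (T j) EΓ := by
    intro j
    rw [Finset.disjoint_left]
    intro e he he'
    rw [hEΓ, Finset.mem_sdiff] at he'
    exact he'.2 ((hTTm e).2 ⟨j, he⟩)
  refine ⟨⟨κ, T, Es, EH, gs, gH, S, H, hnl, fun j => (hT1 j).trans hGbE, hEsΓ.trans (hEΓb.trans hGbE),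
    hEHΓ.trans (hEΓb.trans hGbE), hT3, fun j => (hdisj j).mono_right hEsΓ, fun j => (hdisj j).mono_right hEHΓ,
    ?_, fun j e he => hGbκ e (hT1 j he), fun e he => hGbκ e (hEΓb (hEsΓ he)), hT2, fun v => (hgs v).1, ?_, ?_,
    fun p hp => ⟨(S1 p hp).1, (S1 p hp).2.1, hsub _ _ (S1 p hp).2.2⟩, S2, S3, S4,
    fun p hp => ⟨(H1 p hp).1, (H1 p hp).2.1, hsub _ _ (H1 p hp).2.2⟩, H2, H3, H4⟩⟩
  · rw [hEH]; exact Finset.disjoint_sdiff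
  · rw [← hTT]; exact hgT
  · rw [← hTT]
    intro v
    have h1 := hgH' v
    have : dg (TT ∪ Es) v ≤ dg TT v + dg Es v := by
      rw [dg, Finset.filter_union]; exact Finset.card_union_le _ _
    omega

end P5

namespace P5
open scoped Classical
set_option linter.unusedSectionVars false
lemma inj_choice {I V α : Type} [DecidableEq I] [DecidableEq V] [DecidableEq α] [Inhabited α]
    (cls : I → V) (hdp : V → α → Prop) (O : I → Finset α)
    (hu : ∀ v w x, hdp v x → hdp w x → v = w) (S : Finset I)
    (h1 : ∀ i ∈ S, ∀ x ∈ O i, hdp (cls i) x)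
    (h2 : ∀ i ∈ S, (S.filter (fun i' => cls i' = cls i)).card ≤ (O i).card) :
    ∃ f : I → α, (∀ i ∈ S, f i ∈ O i) ∧ Set.InjOn f S := by
  have main : ∀ S' : Finset I, S' ⊆ S → ∃ f : I → α, (∀ i ∈ S', f i ∈ O i) ∧ Set.InjOn f S' := by
    intro S'
    induction S' using Finset.induction_on with
    | empty => intro _; exact ⟨fun _ => default, by simp, by simp⟩
    | insert i s his ih =>
      intro hsub
      obtain ⟨f, hf1, hf2⟩ := ih ((Finset.subset_insert _ _).trans hsub)
      have hiS : i ∈ S := hsub (Finset.mem_insert_self _ _)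
      have hlt : ((s.filter (fun i' => cls i' = cls i)).image f).card < (O i).card := by
        refine lt_of_lt_of_le (lt_of_le_of_lt Finset.card_image_le (Finset.card_lt_card ?_)) (h2 i hiS)
        refine ⟨Finset.filter_subset_filter _ ((Finset.subset_insert _ _).trans hsub), fun hh => ?_⟩
        have : i ∈ s.filter (fun i' => cls i' = cls i) := hh (by simp [hiS])
        exact his (Finset.mem_filter.1 this).1
      obtain ⟨x, hx, hx'⟩ := Finset.exists_mem_notMem_of_card_lt_card hlt
      have hne : ∀ k ∈ s, f k ≠ x := by
        rintro k hk rfl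
        have hkS : k ∈ S := hsub (Finset.mem_insert_of_mem hk)
        have := hu _ _ _ (h1 k hkS _ (hf1 k hk)) (h1 i hiS _ hx)
        exact hx' (Finset.mem_image_of_mem f (by simp [hk, this]))
      have hup : ∀ k ∈ s, Function.update f i x k = f k := by
        intro k hk
        rw [Function.update_of_ne]
        rintro rfl; exact his hk
      refine ⟨Function.update f i x, ?_, ?_⟩
      · intro k hk
        rw [Finset.mem_insert] at hk
        rcases hk with rfl | hk
        · simpa using hx
        · rw [hup k hk]; exact hf1 k hk
      · intro k hk l hl hkl
        rw [Finset.mem_coe, Finset.mem_insert] at hk hl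
        rcases hk with rfl | hk <;> rcases hl with rfl | hl
        · rfl
        · rw [Function.update_self, hup l hl] at hkl; exact (hne l hl hkl.symm).elim
        · rw [Function.update_self, hup k hk] at hkl; exact (hne k hk hkl).elim
        · rw [hup k hk, hup l hl] at hkl; exact hf2 hk hl hkl
  exact main S (Finset.Subset.refl _)

section
variable {V : Type}

lemma par_list (κ : Set V) : ∀ (l : List V) (b w : V), (∀ e ∈ ed (b :: l), cx κ e) →
    (b :: l).getLast? = some w → (w ∈ κ ↔ (b ∈ κ ↔ Even l.length))
  | [], b, w, _, h => by
    simp at h; simp [h]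
  | c :: l, b, w, hb, h => by
    have h1 := par_list κ l c w (fun e he => hb e (by rw [ed_cons_cons]; exact Finset.mem_insert_of_mem he))
      (by simpa using h)
    have h2 := hb s(b, c) (by rw [ed_cons_cons]; exact Finset.mem_insert_self _ _)
    rw [cx_mk] at h2
    rw [h1, List.length_cons, Nat.even_add_one]
    tauto

lemma cross_exists [Fintype V] (κ : Set V) (Tj : Finset (Sym2 V)) (bich : ∀ e ∈ Tj, cx κ e)
    (conn : ∀ X : Set V, X.Nonempty → Xᶜ.Nonempty → ∃ e ∈ Tj, cx X e)
    (σ : V → Equiv.Perm V) (hσ : ∀ b, (σ b).IsCycleOn ((Finset.univ.filter (fun a => s(b, a) ∈ Tj) : Finset V) : Set V))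
    (far : V → V → V) (hfar : ∀ b a, s(b, a) ∈ Tj → (far b a ∈ κ ↔ b ∈ κ))
    (X : Set V) (hX1 : X.Nonempty) (hX2 : Xᶜ.Nonempty) :
    ∃ b a, s(b, a) ∈ Tj ∧ (¬ (a ∈ X ↔ far b a ∈ X) ∨ ¬ (σ b a ∈ X ↔ far b a ∈ X)) := by
  by_contra hcon
  push Not at hcon
  have hstep : ∀ b a, s(b, a) ∈ Tj → (σ b a ∈ X ↔ a ∈ X) := by
    intro b a h
    obtain ⟨h1, h2⟩ := hcon b a h
    exact h2.trans h1.symm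
  have hpow : ∀ b a, s(b, a) ∈ Tj → ∀ n : ℕ, s(b, (σ b ^ n) a) ∈ Tj ∧ ((σ b ^ n) a ∈ X ↔ a ∈ X) := by
    intro b a h n
    induction n with
    | zero => simpa using h
    | succ n ih =>
      rw [pow_succ', Equiv.Perm.mul_apply]
      refine ⟨?_, (hstep b _ ih.1).trans ih.2⟩
      have := (hσ b).1.mapsTo (x := (σ b ^ n) a) (by simpa using ih.1)
      simpa using this
  have hconst : ∀ b a a', s(b, a) ∈ Tj → s(b, a') ∈ Tj → a ∈ X → a' ∈ X := by
    intro b a a' h h' ha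
    obtain ⟨n, _, hn⟩ := (hσ b).exists_pow_eq (a := a) (b := a') (by simpa using h) (by simpa using h')
    rw [← hn]
    exact (hpow b a h n).2.2 ha
  have hclass : ∀ A : Set V, (∀ b a, s(b, a) ∈ Tj → (b ∈ A ↔ a ∉ A)) → ∀ u ∈ A, ∀ w ∈ A, u ∈ X → w ∈ X := by
    intro A hA u hu w hw huX
    by_contra hwX
    obtain ⟨e, he, c, d, rfl, hc, hd⟩ := conn {v | (v ∈ A ∧ v ∈ X) ∨ (v ∉ A ∧ ∃ a, s(v, a) ∈ Tj ∧ a ∈ X)}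
      ⟨u, Or.inl ⟨hu, huX⟩⟩ ⟨w, by
        rintro (h | h)
        · exact hwX h.2
        · exact h.1 hw⟩
    rw [Set.mem_ofPred_eq] at hc hd
    push Not at hd
    have hcd := hA c d he
    rcases hc with ⟨h1, h2⟩ | ⟨h1, a, h2, h3⟩
    · exact hd.2 (hcd.1 h1) c (by rw [Sym2.eq_swap]; exact he) h2
    · have hdA : d ∈ A := by tauto
      exact hd.1 hdA (hconst c a d h2 he h3)
  obtain ⟨e, he, c, d, rfl, hc, hd⟩ := conn X hX1 hX2
  have hedge : ∀ b a, s(b, a) ∈ Tj → (b ∈ κ ↔ a ∉ κ) := by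
    intro b a h
    have := bich _ h
    rw [cx_mk] at this
    tauto
  have he' : s(d, c) ∈ Tj := by rw [Sym2.eq_swap]; exact he
  have h1 := (hcon d c he').1.1 hc
  have h2 := hfar d c he'
  by_cases hdκ : d ∈ κ
  · exact hd (hclass κ hedge _ (h2.2 hdκ) _ hdκ h1)
  · refine hd (hclass κᶜ ?_ _ (fun h => hdκ (h2.1 h)) _ hdκ h1)
    intro b a h
    have := hedge b a h
    simp only [Set.mem_compl_iff]
    tauto

end
end P5

namespace P5
open scoped Classical
set_option linter.unusedSectionVars false
section
variable {V : Type} [Fintype V] {E : Finset (Sym2 V)} {c1 : ℕ}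

lemma isHead_uniq {v w : V} {p : List V} (h : isHead v p) (h' : isHead w p) : v = w := by
  unfold isHead at h h'
  rw [h] at h'
  exact Option.some.inj h'

noncomputable def slotSet (St : Setup V E c1) : Finset (Fin 64 × V × V) :=
  Finset.univ.filter (fun i => s(i.2.1, i.2.2) ∈ St.T i.1)

lemma mem_slotSet (St : Setup V E c1) (j : Fin 64) (b a : V) : (j, b, a) ∈ slotSet St ↔ s(b, a) ∈ St.T j := by
  simp [slotSet]

lemma T_index (St : Setup V E c1) {j j' : Fin 64} {e : Sym2 V} (h : e ∈ St.T j) (h' : e ∈ St.T j') : j = j' := by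
  by_contra hne
  exact Finset.disjoint_left.1 (St.dTT j j' hne) h h'

lemma slot_count (St : Setup V E c1) (b : V) :
    ((slotSet St).filter (fun i => i.2.1 = b)).card ≤ St.gs b := by
  refine le_trans (Finset.card_le_card_of_injOn (fun i => s(i.2.1, i.2.2)) ?_ ?_) (St.gT b)
  · rintro ⟨j, b', a⟩ hi
    rw [Finset.mem_coe, Finset.mem_filter, mem_slotSet] at hi
    obtain ⟨hi, rfl⟩ := hi
    rw [Finset.mem_coe, Finset.mem_filter]
    exact ⟨Finset.mem_biUnion.2 ⟨j, Finset.mem_univ _, hi⟩, Sym2.mem_mk_left _ _⟩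
  · rintro ⟨j, b', a⟩ hi ⟨j', b'', a'⟩ hi' hee
    rw [Finset.mem_coe, Finset.mem_filter, mem_slotSet] at hi hi'
    obtain ⟨hi, rfl⟩ := hi
    obtain ⟨hi', h⟩ := hi'
    simp only at h hee
    subst h
    have h2 := Sym2.congr_right.1 hee
    subst h2
    rw [T_index St hi hi']

lemma slots (St : Setup V E c1) (σ : Fin 64 → V → Equiv.Perm V) (hσ : ∀ j b a, s(b, a) ∈ St.T j → s(b, σ j b a) ∈ St.T j) :
    ∃ h : Fin 64 × V × V → List V,
      (∀ i ∈ slotSet St, h i ∈ St.S ∧ isHead i.2.1 (h i) ∧ i.2.2 ∉ h i ∧ σ i.1 i.2.1 i.2.2 ∉ h i) ∧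
      Set.InjOn h (slotSet St) := by
  have hT : ∀ j b a, s(b, a) ∈ St.T j → a ≠ b := by
    rintro j b a h rfl
    exact St.nl _ (St.hTE j h) (Sym2.mk_isDiag_iff.2 rfl)
  obtain ⟨h, h1, h2⟩ := inj_choice (I := Fin 64 × V × V) (V := V) (α := List V) (fun i => i.2.1) isHead
    (fun i => (St.S.filter (fun p => isHead i.2.1 p)).filter (fun p => i.2.2 ∉ p ∧ σ i.1 i.2.1 i.2.2 ∉ p))
    (fun v w x => isHead_uniq) (slotSet St)
    (fun i _ x hx => (Finset.mem_filter.1 (Finset.mem_filter.1 hx).1).2) (by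
      rintro ⟨j, b, a⟩ hi
      refine le_trans (slot_count St b) ?_
      rw [mem_slotSet] at hi
      have hb := St.S3 b
      have key : ∀ x, x ≠ b → ((St.S.filter (fun p => isHead b p)).filter (fun p => x ∈ p)).card ≤ c1 * St.gs b := by
        intro x hx
        refine le_trans (Finset.card_le_card ?_) (St.S4 b x hx)
        intro p hp
        rw [Finset.mem_filter, Finset.mem_filter] at hp
        exact Finset.mem_filter.2 ⟨hp.1.1, Or.inl hp.1.2, hp.2⟩
      have k1 := key a (hT j b a hi)
      have k2 := key (σ j b a) (hT j b _ (hσ j b a hi))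
      have hsub : St.S.filter (fun p => isHead b p) ⊆
          ((St.S.filter (fun p => isHead b p)).filter (fun p => a ∉ p ∧ σ j b a ∉ p)) ∪
          (((St.S.filter (fun p => isHead b p)).filter (fun p => a ∈ p)) ∪
          ((St.S.filter (fun p => isHead b p)).filter (fun p => σ j b a ∈ p))) := by
        intro p hp
        simp only [Finset.mem_union]
        by_cases ha : a ∈ p
        · exact Or.inr (Or.inl (Finset.mem_filter.2 ⟨hp, ha⟩))
        by_cases ha' : σ j b a ∈ p
        · exact Or.inr (Or.inr (Finset.mem_filter.2 ⟨hp, ha'⟩))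
        · exact Or.inl (Finset.mem_filter.2 ⟨hp, ha, ha'⟩)
      have hc := (Finset.card_le_card hsub).trans ((Finset.card_union_le _ _).trans
        (Nat.add_le_add_left (Finset.card_union_le _ _) _))
      have : (2 * c1 + 6) * St.gs b = c1 * St.gs b + c1 * St.gs b + 6 * St.gs b := by ring
      have hg : St.gs b ≤ ((St.S.filter (fun p => isHead b p)).filter (fun p => a ∉ p ∧ σ j b a ∉ p)).card := by omega
      exact hg)
  refine ⟨h, fun i hi => ?_, h2⟩
  have := h1 i hi
  rw [Finset.mem_filter, Finset.mem_filter] at this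
  exact ⟨this.1.1, this.1.2, this.2⟩

lemma card_of_disj_cross {ι : Type} [Fintype ι] {K : Type} [DecidableEq K] (C : Finset K) (P : K → Prop)
    (f : K → ι) (h : ∀ j, ∃ c ∈ C, P c ∧ f c = j) : Fintype.card ι ≤ (C.filter P).card := by
  choose c h1 h2 h3 using h
  rw [← Finset.card_univ]
  refine Finset.card_le_card_of_injOn c ?_ ?_
  · intro j _
    exact Finset.mem_coe.2 (Finset.mem_filter.2 ⟨h1 j, h2 j⟩)
  · intro j _ j' _ hj
    rw [← h3 j, ← h3 j', hj]

/-- separated by `X` -/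
def sep (X : Set V) (p : List V) : Prop :=
  ∃ a b, p.head? = some a ∧ p.getLast? = some b ∧ ((a ∈ X ∧ b ∉ X) ∨ (a ∉ X ∧ b ∈ X))

theorem famF (St : Setup V E c1) [Inhabited V] : ∃ used F1 F2 : Finset (List V), used ⊆ St.S ∧
    (∀ v, (used.filter (fun p => isHead v p)).card ≤ St.gs v) ∧
    (∀ p ∈ F1 ∪ F2, ∃ a h b j, p = a :: h ∧ h ∈ used ∧ a ∉ h ∧ isHead b h ∧ s(a, b) ∈ St.T j) ∧
    (∀ p ∈ F1 ∪ F2, ∀ q ∈ F1 ∪ F2, p ≠ q → Disjoint (ed p) (ed q)) ∧ Disjoint F1 F2 ∧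
    (∀ X : Set V, X.Nonempty → Xᶜ.Nonempty → ∃ p ∈ F1, sep X p) ∧
    (∀ X : Set V, X.Nonempty → Xᶜ.Nonempty → ∃ p ∈ F2, sep X p) := by
  choose σ hσ hσs using fun (j : Fin 64) (b : V) => Finset.exists_cycleOn (Finset.univ.filter (fun a => s(b, a) ∈ St.T j))
  have hσT : ∀ j b a, s(b, a) ∈ St.T j → s(b, σ j b a) ∈ St.T j := by
    intro j b a h
    have := (hσ j b).1.mapsTo (x := a) (by simpa using h)
    simpa using this
  obtain ⟨h, hh, hinj⟩ := slots St σ hσT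
  obtain ⟨nx, hnx⟩ : ∃ nx : (Fin 64 × V × V) × Bool → V,
    ∀ c, nx c = if c.2 then c.1.2.2 else σ c.1.1 c.1.2.1 c.1.2.2 := ⟨_, fun _ => rfl⟩
  obtain ⟨far, hfar⟩ : ∃ far : (Fin 64 × V × V) → V, ∀ i, far i = (h i).getLast?.getD default := ⟨_, fun _ => rfl⟩
  have hlast : ∀ i ∈ slotSet St, (h i).getLast? = some (far i) := by
    intro i hi
    have h15 := (St.S1 _ (hh i hi).1).2.1
    rw [hfar]
    cases hl : (h i).getLast? with
    | none => rw [List.getLast?_eq_none_iff] at hl; rw [hl] at h15; simp at h15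
    | some x => rfl
  have hfarκ : ∀ i ∈ slotSet St, (far i ∈ St.κ ↔ i.2.1 ∈ St.κ) := by
    intro i hi
    have h15 := St.S1 _ (hh i hi).1
    have hhd := (hh i hi).2.1
    have hl := hlast i hi
    obtain ⟨p, hp⟩ : ∃ p, p = h i := ⟨_, rfl⟩
    rw [← hp] at h15 hhd hl
    cases p with
    | nil => simp at h15
    | cons b l =>
      unfold isHead at hhd
      have hb : b = i.2.1 := by simpa using hhd
      have := par_list St.κ l b _ (fun e he => St.bs e (h15.2.2 he)) hl
      have hlen : l.length = 14 := by simpa using h15.2.1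
      rw [hlen] at this
      rw [this, hb]
      have : Even 14 := by decide
      tauto
  have hnxT : ∀ c, c.1 ∈ slotSet St → s(c.1.2.1, nx c) ∈ St.T c.1.1 ∧ nx c ∉ h c.1 := by
    rintro ⟨⟨j, b, a⟩, d⟩ hi
    have h1 := (hh _ hi).2.2
    rw [mem_slotSet] at hi
    rw [hnx]
    cases d
    · exact ⟨by simpa using hσT j b a hi, by simpa using h1.2⟩
    · exact ⟨by simpa using hi, by simpa using h1.1⟩
  obtain ⟨C, hC⟩ : ∃ C : Finset ((Fin 64 × V × V) × Bool), ∀ c, c ∈ C ↔ c.1 ∈ slotSet St :=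
    ⟨Finset.univ.filter (fun c => c.1 ∈ slotSet St), by simp⟩
  obtain ⟨S1, hS1, hS1c, hS1g⟩ := lemmaR nx (fun c => far c.1) C (fun c => c.1) 2 16 (by
    intro γ
    refine le_trans (Finset.card_le_card_of_injOn (t := (Finset.univ : Finset Bool)) (fun c => c.2) (fun _ _ => Finset.mem_coe.2 (Finset.mem_univ _)) ?_) (by simp)
    rintro ⟨c, d⟩ hc ⟨c', d'⟩ hc' hcc
    simp at hc hc' hcc
    rw [hc.2, hc'.2, hcc]) (by norm_num) (by
    intro X hX1 hX2
    refine le_trans ?_ (card_of_disj_cross (ι := Fin 64) C _ (fun c => c.1.1) ?_)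
    · simp
    · intro j
      obtain ⟨b, a, hba, hc⟩ := cross_exists St.κ (St.T j) (St.bT j) (St.conn j) (σ j) (hσ j) (fun b a => far (j, b, a))
        (fun b a hba => hfarκ _ ((mem_slotSet St j b a).2 hba)) X hX1 hX2
      have hm := (mem_slotSet St j b a).2 hba
      rcases hc with hc | hc
      · refine ⟨((j, b, a), true), (hC _).2 hm, ?_, rfl⟩
        unfold Cr
        rw [hnx]
        simp only [if_true]
        tauto
      · refine ⟨((j, b, a), false), (hC _).2 hm, ?_, rfl⟩
        unfold Cr
        rw [hnx]
        simp only [Bool.false_eq_true, if_false]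
        tauto)
  obtain ⟨C2, hC2⟩ : ∃ C2 : Finset ((Fin 64 × V × V) × Bool), ∀ c, c ∈ C2 ↔ ∃ i, c ∈ S1 i :=
    ⟨Finset.univ.biUnion S1, by simp⟩
  have hC2C : ∀ c ∈ C2, c.1 ∈ slotSet St := by
    intro c hc
    obtain ⟨i, hi⟩ := (hC2 c).1 hc
    exact (hC c).1 (hS1 i hi)
  have hslot : ∀ c ∈ C2, ∀ c' ∈ C2, c.1 = c'.1 → c = c' := by
    intro c hc c' hc' hcc
    obtain ⟨i, hi⟩ := (hC2 c).1 hc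
    obtain ⟨i', hi'⟩ := (hC2 c').1 hc'
    exact (hS1g i i' c hi c' hi' hcc).2
  obtain ⟨S2, hS2, hS2c, hS2g⟩ := lemmaR nx (fun c => far c.1) C2 (fun c => s(c.1.2.1, nx c)) 4 2 (by
    intro γ
    induction γ using Sym2.ind with
    | _ x y =>
    refine le_trans (Finset.card_le_card_of_injOn (t := (Finset.univ : Finset (Bool × Bool)))
      (fun c => (c.2, decide (c.1.2.1 = x))) (fun _ _ => Finset.mem_coe.2 (Finset.mem_univ _)) ?_) (by simp)
    rintro ⟨⟨j, b, a⟩, d⟩ hc ⟨⟨j', b', a'⟩, d'⟩ hc' hcc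
    obtain ⟨hcm, hc⟩ := (@Finset.mem_filter _ _ (_) _ _).1 (Finset.mem_coe.1 hc)
    obtain ⟨hcm', hc'⟩ := (@Finset.mem_filter _ _ (_) _ _).1 (Finset.mem_coe.1 hc')
    have t1 := (hnxT _ (hC2C _ hcm)).1
    have t2 := (hnxT _ (hC2C _ hcm')).1
    rw [hc] at t1
    rw [hc'] at t2
    have hjj : j = j' := T_index St t1 t2
    subst hjj
    rw [Prod.mk.injEq, decide_eq_decide] at hcc
    obtain ⟨hd, hb⟩ := hcc
    simp only at hd hb
    subst hd
    simp only at hc hc'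
    have hbb : b = b' ∧ nx ((j, b, a), d) = nx ((j, b', a'), d) := by
      rw [Sym2.eq_iff] at hc hc'
      rcases hc with ⟨h1, h2⟩ | ⟨h1, h2⟩ <;> rcases hc' with ⟨h3, h4⟩ | ⟨h3, h4⟩
      · exact ⟨h1.trans h3.symm, h2.trans h4.symm⟩
      · have := hb.1 h1
        exact ⟨h1.trans this.symm, by rw [h2, h4, ← h3, this]⟩
      · have := hb.2 h3
        exact ⟨this.trans h3.symm, by rw [h2, h4, ← h1, this]⟩
      · exact ⟨h1.trans h3.symm, h2.trans h4.symm⟩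
    obtain ⟨hbb, hn⟩ := hbb
    subst hbb
    rw [hnx, hnx] at hn
    cases d
    · simp at hn; rw [hn]
    · simp at hn; rw [hn]) (by norm_num) (by
    intro X hX1 hX2
    refine le_trans ?_ (Finset.card_le_card_of_injOn (s := (Finset.univ : Finset (Fin 16)))
      (fun i => (hS1c i X hX1 hX2).choose) ?_ ?_)
    · simp
    · intro i _
      have := (hS1c i X hX1 hX2).choose_spec
      exact Finset.mem_coe.2 (Finset.mem_filter.2 ⟨(hC2 _).2 ⟨i, this.1⟩, this.2⟩)
    · intro i _ i' _ hii
      have h1 := (hS1c i X hX1 hX2).choose_spec.1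
      have h2 := (hS1c i' X hX1 hX2).choose_spec.1
      exact (hS1g i i' _ h1 _ h2 (congrArg Prod.fst hii)).1)
  obtain ⟨pl, hpl⟩ : ∃ pl : (Fin 64 × V × V) × Bool → List V, ∀ c, pl c = nx c :: h c.1 := ⟨_, fun _ => rfl⟩
  have hplinj : ∀ i i', ∀ c ∈ S2 i, ∀ c' ∈ S2 i', pl c = pl c' → i = i' ∧ c = c' := by
    intro i i' c hc c' hc' hcc
    rw [hpl, hpl, List.cons.injEq] at hcc
    have : c.1 = c'.1 := hinj (hC2C _ (hS2 i hc)) (hC2C _ (hS2 i' hc')) hcc.2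
    have h2 := hslot c (hS2 i hc) c' (hS2 i' hc') this
    exact hS2g i i' c hc c' hc' (by rw [h2])
  have hmem : ∀ p ∈ (S2 0).image pl ∪ (S2 1).image pl, ∃ i, ∃ c ∈ S2 i, pl c = p := by
    intro p hp
    rw [Finset.mem_union, Finset.mem_image, Finset.mem_image] at hp
    rcases hp with ⟨c, hc, hp⟩ | ⟨c, hc, hp⟩
    · exact ⟨0, c, hc, hp⟩
    · exact ⟨1, c, hc, hp⟩
  have hsepall : ∀ i, ∀ X : Set V, X.Nonempty → Xᶜ.Nonempty → ∃ p ∈ (S2 i).image pl, sep X p := by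
    intro i X hX1 hX2
    obtain ⟨c, hc, hcr⟩ := hS2c i X hX1 hX2
    refine ⟨pl c, Finset.mem_image_of_mem _ hc, nx c, far c.1, by rw [hpl]; rfl, ?_, hcr⟩
    have := hlast _ (hC2C c (hS2 i hc))
    rw [hpl, List.getLast?_cons, this]
    rfl
  have hedl : ∀ i, ∀ c ∈ S2 i, ed (pl c) = insert s(nx c, c.1.2.1) (ed (h c.1)) := by
    intro i c hc
    have := (hh _ (hC2C c (hS2 i hc))).2.1
    rw [hpl]
    unfold isHead at this
    cases hq : h c.1 with
    | nil => rw [hq] at this; simp at this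
    | cons x l =>
      rw [hq] at this
      have hx : x = c.1.2.1 := by simpa using this
      rw [ed_cons_cons, hx]
  refine ⟨(slotSet St).image h, (S2 0).image pl, (S2 1).image pl, ?_, ?_, ?_, ?_, ?_, hsepall 0, hsepall 1⟩
  · intro p hp
    obtain ⟨i, hi, rfl⟩ := Finset.mem_image.1 hp
    exact (hh i hi).1
  · intro v
    refine le_trans (le_trans (Finset.card_le_card ?_) (Finset.card_image_le (s := (slotSet St).filter (fun i => i.2.1 = v)) (f := h))) (slot_count St v)
    intro p hp
    rw [Finset.mem_filter, Finset.mem_image] at hp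
    obtain ⟨⟨i, hi, rfl⟩, hv⟩ := hp
    exact Finset.mem_image_of_mem _ (Finset.mem_filter.2 ⟨hi, isHead_uniq (hh i hi).2.1 hv⟩)
  · intro p hp
    obtain ⟨i, c, hc, rfl⟩ := hmem p hp
    have hcs := hC2C c (hS2 i hc)
    refine ⟨nx c, h c.1, c.1.2.1, c.1.1, hpl c, Finset.mem_image_of_mem _ hcs, (hnxT c hcs).2, (hh _ hcs).2.1, ?_⟩
    rw [Sym2.eq_swap]
    exact (hnxT c hcs).1
  · intro p hp q hq hpq
    obtain ⟨i, c, hc, rfl⟩ := hmem p hp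
    obtain ⟨i', c', hc', rfl⟩ := hmem q hq
    have hcs := hC2C c (hS2 i hc)
    have hcs' := hC2C c' (hS2 i' hc')
    have hcc : c ≠ c' := by rintro rfl; exact hpq rfl
    have hc1 : c.1 ≠ c'.1 := fun hh => hcc (hslot c (hS2 i hc) c' (hS2 i' hc') hh)
    have hge : s(nx c, c.1.2.1) ≠ s(nx c', c'.1.2.1) := by
      intro hee
      apply hcc
      refine (hS2g i i' c hc c' hc' ?_).2
      rw [Sym2.eq_swap, hee, Sym2.eq_swap]
    have hsub := (St.S1 _ (hh _ hcs).1).2.2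
    have hsub' := (St.S1 _ (hh _ hcs').1).2.2
    have ht : ∀ c, c.1 ∈ slotSet St → s(nx c, c.1.2.1) ∉ St.Es := by
      intro c hcs hm
      have := (hnxT c hcs).1
      rw [Sym2.eq_swap] at this
      exact Finset.disjoint_left.1 (St.dTs _) this hm
    rw [hedl i c hc, hedl i' c' hc', Finset.disjoint_insert_left, Finset.disjoint_insert_right, Finset.mem_insert]
    refine ⟨?_, ?_, ?_⟩
    · rintro (hx | hx)
      · exact hge hx
      · exact ht c hcs (hsub' hx)
    · exact fun hx => ht c' hcs' (hsub hx)
    · exact St.S2 _ (hh _ hcs).1 _ (hh _ hcs').1 (fun he => hc1 (hinj hcs hcs' he))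
  · rw [Finset.disjoint_left]
    intro p hp hp'
    obtain ⟨c, hc, rfl⟩ := Finset.mem_image.1 hp
    obtain ⟨c', hc', hcc⟩ := Finset.mem_image.1 hp'
    have := (hplinj 1 0 c' hc' c hc hcc).1
    exact absurd this (by decide)
end
end P5

namespace P5
open scoped Classical
set_option linter.unusedSectionVars false
section
variable {V : Type} [Fintype V]

lemma greedy (E : Finset (Sym2 V)) (nl : ∀ e ∈ E, ¬ e.IsDiag) (hne : E.Nonempty)
    (hd : ∀ v, 1 ≤ dg E v → 5 ≤ dg E v) : ∀ n ≤ 5, ∃ (x : V) (l : List V), (x :: l).Nodup ∧ l.length = n ∧ ed (x :: l) ⊆ E ∧ 1 ≤ dg E x := by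
  have hpos : ∀ e ∈ E, ∀ v ∈ e, 1 ≤ dg E v := fun e he v hv =>
    Finset.card_pos.2 ⟨e, Finset.mem_filter.2 ⟨he, hv⟩⟩
  intro n
  induction n with
  | zero =>
    intro _
    obtain ⟨e, he⟩ := hne
    induction e using Sym2.ind with
    | _ x y => exact ⟨x, [], by simp, rfl, by simp, hpos _ he x (Sym2.mem_mk_left _ _)⟩
  | succ n ih =>
    intro hn
    obtain ⟨x, l, h1, h2, h3, h4⟩ := ih (by omega)
    have h5 := hd x h4
    have : ∃ y, s(x, y) ∈ E ∧ y ∉ l := by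
      by_contra hcon
      push Not at hcon
      have : dg E x ≤ l.toFinset.card := by
        refine le_trans (Finset.card_le_card (t := l.toFinset.image (fun y => s(x, y))) ?_) Finset.card_image_le
        intro e he
        obtain ⟨he, hx⟩ := Finset.mem_filter.1 he
        obtain ⟨y, rfl⟩ := hx
        exact Finset.mem_image_of_mem _ (List.mem_toFinset.2 (hcon y he))
      have := this.trans (List.toFinset_card_le l)
      omega
    obtain ⟨y, hy, hyl⟩ := this
    have hxy : y ≠ x := by
      rintro rfl
      exact nl _ hy (Sym2.mk_isDiag_iff.2 rfl)
    refine ⟨y, x :: l, ?_, by simp [h2], ?_, hpos _ hy y (Sym2.mem_mk_right _ _)⟩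
    · rw [List.nodup_cons]
      exact ⟨by simp [hxy, hyl], h1⟩
    · rw [ed_cons_cons, Finset.insert_subset_iff, Sym2.eq_swap]
      exact ⟨hy, h3⟩

theorem packing (n : ℕ) : ∀ E : Finset (Sym2 V), E.card ≤ n → (∀ e ∈ E, ¬ e.IsDiag) →
    ∃ (R : Finset (Sym2 V)) (o : Sym2 V → V), R ⊆ E ∧ PD (E \ R) ∧ (∀ e ∈ R, o e ∈ e) ∧
      ∀ v, (R.filter (fun e => o e = v)).card ≤ 4 := by
  induction n with
  | zero =>
    intro E h0 _
    have : E = ∅ := Finset.card_eq_zero.1 (by omega)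
    subst this
    exact ⟨∅, fun e => sd e, by simp, by simpa using PD.nil, by simp, by simp⟩
  | succ n ih =>
    intro E hn nl
    by_cases c1 : ∃ l : List V, l.Nodup ∧ l.length = 6 ∧ ed l ⊆ E
    · obtain ⟨l, l1, l2, l3⟩ := c1
      have hc : (ed l).card = 5 := by rw [ed_card l1, l2]
      obtain ⟨R, o, h1, h2, h3, h4⟩ := ih (E \ ed l) (by
        have := Finset.card_sdiff_of_subset l3
        omega) (fun e he => nl e (Finset.mem_sdiff.1 he).1)
      refine ⟨R, o, h1.trans Finset.sdiff_subset, ?_, h3, h4⟩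
      have := PD.cons l1 l2 (E := (E \ ed l) \ R) (by
        rw [Finset.disjoint_left]
        intro e he he'
        exact (Finset.mem_sdiff.1 (Finset.mem_sdiff.1 he').1).2 he) h2
      have heq : E \ R = ed l ∪ ((E \ ed l) \ R) := by
        ext e
        have a1 : e ∈ ed l → e ∈ E := fun h => l3 h
        have a2 : e ∈ R → e ∉ ed l := fun h => (Finset.mem_sdiff.1 (h1 h)).2
        simp only [Finset.mem_union, Finset.mem_sdiff]
        tauto
      rw [heq]; exact this
    by_cases c2 : ∃ v, 1 ≤ dg E v ∧ dg E v ≤ 4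
    · obtain ⟨v, v1, v2⟩ := c2
      obtain ⟨St, hSt⟩ : ∃ St, St = E.filter (fun e => v ∈ e) := ⟨_, rfl⟩
      have hm : ∀ e, e ∈ St ↔ e ∈ E ∧ v ∈ e := by intro e; rw [hSt, Finset.mem_filter]
      have hSE : St ⊆ E := fun e he => ((hm e).1 he).1
      have hcard : St.card = dg E v := by rw [hSt]; rfl
      obtain ⟨R, o, h1, h2, h3, h4⟩ := ih (E \ St) (by
        have := Finset.card_sdiff_of_subset hSE
        omega) (fun e he => nl e (Finset.mem_sdiff.1 he).1)
      have hRv : ∀ e ∈ R, v ∉ e := by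
        intro e he hv
        have := Finset.mem_sdiff.1 (h1 he)
        exact this.2 ((hm e).2 ⟨this.1, hv⟩)
      obtain ⟨o', ho1, ho2⟩ : ∃ o' : Sym2 V → V, (∀ e, v ∈ e → o' e = v) ∧ (∀ e, v ∉ e → o' e = o e) :=
        ⟨fun e => if v ∈ e then v else o e, fun e h => if_pos h, fun e h => if_neg h⟩
      refine ⟨R ∪ St, o', ?_, ?_, ?_, ?_⟩
      · exact Finset.union_subset (h1.trans Finset.sdiff_subset) hSE
      · have heq : E \ (R ∪ St) = (E \ St) \ R := by
          ext e
          simp only [Finset.mem_union, Finset.mem_sdiff]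
          tauto
        rw [heq]; exact h2
      · intro e he
        rcases Finset.mem_union.1 he with he | he
        · rw [ho2 e (hRv e he)]; exact h3 e he
        · rw [ho1 e ((hm e).1 he).2]; exact ((hm e).1 he).2
      · intro w
        by_cases hw : w = v
        · subst hw
          refine le_trans (Finset.card_le_card (t := St) ?_) (by omega)
          intro e he
          obtain ⟨he, hoe⟩ := Finset.mem_filter.1 he
          rcases Finset.mem_union.1 he with he | he
          · rw [ho2 e (hRv e he)] at hoe
            exact absurd (hoe ▸ h3 e he) (hRv e he)
          · exact he
        · refine le_trans (Finset.card_le_card ?_) (h4 w)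
          intro e he
          obtain ⟨he, hoe⟩ := Finset.mem_filter.1 he
          rcases Finset.mem_union.1 he with he | he
          · rw [ho2 e (hRv e he)] at hoe
            exact Finset.mem_filter.2 ⟨he, hoe⟩
          · rw [ho1 e ((hm e).1 he).2] at hoe
            exact absurd hoe.symm hw
    · by_cases hE : E.Nonempty
      · push Not at c2
        obtain ⟨x, l, g1, g2, g3, _⟩ := greedy E nl hE (fun v hv => c2 v hv) 5 le_rfl
        exact absurd ⟨x :: l, g1, by simp [g2], g3⟩ c1
      · rw [Finset.not_nonempty_iff_eq_empty] at hE
        subst hE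
        exact ⟨∅, fun e => sd e, by simp, by simpa using PD.nil, by simp, by simp⟩

end
end P5

namespace P5
open scoped Classical
set_option linter.unusedSectionVars false
section
variable {V : Type} [Fintype V]

/-- parity vector of the two ends -/
noncomputable def pv (a b : V) : V → ZMod 2 := Pi.single a 1 + Pi.single b 1

lemma two_self (x : V → ZMod 2) : x + x = 0 := by
  ext v
  exact CharTwo.add_self_eq_zero (x v)

lemma pv_self (a : V) : pv a a = 0 := two_self _

lemma pv_trans (u a b : V) : pv u a + pv a b = pv u b := by
  have : pv u a + pv a b = pv u b + (Pi.single a 1 + Pi.single a 1) := by unfold pv; abel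
  rw [this, two_self, add_zero]

lemma pv_comm (a b : V) : pv a b = pv b a := add_comm _ _

lemma pv_sum (a b : V) : ∑ v, pv a b v = 0 := by
  unfold pv
  simp only [Pi.add_apply, Finset.sum_add_distrib]
  rw [Finset.sum_pi_single', Finset.sum_pi_single']
  simp only [Finset.mem_univ, if_true]
  decide

lemma tjoin {ι : Type} [DecidableEq ι] (F : Finset ι) (a b : ι → V)
    (hc : ∀ X : Set V, X.Nonempty → Xᶜ.Nonempty → ∃ p ∈ F, (a p ∈ X ∧ b p ∉ X) ∨ (a p ∉ X ∧ b p ∈ X))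
    (T : V → ZMod 2) (hT : ∑ v, T v = 0) [Inhabited V] :
    ∃ J ⊆ F, ∑ p ∈ J, pv (a p) (b p) = T := by
  obtain ⟨W, hW⟩ : ∃ W, W = Submodule.span (ZMod 2) ((fun p => pv (a p) (b p)) '' (F : Set ι)) := ⟨_, rfl⟩
  have hall : ∀ u w, pv u w ∈ W := by
    intro u
    by_contra hcon
    push Not at hcon
    obtain ⟨w, hw⟩ := hcon
    obtain ⟨p, hp, hpX⟩ := hc {w | pv u w ∈ W} ⟨u, by rw [Set.mem_ofPred_eq, pv_self]; exact W.zero_mem⟩ ⟨w, hw⟩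
    have hpW : pv (a p) (b p) ∈ W := by
      rw [hW]; exact Submodule.subset_span ⟨p, hp, rfl⟩
    simp only [Set.mem_ofPred_eq] at hpX
    rcases hpX with ⟨h1, h2⟩ | ⟨h1, h2⟩
    · apply h2
      rw [← pv_trans u (a p) (b p)]
      exact W.add_mem h1 hpW
    · apply h1
      rw [← pv_trans u (b p) (a p), pv_comm (b p)]
      exact W.add_mem h2 hpW
  have hTW : T ∈ W := by
    have : T = ∑ v, T v • pv default v := by
      ext w
      rw [Finset.sum_apply]
      unfold pv
      simp only [Pi.smul_apply, Pi.add_apply, smul_eq_mul, mul_add, Finset.sum_add_distrib]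
      rw [← Finset.sum_mul, hT, zero_mul, zero_add]
      rw [Finset.sum_eq_single w]
      · simp
      · intro v _ hv; rw [Pi.single_eq_of_ne (Ne.symm hv), mul_zero]
      · simp
    rw [this]
    exact Submodule.sum_mem _ (fun v _ => W.smul_mem _ (hall _ _))
  rw [hW, Submodule.mem_span_image_finset_iff_exists_fun] at hTW
  obtain ⟨c0, hcs⟩ := hTW
  obtain ⟨c, hc0⟩ : ∃ c : ι → ZMod 2, ∀ i : {p // p ∈ F}, c i.1 = c0 i :=
    ⟨fun p => if h : p ∈ F then c0 ⟨p, h⟩ else 0, fun i => by simp [i.2]⟩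
  have hcs' : ∑ p ∈ F, c p • pv (a p) (b p) = T := by
    rw [← Finset.sum_coe_sort, ← hcs]
    exact Finset.sum_congr rfl fun i _ => by rw [hc0]
  clear hcs
  rename' hcs' => hcs
  refine ⟨F.filter (fun p => c p ≠ 0), Finset.filter_subset _ _, ?_⟩
  rw [← hcs, Finset.sum_filter]
  refine Finset.sum_congr rfl fun p _ => ?_
  have h01 : ∀ z : ZMod 2, z = 0 ∨ z = 1 := by decide
  rcases h01 (c p) with h | h
  · simp [h]
  · simp [h]

/-- first vertex -/
noncomputable def hd [Inhabited V] (p : List V) : V := p.head?.getD default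
/-- last vertex -/
noncomputable def ls [Inhabited V] (p : List V) : V := p.getLast?.getD default

lemma hd_spec [Inhabited V] {p : List V} (h : 1 ≤ p.length) : p.head? = some (hd p) := by
  cases p with
  | nil => simp at h
  | cons a l => rfl

lemma ls_spec [Inhabited V] {p : List V} (h : 1 ≤ p.length) : p.getLast? = some (ls p) := by
  unfold ls
  cases hl : p.getLast? with
  | none => rw [List.getLast?_eq_none_iff] at hl; rw [hl] at h; simp at h
  | some x => rfl

lemma isEnd_iff [Inhabited V] {p : List V} (h : 1 ≤ p.length) (v : V) : isEnd v p ↔ hd p = v ∨ ls p = v := by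
  unfold isEnd
  rw [hd_spec h, ls_spec h, Option.some.injEq, Option.some.injEq]

lemma hd_ne_ls [Inhabited V] {p : List V} (hn : p.Nodup) (h : 2 ≤ p.length) : hd p ≠ ls p := by
  intro heq
  have h1 := hd_spec (p := p) (by omega)
  have h2 := ls_spec (p := p) (by omega)
  rw [← heq] at h2
  cases p with
  | nil => simp at h
  | cons a l =>
    have ha : a = hd (a :: l) := by simpa using h1
    cases l with
    | nil => simp at h
    | cons b l =>
      rw [List.getLast?_cons_cons] at h2
      have := List.mem_of_getLast? h2
      rw [← ha] at this
      exact (List.nodup_cons.1 hn).1 this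

theorem merge_fam [Inhabited V] (M : Finset (List V)) (h1 : ∀ p ∈ M, p.Nodup ∧ 6 ≤ p.length)
    (h2 : ∀ p ∈ M, ∀ q ∈ M, p ≠ q → Disjoint (ed p) (ed q))
    (hev : ∑ p ∈ M, pv (hd p) (ls p) = 0)
    (hden : ∀ v, ∀ p ∈ M, isEnd v p → 10 * (M.filter (fun q => isEnd v q ∧ ∃ x, x ≠ v ∧ x ∈ p ∧ x ∈ q)).card ≤ (M.filter (fun q => isEnd v q)).card)
    (hconn : ∀ X : Set V, X.Nonempty → Xᶜ.Nonempty → ∃ p ∈ M, sep X p)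
    (h5 : 5 ∣ (M.biUnion ed).card) : PD (M.biUnion ed) := by
  have hU : M.biUnion ed = Finset.univ.biUnion (fun i : {p // p ∈ M} => ed i.1) := by
    ext e
    simp
  obtain ⟨vert, hvt, hvf⟩ : ∃ vert : {p // p ∈ M} × Bool → V, (∀ i, vert (i, true) = hd i.1) ∧ (∀ i, vert (i, false) = ls i.1) :=
    ⟨fun d => if d.2 then hd d.1.1 else ls d.1.1, fun _ => rfl, fun _ => rfl⟩
  have hl : ∀ i : {p // p ∈ M}, 1 ≤ i.1.length := fun i => by have := (h1 i.1 i.2).2; omega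
  have hve : ∀ d, isEnd (vert d) d.1.1 := by
    rintro ⟨i, b⟩
    rw [isEnd_iff (hl i)]
    cases b
    · exact Or.inr (hvf i).symm
    · exact Or.inl (hvt i).symm
  have hinj : ∀ d d', vert d = vert d' → d.1 = d'.1 → d = d' := by
    rintro ⟨i, b⟩ ⟨i', b'⟩ hv hi
    simp only at hi
    subst hi
    have hne := hd_ne_ls (h1 i.1 i.2).1 (by have := (h1 i.1 i.2).2; omega)
    cases b <;> cases b'
    · rfl
    · rw [hvf, hvt] at hv; exact absurd hv.symm hne
    · rw [hvf, hvt] at hv; exact absurd hv hne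
    · rfl
  rw [hU] at h5 ⊢
  refine merging (fun i : {p // p ∈ M} => i.1) vert (fun i => h1 i.1 i.2) ?_ ?_ ?_ ?_ ?_ h5
  · rintro ⟨i, b⟩
    cases b
    · rw [hvf]
      show i.1.reverse.head? = _
      rw [List.head?_reverse]
      exact ls_spec (hl i)
    · rw [hvt]
      exact hd_spec (hl i)
  · intro i j hij
    exact h2 i.1 i.2 j.1 j.2 (fun h => hij (Subtype.ext h))
  · intro v
    rw [← ZMod.natCast_eq_zero_iff_even, Finset.card_filter, Fintype.sum_prod_type]
    simp only [Fintype.sum_bool, hvt, hvf]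
    have := congrFun hev v
    rw [Finset.sum_apply, ← Finset.sum_coe_sort] at this
    push_cast
    refine Eq.trans ?_ this
    refine Finset.sum_congr rfl fun i _ => ?_
    unfold pv
    rw [Pi.add_apply, Pi.single_apply, Pi.single_apply]
    simp only [eq_comm]
  · intro d
    refine le_trans (Nat.mul_le_mul_left 10 ?_) (le_trans (hden (vert d) d.1.1 d.1.2 (hve d)) ?_)
    · refine Finset.card_le_card_of_injOn (fun d' => d'.1.1) ?_ ?_
      · intro d' hd'
        obtain ⟨_, hv, hx⟩ := (@Finset.mem_filter _ _ (_) _ _).1 (Finset.mem_coe.1 hd')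
        refine Finset.mem_coe.2 (Finset.mem_filter.2 ⟨d'.1.2, ?_, hx⟩)
        rw [← hv]; exact hve d'
      · intro d' hd' d'' hd'' hh
        obtain ⟨_, hv, hx⟩ := (@Finset.mem_filter _ _ (_) _ _).1 (Finset.mem_coe.1 hd')
        obtain ⟨_, hv', hx'⟩ := (@Finset.mem_filter _ _ (_) _ _).1 (Finset.mem_coe.1 hd'')
        exact hinj d' d'' (hv.trans hv'.symm) (Subtype.ext hh)
    · refine Finset.card_le_card_of_surjOn (fun d' => d'.1.1) ?_
      intro q hq
      obtain ⟨hqM, hqe⟩ := Finset.mem_filter.1 (Finset.mem_coe.1 hq)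
      rw [isEnd_iff (hl ⟨q, hqM⟩)] at hqe
      rcases hqe with hqe | hqe
      · exact ⟨(⟨q, hqM⟩, true), Finset.mem_coe.2 (Finset.mem_filter.2 ⟨Finset.mem_univ _, by rw [hvt]; exact hqe⟩), rfl⟩
      · exact ⟨(⟨q, hqM⟩, false), Finset.mem_coe.2 (Finset.mem_filter.2 ⟨Finset.mem_univ _, by rw [hvf]; exact hqe⟩), rfl⟩
  · intro X hX1 hX2
    obtain ⟨p, hp, a, b, ha, hb, hab⟩ := hconn X hX1 hX2
    refine ⟨⟨p, hp⟩, ?_⟩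
    rw [hvt, hvf]
    rw [hd_spec (hl ⟨p, hp⟩), Option.some.injEq] at ha
    rw [ls_spec (hl ⟨p, hp⟩), Option.some.injEq] at hb
    subst ha hb
    simp only
    tauto

lemma PD_biUnion {ι : Type} [DecidableEq ι] (A : Finset ι) (f : ι → Finset (Sym2 V)) (h : ∀ i ∈ A, PD (f i))
    (hd : ∀ i ∈ A, ∀ j ∈ A, i ≠ j → Disjoint (f i) (f j)) : PD (A.biUnion f) := by
  induction A using Finset.induction_on with
  | empty => simpa using PD.nil
  | insert i s his ih =>
    rw [Finset.biUnion_insert]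
    refine PD.union (h i (Finset.mem_insert_self _ _)) (ih (fun j hj => h j (Finset.mem_insert_of_mem hj))
      (fun j hj k hk => hd j (Finset.mem_insert_of_mem hj) k (Finset.mem_insert_of_mem hk))) ?_
    rw [Finset.disjoint_biUnion_right]
    intro j hj
    refine hd i (Finset.mem_insert_self _ _) j (Finset.mem_insert_of_mem hj) ?_
    rintro rfl; exact his hj

lemma end_edge {v : V} {p : List V} (h : isEnd v p) (hl : 2 ≤ p.length) : ∃ e ∈ ed p, v ∈ e := by
  have key : ∀ q : List V, q.head? = some v → 2 ≤ q.length → ∃ e ∈ ed q, v ∈ e := by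
    intro q hq hl
    match q, hl with
    | a :: b :: l, _ =>
      have ha : a = v := by simpa using hq
      exact ⟨s(a, b), by rw [ed_cons_cons]; exact Finset.mem_insert_self _ _, by rw [ha]; exact Sym2.mem_mk_left _ _⟩
  rcases h with h | h
  · exact key p h hl
  · rw [← ed_reverse]
    exact key p.reverse (by rw [List.head?_reverse]; exact h) (by simpa using hl)

lemma count_ends (Q : Finset (List V)) (A : Finset (Sym2 V)) (h : ∀ p ∈ Q, 2 ≤ p.length ∧ ed p ⊆ A)
    (hd : ∀ p ∈ Q, ∀ q ∈ Q, p ≠ q → Disjoint (ed p) (ed q)) (v : V) :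
    (Q.filter (fun p => isEnd v p)).card ≤ dg A v := by
  have : ∀ p, ∃ e : Sym2 V, p ∈ Q.filter (fun p => isEnd v p) → e ∈ ed p ∧ v ∈ e := by
    intro p
    by_cases hp : p ∈ Q.filter (fun p => isEnd v p)
    · obtain ⟨h1, h2⟩ := Finset.mem_filter.1 hp
      obtain ⟨e, he⟩ := end_edge h2 (h p h1).1
      exact ⟨e, fun _ => he⟩
    · exact ⟨s(v, v), fun h => absurd h hp⟩
  choose f hf using this
  refine Finset.card_le_card_of_injOn f ?_ ?_
  · intro p hp
    have hp := Finset.mem_coe.1 hp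
    exact Finset.mem_coe.2 (Finset.mem_filter.2 ⟨(h p (Finset.mem_filter.1 hp).1).2 (hf p hp).1, (hf p hp).2⟩)
  · intro p hp q hq hpq
    by_contra hne
    have hp := Finset.mem_coe.1 hp
    have hq := Finset.mem_coe.1 hq
    have := hd p (Finset.mem_filter.1 hp).1 q (Finset.mem_filter.1 hq).1 hne
    exact Finset.disjoint_left.1 this (hf p hp).1 (hpq ▸ (hf q hq).1)

end
end P5

namespace P5
open scoped Classical
set_option linter.unusedSectionVars false
section
variable {V : Type} [Fintype V] {E : Finset (Sym2 V)} {c1 : ℕ}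

lemma ed_cons_head {a b : V} {h : List V} (hb : isHead b h) : ed (a :: h) = insert s(a, b) (ed h) := by
  unfold isHead at hb
  cases h with
  | nil => simp at hb
  | cons x l =>
    have hx : x = b := by simpa using hb
    rw [ed_cons_cons, hx]

lemma sub_bi {A : Finset (List V)} {p : List V} (hp : p ∈ A) : ed p ⊆ A.biUnion ed :=
  fun _ he => Finset.mem_biUnion.2 ⟨p, hp, he⟩

lemma disj_bi {A B C : Finset (List V)} (hC : ∀ p ∈ C, ∀ q ∈ C, p ≠ q → Disjoint (ed p) (ed q))
    (hA : A ⊆ C) (hB : B ⊆ C) (hd : Disjoint A B) : Disjoint (A.biUnion ed) (B.biUnion ed) := by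
  rw [Finset.disjoint_biUnion_left]
  intro p hp
  rw [Finset.disjoint_biUnion_right]
  intro q hq
  refine hC p (hA hp) q (hB hq) ?_
  rintro rfl
  exact Finset.disjoint_left.1 hd hp hq

/-- the orphan step: every leftover edge gets a private path -/
lemma orphans (St : Setup V E c1) (used : Finset (List V))
    (hu : ∀ v, (used.filter (fun p => isHead v p)).card ≤ St.gs v)
    (R : Finset (Sym2 V)) (hR : R ⊆ E) (o : Sym2 V → V) (ho : ∀ e ∈ R, o e ∈ e)
    (ho4 : ∀ v, (R.filter (fun e => o e = v)).card ≤ 4) :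
    ∃ (x : Sym2 V → V) (f : Sym2 V → List V), Set.InjOn f R ∧ ∀ e ∈ R, f e ∈ St.S ∧ f e ∉ used ∧ x e ∉ f e ∧
      ed (x e :: f e) = insert e (ed (f e)) := by
  have : ∀ e, ∃ x, e ∈ R → e = s(o e, x) := by
    intro e
    by_cases he : e ∈ R
    · obtain ⟨y, hy⟩ := ho e he
      exact ⟨y, fun _ => hy⟩
    · exact ⟨o e, fun h => absurd h he⟩
  choose x hx using this
  have hxo : ∀ e ∈ R, x e ≠ o e := by
    intro e he hh
    refine St.nl e (hR he) ?_
    rw [hx e he, hh]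
    exact Sym2.mk_isDiag_iff.2 rfl
  obtain ⟨f, hf1, hf2⟩ := inj_choice (I := Sym2 V) (V := V) (α := List V) o isHead
    (fun e => (St.S.filter (fun p => isHead (o e) p)).filter (fun p => p ∉ used ∧ x e ∉ p))
    (fun v w x => isHead_uniq) R
    (fun i _ x hx => (Finset.mem_filter.1 (Finset.mem_filter.1 hx).1).2) (by
      intro e he
      refine le_trans (ho4 (o e)) ?_
      have hb := St.S3 (o e)
      have hg := St.gs1 (o e)
      have k1 : ((St.S.filter (fun p => isHead (o e) p)).filter (fun p => x e ∈ p)).card ≤ c1 * St.gs (o e) := by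
        refine le_trans (Finset.card_le_card ?_) (St.S4 (o e) (x e) (hxo e he))
        intro p hp
        rw [Finset.mem_filter, Finset.mem_filter] at hp
        exact Finset.mem_filter.2 ⟨hp.1.1, Or.inl hp.1.2, hp.2⟩
      have k2 := hu (o e)
      have hsub : St.S.filter (fun p => isHead (o e) p) ⊆
          ((St.S.filter (fun p => isHead (o e) p)).filter (fun p => p ∉ used ∧ x e ∉ p)) ∪
          (((St.S.filter (fun p => isHead (o e) p)).filter (fun p => x e ∈ p)) ∪
          (used.filter (fun p => isHead (o e) p))) := by
        intro p hp
        simp only [Finset.mem_union]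
        by_cases ha : x e ∈ p
        · exact Or.inr (Or.inl (Finset.mem_filter.2 ⟨hp, ha⟩))
        by_cases ha' : p ∈ used
        · exact Or.inr (Or.inr (Finset.mem_filter.2 ⟨ha', (Finset.mem_filter.1 hp).2⟩))
        · exact Or.inl (Finset.mem_filter.2 ⟨hp, ha', ha⟩)
      have hc := (Finset.card_le_card hsub).trans ((Finset.card_union_le _ _).trans
        (Nat.add_le_add_left (Finset.card_union_le _ _) _))
      have : (2 * c1 + 6) * St.gs (o e) = c1 * St.gs (o e) + c1 * St.gs (o e) + 6 * St.gs (o e) := by ring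
      have hg : 4 ≤ ((St.S.filter (fun p => isHead (o e) p)).filter (fun p => p ∉ used ∧ x e ∉ p)).card := by omega
      exact hg)
  refine ⟨x, f, hf2, fun e he => ?_⟩
  have := hf1 e he
  rw [Finset.mem_filter, Finset.mem_filter] at this
  refine ⟨this.1.1, this.2.1, this.2.2, ?_⟩
  rw [ed_cons_head this.1.2, Sym2.eq_swap, ← hx e he]

lemma hden_aux (St : Setup V E c1) (M : Finset (List V)) (hH : St.H ⊆ M)
    (hM : ∀ p ∈ M, 2 ≤ p.length ∧ p.length ≤ 16) (hM2 : ∀ p ∈ M, ∀ q ∈ M, p ≠ q → Disjoint (ed p) (ed q))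
    (hMT : ∀ p ∈ M, p ∉ St.H → ed p ⊆ Finset.univ.biUnion St.T ∪ St.Es) (v : V) (p : List V) (hp : p ∈ M) (hpv : isEnd v p) :
    10 * (M.filter (fun q => isEnd v q ∧ ∃ x, x ≠ v ∧ x ∈ p ∧ x ∈ q)).card ≤ (M.filter (fun q => isEnd v q)).card := by
  have hvp : v ∈ p := by
    rcases hpv with h | h
    · exact List.mem_of_head? h
    · exact List.mem_of_getLast? h
  have hcount := (count_ends (M \ St.H) (Finset.univ.biUnion St.T ∪ St.Es)
    (fun q hq => ⟨(hM q (Finset.mem_sdiff.1 hq).1).1, hMT q (Finset.mem_sdiff.1 hq).1 (Finset.mem_sdiff.1 hq).2⟩)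
    (fun q hq q' hq' => hM2 q (Finset.mem_sdiff.1 hq).1 q' (Finset.mem_sdiff.1 hq').1) v).trans (St.gTs v)
  have hbig : (10 * (15 * c1 + 2)) * St.gH v ≤ (M.filter (fun q => isEnd v q)).card := by
    refine (St.H3 v).trans (Finset.card_le_card ?_)
    intro q hq
    obtain ⟨h1, h2⟩ := Finset.mem_filter.1 hq
    exact Finset.mem_filter.2 ⟨hH h1, Or.inl h2⟩
  have hX : (p.toFinset.erase v).card ≤ 15 := by
    rw [Finset.card_erase_of_mem (List.mem_toFinset.2 hvp)]
    have := List.toFinset_card_le p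
    have := (hM p hp).2
    omega
  have hHc : ((p.toFinset.erase v).biUnion (fun x => St.H.filter (fun q => isEnd v q ∧ x ∈ q))).card ≤ 15 * (c1 * St.gH v) := by
    refine le_trans (Finset.card_biUnion_le_card_mul _ _ (c1 * St.gH v) ?_) (Nat.mul_le_mul_right _ hX)
    intro x hx
    exact St.H4 v x (Finset.ne_of_mem_erase hx)
  have hsub : M.filter (fun q => isEnd v q ∧ ∃ x, x ≠ v ∧ x ∈ p ∧ x ∈ q) ⊆
      ((p.toFinset.erase v).biUnion (fun x => St.H.filter (fun q => isEnd v q ∧ x ∈ q))) ∪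
      ((M \ St.H).filter (fun q => isEnd v q)) := by
    intro q hq
    obtain ⟨h1, h2, x, hxv, hxp, hxq⟩ := Finset.mem_filter.1 hq
    rw [Finset.mem_union]
    by_cases hqH : q ∈ St.H
    · exact Or.inl (Finset.mem_biUnion.2 ⟨x, Finset.mem_erase.2 ⟨hxv, List.mem_toFinset.2 hxp⟩, Finset.mem_filter.2 ⟨hqH, h2, hxq⟩⟩)
    · exact Or.inr (Finset.mem_filter.2 ⟨Finset.mem_sdiff.2 ⟨h1, hqH⟩, h2⟩)
  have hc := (Finset.card_le_card hsub).trans (Finset.card_union_le _ _)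
  have : (10 * (15 * c1 + 2)) * St.gH v = 10 * (15 * (c1 * St.gH v) + 2 * St.gH v) := by ring
  omega

theorem final (St : Setup V E c1) [Inhabited V] (h5 : 5 ∣ E.card) : PD E := by
  obtain ⟨used, F1, F2, hus, huc, hF, hFd, hF12, hc1, hc2⟩ := famF St
  obtain ⟨T0, hT0⟩ : ∃ T0, T0 = (F1 ∪ F2).image List.tail := ⟨_, rfl⟩
  obtain ⟨B, hB⟩ : ∃ B, B = St.H ∪ (St.S \ T0) ∪ (F1 ∪ F2) := ⟨_, rfl⟩
  have hBm : ∀ p, p ∈ B ↔ (p ∈ St.H ∨ (p ∈ St.S ∧ p ∉ T0)) ∨ p ∈ F1 ∪ F2 := by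
    intro p; rw [hB, Finset.mem_union, Finset.mem_union, Finset.mem_sdiff]
  have hT0u : T0 ⊆ used := by
    rw [hT0]
    intro p hp
    obtain ⟨q, hq, rfl⟩ := Finset.mem_image.1 hp
    obtain ⟨a, h, b, j, rfl, hh, -⟩ := hF q hq
    exact hh
  -- structure of lists in F1 ∪ F2
  have hFs : ∀ p ∈ F1 ∪ F2, p.Nodup ∧ p.length = 16 ∧ ∃ e j, e ∈ St.T j ∧ p.tail ∈ St.S ∧ p.tail ∈ T0 ∧ ed p = insert e (ed p.tail) := by
    intro p hp
    have ht : p.tail ∈ T0 := by rw [hT0]; exact Finset.mem_image_of_mem _ hp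
    obtain ⟨a, h, b, j, rfl, hh, ha, hb, he⟩ := hF p hp
    have hS := St.S1 h (hus hh)
    exact ⟨List.nodup_cons.2 ⟨ha, hS.1⟩, by simp [hS.2.1], s(a, b), j, he, hus hh, ht, ed_cons_head hb⟩
  have hB1 : ∀ p ∈ B, p.Nodup ∧ 15 ≤ p.length ∧ p.length ≤ 16 ∧ ed p ⊆ E := by
    intro p hp
    rcases (hBm p).1 hp with (h | ⟨h, -⟩) | h
    · have := St.H1 p h
      exact ⟨this.1, by omega, by omega, this.2.2.trans St.hHE⟩
    · have := St.S1 p h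
      exact ⟨this.1, by omega, by omega, this.2.2.trans St.hsE⟩
    · obtain ⟨h1, h2, e, j, he, h3, -, h4⟩ := hFs p h
      refine ⟨h1, by omega, by omega, ?_⟩
      rw [h4, Finset.insert_subset_iff]
      exact ⟨St.hTE j he, (St.S1 _ h3).2.2.trans St.hsE⟩
  have hBT : ∀ p ∈ B, p ∉ St.H → ed p ⊆ Finset.univ.biUnion St.T ∪ St.Es := by
    intro p hp hpH
    rcases (hBm p).1 hp with (h | ⟨h, -⟩) | h
    · exact absurd h hpH
    · exact (St.S1 p h).2.2.trans Finset.subset_union_right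
    · obtain ⟨h1, h2, e, j, he, h3, -, h4⟩ := hFs p h
      rw [h4, Finset.insert_subset_iff]
      exact ⟨Finset.mem_union_left _ (Finset.mem_biUnion.2 ⟨j, Finset.mem_univ _, he⟩),
        (St.S1 _ h3).2.2.trans Finset.subset_union_right⟩
  have hTsH : Disjoint (Finset.univ.biUnion St.T ∪ St.Es) St.EH := by
    rw [Finset.disjoint_union_left, Finset.disjoint_biUnion_left]
    exact ⟨fun j _ => St.dTH j, St.dsH⟩
  have dSF : ∀ p ∈ St.S, p ∉ T0 → ∀ q ∈ F1 ∪ F2, Disjoint (ed p) (ed q) := by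
    intro p hp hpT q hq
    obtain ⟨h1, h2, e, j, he, h3, h3', h4⟩ := hFs q hq
    rw [h4, Finset.disjoint_insert_right]
    refine ⟨fun hep => Finset.disjoint_left.1 (St.dTs j) he ((St.S1 p hp).2.2 hep), St.S2 p hp _ h3 ?_⟩
    intro heq
    exact hpT (heq ▸ h3')
  have hB2 : ∀ p ∈ B, ∀ q ∈ B, p ≠ q → Disjoint (ed p) (ed q) := by
    intro p hp q hq hpq
    by_cases hpH : p ∈ St.H
    · by_cases hqH : q ∈ St.H
      · exact St.H2 p hpH q hqH hpq
      · exact (Disjoint.mono (hBT q hq hqH) (St.H1 p hpH).2.2 hTsH).symm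
    by_cases hqH : q ∈ St.H
    · exact Disjoint.mono (hBT p hp hpH) (St.H1 q hqH).2.2 hTsH
    rcases (hBm p).1 hp with (h | ⟨h, hT⟩) | h
    · exact absurd h hpH
    · rcases (hBm q).1 hq with (h' | ⟨h', hT'⟩) | h'
      · exact absurd h' hqH
      · exact St.S2 p h q h' hpq
      · exact dSF p h hT q h'
    · rcases (hBm q).1 hq with (h' | ⟨h', hT'⟩) | h'
      · exact absurd h' hqH
      · exact (dSF q h' hT' p h).symm
      · exact hFd p h q h' hpq
  have hBE : B.biUnion ed ⊆ E := Finset.biUnion_subset.2 (fun p hp => (hB1 p hp).2.2.2)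
  -- pack the rest
  obtain ⟨R, o, hRP, hPR, hoR, ho4⟩ := packing _ (E \ B.biUnion ed) le_rfl (fun e he => St.nl e (Finset.mem_sdiff.1 he).1)
  have hRE : R ⊆ E := hRP.trans Finset.sdiff_subset
  have hRB : ∀ e ∈ R, e ∉ B.biUnion ed := fun e he => (Finset.mem_sdiff.1 (hRP he)).2
  obtain ⟨x, f, hfi, hf⟩ := orphans St used huc R hRE o hoR ho4
  obtain ⟨W, hW⟩ : ∃ W, W = R.image f := ⟨_, rfl⟩
  have hfB : ∀ e ∈ R, f e ∈ B := by
    intro e he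
    obtain ⟨h1, h2, -⟩ := hf e he
    exact (hBm _).2 (Or.inl (Or.inr ⟨h1, fun h => h2 (hT0u h)⟩))
  have hWs : ∀ p ∈ W, p ∈ St.S ∧ p ∈ B := by
    intro p hp
    rw [hW] at hp
    obtain ⟨e, he, rfl⟩ := Finset.mem_image.1 hp
    exact ⟨(hf e he).1, hfB e he⟩
  have hWF : ∀ p ∈ F1 ∪ F2, p ∉ W := by
    intro p hp hpW
    have h1 := (hFs p hp).2.1
    have h2 := (St.S1 p (hWs p hpW).1).2.1
    omega
  have hFH : ∀ p ∈ F1 ∪ F2, p ∉ St.H := by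
    intro p hp hpW
    have h1 := (hFs p hp).2.1
    have h2 := (St.H1 p hpW).2.1
    omega
  have hHW : ∀ p ∈ St.H, p ∉ W := by
    intro p hp hpW
    have hS := St.S1 p (hWs p hpW).1
    have hH := St.H1 p hp
    have hd : Disjoint (ed p) (ed p) := Disjoint.mono hS.2.2 hH.2.2 St.dsH
    have := ed_card hS.1
    rw [disjoint_self] at hd
    rw [hd] at this
    simp at this
    omega
  -- T-join
  obtain ⟨J, hJ, hJs⟩ := tjoin F2 hd ls (by
    intro X hX1 hX2
    obtain ⟨p, hp, a, b, ha, hb, hab⟩ := hc2 X hX1 hX2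
    have hl := (hFs p (Finset.mem_union_right _ hp)).2.1
    rw [hd_spec (by omega), Option.some.injEq] at ha
    rw [ls_spec (by omega), Option.some.injEq] at hb
    subst ha hb
    exact ⟨p, hp, hab⟩) (∑ p ∈ B \ W, pv (hd p) (ls p)) (by
    simp only [Finset.sum_apply]
    rw [Finset.sum_comm]
    exact Finset.sum_eq_zero fun p _ => pv_sum _ _)
  have hJF : J ⊆ F1 ∪ F2 := hJ.trans Finset.subset_union_right
  have hJB : J ⊆ B := fun p hp => (hBm p).2 (Or.inr (hJF hp))
  have hJBW : J ⊆ B \ W := fun p hp => Finset.mem_sdiff.2 ⟨hJB hp, hWF p (hJF hp)⟩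
  obtain ⟨M, hM⟩ : ∃ M, M = (B \ W) \ J := ⟨_, rfl⟩
  have hMB : M ⊆ B := by rw [hM]; exact Finset.sdiff_subset.trans Finset.sdiff_subset
  have hMW : Disjoint M W := by
    rw [Finset.disjoint_left]; intro p hp hp'
    rw [hM] at hp
    exact (Finset.mem_sdiff.1 (Finset.mem_sdiff.1 hp).1).2 hp'
  have hMJ : Disjoint M J := by
    rw [hM]; exact Finset.sdiff_disjoint
  have hWB : W ⊆ B := fun p hp => (hWs p hp).2
  have hJW : Disjoint J W := by
    rw [Finset.disjoint_left]; intro p hp hp'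
    exact hWF p (hJF hp) hp'
  -- the orphan paths
  have hOe : ∀ e ∈ R, ed (x e :: f e) = insert e (ed (f e)) := fun e he => (hf e he).2.2.2
  have hO : PD (R.biUnion (fun e => ed (x e :: f e))) := by
    refine PD_biUnion _ _ ?_ ?_
    · intro e he
      have hS := St.S1 _ (hf e he).1
      refine PD_of_path (List.nodup_cons.2 ⟨(hf e he).2.2.1, hS.1⟩) ?_
      simp [hS.2.1]
    · intro e he e' he' hne
      rw [hOe e he, hOe e' he', Finset.disjoint_insert_left, Finset.disjoint_insert_right, Finset.mem_insert]
      refine ⟨?_, ?_, ?_⟩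
      · rintro (h | h)
        · exact hne h
        · exact hRB e he (sub_bi (hfB e' he') h)
      · exact fun h => hRB e' he' (sub_bi (hfB e he) h)
      · exact hB2 _ (hfB e he) _ (hfB e' he') (fun h => hne (hfi he he' h))
  have hOm : R.biUnion (fun e => ed (x e :: f e)) = R ∪ W.biUnion ed := by
    ext e
    rw [Finset.mem_biUnion, Finset.mem_union, Finset.mem_biUnion]
    constructor
    · rintro ⟨e', he', h⟩
      rw [hOe e' he', Finset.mem_insert] at h
      rcases h with rfl | h
      · exact Or.inl he'
      · exact Or.inr ⟨f e', by rw [hW]; exact Finset.mem_image_of_mem _ he', h⟩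
    · rintro (h | ⟨p, hp, h⟩)
      · exact ⟨e, h, by rw [hOe e h]; exact Finset.mem_insert_self _ _⟩
      · rw [hW] at hp
        obtain ⟨e', he', rfl⟩ := Finset.mem_image.1 hp
        exact ⟨e', he', by rw [hOe e' he']; exact Finset.mem_insert_of_mem h⟩
  have hJP : PD (J.biUnion ed) := by
    refine PD_biUnion _ _ ?_ ?_
    · intro p hp
      have := hFs p (hJF hp)
      exact PD_of_path this.1 (by rw [this.2.1]; norm_num)
    · intro p hp q hq
      exact hB2 p (hJB hp) q (hJB hq)
  have dWJ := disj_bi hB2 hWB hJB hJW.symm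
  have dWM := disj_bi hB2 hWB hMB hMW.symm
  have dJM := disj_bi hB2 hJB hMB hMJ.symm
  have hBsplit : B.biUnion ed = W.biUnion ed ∪ (J.biUnion ed ∪ M.biUnion ed) := by
    rw [← Finset.union_biUnion, ← Finset.union_biUnion]
    congr 1
    ext p
    have a1 : p ∈ W → p ∈ B := fun h => hWB h
    have a2 : p ∈ J → p ∈ B := fun h => hJB h
    rw [hM]
    simp only [Finset.mem_union, Finset.mem_sdiff]
    tauto
  obtain ⟨bW, hbW⟩ : ∃ b, b = W.biUnion ed := ⟨_, rfl⟩
  obtain ⟨bJ, hbJ⟩ : ∃ b, b = J.biUnion ed := ⟨_, rfl⟩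
  obtain ⟨bM, hbM⟩ : ∃ b, b = M.biUnion ed := ⟨_, rfl⟩
  obtain ⟨bB, hbB⟩ : ∃ b, b = B.biUnion ed := ⟨_, rfl⟩
  rw [hOm] at hO
  rw [← hbW] at hO hBsplit dWJ dWM
  rw [← hbJ] at hJP hBsplit dWJ dJM
  rw [← hbM] at hBsplit dWM dJM
  rw [← hbB] at hBsplit hRB hPR hRP hBE
  have hZ : PD (((E \ bB) \ R) ∪ ((R ∪ bW) ∪ bJ)) := by
    refine PD.union hPR (PD.union hO hJP ?_) ?_
    · rw [Finset.disjoint_left]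
      intro e he he'
      rcases Finset.mem_union.1 he with h | h
      · exact hRB e h (by rw [hBsplit]; simp [he'])
      · exact Finset.disjoint_left.1 dWJ h he'
    · rw [Finset.disjoint_left]
      intro e he he'
      rw [Finset.mem_sdiff, Finset.mem_sdiff, hBsplit] at he
      simp only [Finset.mem_union] at he he'
      tauto
  have hZM : Disjoint (((E \ bB) \ R) ∪ ((R ∪ bW) ∪ bJ)) bM := by
    rw [Finset.disjoint_left]
    intro e he he'
    have hb : e ∈ bB := by rw [hBsplit]; simp [he']
    simp only [Finset.mem_union, Finset.mem_sdiff] at he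
    rcases he with h | (h | h) | h
    · exact h.1.2 hb
    · exact hRB e h hb
    · exact Finset.disjoint_left.1 dWM h he'
    · exact Finset.disjoint_left.1 dJM h he'
  have hEeq : E = (((E \ bB) \ R) ∪ ((R ∪ bW) ∪ bJ)) ∪ bM := by
    ext e
    have a1 : e ∈ bB → e ∈ E := fun h => hBE h
    have a2 : e ∈ R → e ∈ E := fun h => hRE h
    have a3 : e ∈ bB ↔ e ∈ bW ∨ e ∈ bJ ∨ e ∈ bM := by
      rw [hBsplit]; simp only [Finset.mem_union]
    simp only [Finset.mem_union, Finset.mem_sdiff]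
    tauto
  have h5M : 5 ∣ bM.card := by
    have := Finset.card_union_of_disjoint hZM
    rw [← hEeq] at this
    have hz := hZ.card
    rw [this] at h5
    exact (Nat.dvd_add_right hz).1 h5
  have hHM : St.H ⊆ M := by
    intro p hp
    rw [hM, Finset.mem_sdiff, Finset.mem_sdiff]
    exact ⟨⟨(hBm p).2 (Or.inl (Or.inl hp)), hHW p hp⟩, fun h => hFH p (hJF h) hp⟩
  have hMPD : PD bM := by
    rw [hbM] at h5M ⊢
    refine merge_fam M ?_ ?_ ?_ ?_ ?_ h5M
    · intro p hp
      have := hB1 p (hMB hp)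
      exact ⟨this.1, by omega⟩
    · exact fun p hp q hq => hB2 p (hMB hp) q (hMB hq)
    · have := Finset.sum_sdiff (f := fun p => pv (hd p) (ls p)) hJBW
      rw [hJs, ← hM] at this
      exact left_eq_add.1 (by rw [add_comm]; exact this.symm)
    · intro v p hp hpv
      refine hden_aux St M hHM ?_ ?_ ?_ v p hp hpv
      · intro q hq
        have := hB1 q (hMB hq)
        exact ⟨by omega, this.2.2.1⟩
      · exact fun p hp q hq => hB2 p (hMB hp) q (hMB hq)
      · exact fun q hq => hBT q (hMB hq)
    · intro X hX1 hX2
      obtain ⟨p, hp, hs⟩ := hc1 X hX1 hX2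
      refine ⟨p, ?_, hs⟩
      have hpF : p ∈ F1 ∪ F2 := Finset.mem_union_left _ hp
      rw [hM, Finset.mem_sdiff, Finset.mem_sdiff]
      exact ⟨⟨(hBm p).2 (Or.inr hpF), hWF p hpF⟩, fun h => Finset.disjoint_left.1 hF12 hp (hJ h)⟩
  rw [hEeq]
  exact PD.union hZ hMPD hZM

end
end P5

namespace P5
open scoped Classical
set_option linter.unusedSectionVars false
section
variable {V : Type}

lemma mem_ed_iff : ∀ (l : List V) (e : Sym2 V), e ∈ ed l ↔ ∃ i, ∃ h : i + 1 < l.length, e = s(l[i], l[i+1])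
  | [], e => by simp
  | [a], e => by simp
  | a :: b :: l, e => by
    rw [ed_cons_cons, Finset.mem_insert, mem_ed_iff (b :: l) e]
    constructor
    · rintro (h | ⟨i, hi, h⟩)
      · exact ⟨0, by simp, h⟩
      · exact ⟨i + 1, by simpa using hi, by simpa using h⟩
    · rintro ⟨i, hi, h⟩
      cases i with
      | zero => exact Or.inl h
      | succ i => exact Or.inr ⟨i, by simpa using hi, by simpa using h⟩

lemma PD.lists {E : Finset (Sym2 V)} (h : PD E) : ∃ L : Set (List V), (∀ l ∈ L, l.Nodup ∧ l.length = 6) ∧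
    (∀ l ∈ L, ∀ m ∈ L, l ≠ m → Disjoint (ed l) (ed m)) ∧ ∀ e, e ∈ E ↔ ∃ l ∈ L, e ∈ ed l := by
  induction h with
  | nil => exact ⟨∅, by simp, by simp, by simp⟩
  | @cons l E hn h6 hd _ ih =>
    obtain ⟨L, h1, h2, h3⟩ := ih
    have hdl : ∀ m ∈ L, Disjoint (ed l) (ed m) := fun m hm =>
      Finset.disjoint_of_subset_right (fun e he => (h3 e).2 ⟨m, hm, he⟩) hd
    refine ⟨insert l L, ?_, ?_, ?_⟩
    · rintro m (rfl | hm)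
      · exact ⟨hn, h6⟩
      · exact h1 m hm
    · rintro m (rfl | hm) m' (rfl | hm') hne
      · exact absurd rfl hne
      · exact hdl m' hm'
      · exact (hdl m hm).symm
      · exact h2 m hm m' hm' hne
    · intro e
      rw [Finset.mem_union, h3]
      constructor
      · rintro (h | ⟨m, hm, h⟩)
        · exact ⟨l, Or.inl rfl, h⟩
        · exact ⟨m, Or.inr hm, h⟩
      · rintro ⟨m, rfl | hm, h⟩
        · exact Or.inl h
        · exact Or.inr ⟨m, hm, h⟩

lemma iso_path {G : SimpleGraph V} (H : G.Subgraph) (l : List V) (hn : l.Nodup) (h6 : l.length = 6)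
    (hv : ∀ v, v ∈ H.verts ↔ v ∈ l) (ha : ∀ a b, H.Adj a b ↔ s(a, b) ∈ ed l) : Nonempty (H.coe ≃g pathGraph 6) := by
  let f : Fin 6 → H.verts := fun i => ⟨l[i.1]'(by have := i.2; omega), (hv _).2 (List.getElem_mem _)⟩
  have hf : Function.Bijective f := by
    constructor
    · intro i j hij
      have : l[i.1]'(by have := i.2; omega) = l[j.1]'(by have := j.2; omega) := congrArg Subtype.val hij
      exact Fin.ext ((List.Nodup.getElem_inj_iff hn).1 this)
    · rintro ⟨v, hvv⟩
      obtain ⟨i, hi, h⟩ := List.getElem_of_mem ((hv v).1 hvv)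
      exact ⟨⟨i, by omega⟩, Subtype.ext h⟩
  refine ⟨Iso.symm ⟨Equiv.ofBijective f hf, ?_⟩⟩
  intro i j
  have hi := i.2
  have hj := j.2
  show H.Adj (l[i.1]'(by omega)) (l[j.1]'(by omega)) ↔ _
  rw [ha, mem_ed_iff, pathGraph_adj]
  constructor
  · rintro ⟨k, hk, h⟩
    rw [Sym2.eq_iff, List.Nodup.getElem_inj_iff hn, List.Nodup.getElem_inj_iff hn,
      List.Nodup.getElem_inj_iff hn, List.Nodup.getElem_inj_iff hn] at h
    omega
  · rintro (h | h)
    · refine ⟨i.1, by omega, ?_⟩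
      simp only [h]
    · refine ⟨j.1, by omega, ?_⟩
      simp only [h]
      exact Sym2.eq_swap

lemma decomp_of_PD [Fintype V] (G : SimpleGraph V) (h : PD (gE G)) : ∃ D : Set G.Subgraph, IsDecompInto G (pathGraph 6) D := by
  obtain ⟨L, h1, h2, h3⟩ := h.lists
  have hG : ∀ l ∈ L, ∀ e ∈ ed l, e ∈ G.edgeSet := fun l hl e he => (mem_gE G e).1 ((h3 e).2 ⟨l, hl, he⟩)
  obtain ⟨D, hD⟩ : ∃ D : Set G.Subgraph, ∀ H, H ∈ D ↔ ∃ l ∈ L, (∀ v, v ∈ H.verts ↔ v ∈ l) ∧ ∀ a b, H.Adj a b ↔ s(a, b) ∈ ed l :=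
    ⟨{H | ∃ l ∈ L, (∀ v, v ∈ H.verts ↔ v ∈ l) ∧ ∀ a b, H.Adj a b ↔ s(a, b) ∈ ed l}, fun _ => Iff.rfl⟩
  have hes : ∀ (H : G.Subgraph) (l : List V), (∀ a b, H.Adj a b ↔ s(a, b) ∈ ed l) → ∀ e, e ∈ H.edgeSet ↔ e ∈ ed l := by
    intro H l ha e
    induction e using Sym2.ind with
    | _ a b => rw [Subgraph.mem_edgeSet, ha]
  refine ⟨D, ?_, ?_, ?_⟩
  · intro H hH
    obtain ⟨l, hl, hv, ha⟩ := (hD H).1 hH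
    exact iso_path H l (h1 l hl).1 (h1 l hl).2 hv ha
  · intro H hH K hK hne
    obtain ⟨l, hl, hv, ha⟩ := (hD H).1 hH
    obtain ⟨m, hm, hv', ha'⟩ := (hD K).1 hK
    have hlm : l ≠ m := by
      rintro rfl
      apply hne
      refine SimpleGraph.Subgraph.ext ?_ ?_
      · ext v; rw [hv, hv']
      · funext a b; exact propext ((ha a b).trans (ha' a b).symm)
    rw [Set.disjoint_left]
    intro e he he'
    exact Finset.disjoint_left.1 (h2 l hl m hm hlm) ((hes H l ha e).1 he) ((hes K m ha' e).1 he')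
  · ext e
    rw [Set.mem_iUnion₂]
    constructor
    · rintro ⟨H, _, he⟩
      exact H.edgeSet_subset he
    · intro he
      obtain ⟨l, hl, hel⟩ := (h3 e).1 ((mem_gE G e).2 he)
      let H : G.Subgraph :=
        { verts := {v | v ∈ l}
          Adj := fun a b => s(a, b) ∈ ed l
          adj_sub := fun {a b} h => hG l hl _ h
          edge_vert := fun {a b} h => mem_of_ed h (Sym2.mem_mk_left _ _)
          symm := ⟨fun a b h => by rw [Sym2.eq_swap]; exact h⟩ }
      exact ⟨H, (hD H).2 ⟨l, hl, fun _ => Iff.rfl, fun _ _ => Iff.rfl⟩, (hes H l (fun _ _ => Iff.rfl) e).2 hel⟩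
end
end P5

/-- There exists a natural number `k` such that every `k`-edge-connected finite simple
graph whose number of edges is divisible by `5` admits a decomposition into paths of
length `5`. -/
theorem exists_p5_decomposition_of_edge_connected :
    ∃ k : ℕ, ∀ (V : Type) [Fintype V] (G : SimpleGraph V),
      IsKEdgeConnected G k → 5 ∣ G.edgeSet.ncard →
      ∃ D : Set G.Subgraph, IsDecompInto G (pathGraph 6) D := by
  obtain ⟨c1, K, hK⟩ := P5.exists_setup
  refine ⟨K, ?_⟩
  intro V _ G hG h5
  rcases subsingleton_or_nontrivial V with hs | hnt
  · refine ⟨∅, by simp, by simp, ?_⟩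
    have : G.edgeSet = ∅ := by
      ext e
      induction e using Sym2.ind with
      | _ a b =>
        rw [SimpleGraph.mem_edgeSet]
        simp only [Set.mem_empty_iff_false, iff_false]
        exact fun h => h.ne (Subsingleton.elim a b)
    rw [this]; simp
  · obtain ⟨St⟩ := hK V G hG
    have : Inhabited V := ⟨Classical.choice inferInstance⟩
    refine P5.decomp_of_PD G (P5.final St ?_)
    have : G.edgeSet = ↑(P5.gE G) := by
      ext e; rw [Finset.mem_coe, P5.mem_gE]
    rwa [this, Set.ncard_coe_finset] at h5
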